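/- arXiv:2406.16406 — 3 statements merged into one kernel-verified Lean document; each statement's English description precedes it below -/
import Mathlib

section
/- There is an algorithm (a computable function) which, given a morphism φ encoded as a function Fin m → List (Fin m), decides whether φ is growing, and if so, which of the three mutually exclusive classes (quasi-uniform, polynomially divergent, exponentially divergent) φ belongs to. -/
open Filter Asymptotics

variable {A : Type*}

/-- Extension of a morphism, given on letters, to words. -/
def wordMap (φ : A → List A) (w : List A) : List A := w.flatMap φ

/-- The factor of the infinite word α of length n starting at position i. -/
def factorAt (α : ℕ → A) (i n : ℕ) : List A := (List.range n).map (fun j => α (i + j))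

/-- w is a factor (contiguous subword) of the infinite word α. -/
def IsFactor (α : ℕ → A) (w : List A) : Prop := ∃ i, w = factorAt α i w.length

/-- The factor complexity of α: the number of distinct factors of length n. -/
noncomputable def complexity (α : ℕ → A) (n : ℕ) : ℕ :=
  Set.ncard {w : List A | w.length = n ∧ IsFactor α w}

def UltimatelyPeriodic (α : ℕ → A) : Prop :=
  ∃ N p : ℕ, 1 ≤ p ∧ ∀ i, N ≤ i → α (i + p) = α i

/-- φ is prolongable on a: φ(a) = a·w with w nonempty and |φ^n(a)| → ∞. -/
def Prolongable (φ : A → List A) (a : A) : Prop :=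
  (∃ w, w ≠ [] ∧ φ a = a :: w) ∧
    Tendsto (fun n => ((wordMap φ)^[n] [a]).length) atTop atTop

/-- α is the pure morphic sequence φ^∞(a): every iterate φ^n(a) is a prefix of α. -/
def IsFixedSeq (φ : A → List A) (a : A) (α : ℕ → A) : Prop :=
  ∀ n, factorAt α 0 ((wordMap φ)^[n] [a]).length = (wordMap φ)^[n] [a]

/-- The letter b is growing for φ: |φ^k(b)| → ∞. -/
def GrowingLetter (φ : A → List A) (b : A) : Prop :=
  Tendsto (fun k => ((wordMap φ)^[k] [b]).length) atTop atTop

def BoundedLetter (φ : A → List A) (b : A) : Prop := ¬ GrowingLetter φ b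

/-- φ is growing: every letter is growing. -/
def Growing (φ : A → List A) : Prop := ∀ b, GrowingLetter φ b

/-- φ is quasi-uniform: every letter has growth rate Θ(β^k) for a common β > 1. -/
def QuasiUniform (φ : A → List A) : Prop :=
  ∃ β : ℝ, 1 < β ∧ ∀ b,
    (fun k => (((wordMap φ)^[k] [b]).length : ℝ)) =Θ[atTop] (fun k => β ^ k)

/-- φ is polynomially divergent: every letter has rate Θ(k^(e b) β^k) for a common β > 1,
and at least one exponent e b is nonzero. -/
def PolyDivergent (φ : A → List A) : Prop :=
  ∃ β : ℝ, 1 < β ∧ ∃ e : A → ℕ,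
    (∀ b, (fun k => (((wordMap φ)^[k] [b]).length : ℝ)) =Θ[atTop]
      (fun k => (k : ℝ) ^ (e b) * β ^ k)) ∧
    ∃ b, 1 ≤ e b

/-- φ is exponentially divergent: every letter b has rate Θ(k^(e b) (β b)^k) with β b > 1,
and two letters have distinct β. -/
def ExpDivergent (φ : A → List A) : Prop :=
  ∃ (β : A → ℝ) (e : A → ℕ),
    (∀ b, 1 < β b ∧ (fun k => (((wordMap φ)^[k] [b]).length : ℝ)) =Θ[atTop]
      (fun k => (k : ℝ) ^ (e b) * (β b) ^ k)) ∧
    ∃ b c, β b ≠ β c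

/-- Encoding of a morphism on Fin m as a list of lists of naturals. -/
def encodeMorphism {m : ℕ} (φ : Fin m → List (Fin m)) : List (List ℕ) :=
  (List.finRange m).map (fun i => (φ i).map Fin.val)

namespace MorphismGrowth

set_option linter.unusedSectionVars false

section PathCounts

variable [Fintype A] [DecidableEq A]

/-- The sum of the row `b` of `M ^ k`: the number of paths of length `k` starting at `b`. -/
def rowSum (M : Matrix A A ℕ) (k : ℕ) (b : A) : ℕ := ∑ c, (M ^ k) b c

/-- `c` is accessible from `b` along edges of `M`. -/
def Reach (M : Matrix A A ℕ) (b c : A) : Prop := ∃ j, 0 < (M ^ j) b c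

/-- The matrix `M` with all columns outside `U` set to zero. -/
def restr (M : Matrix A A ℕ) (U : Finset A) : Matrix A A ℕ :=
  fun b c => if c ∈ U then M b c else 0

/-- `U` is closed under taking successors. -/
def ClosedSet (M : Matrix A A ℕ) (U : Finset A) : Prop :=
  ∀ b ∈ U, ∀ c, 0 < M b c → c ∈ U

/-- No row of `M` vanishes. -/
def Nonerasing (M : Matrix A A ℕ) : Prop := ∀ b, ∃ c, 0 < M b c

variable {M P Q : Matrix A A ℕ} {U V : Finset A}

@[simp] lemma rowSum_zero (b : A) : rowSum M 0 b = 1 := by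
  simp [rowSum, Matrix.one_apply]

lemma rowSum_add (k j : ℕ) (b : A) :
    rowSum M (k + j) b = ∑ c, (M ^ k) b c * rowSum M j c := by
  simp only [rowSum, pow_add, Matrix.mul_apply, Finset.mul_sum]
  exact Finset.sum_comm

lemma rowSum_one (b : A) : rowSum M 1 b = ∑ c, M b c := by
  simp [rowSum]

lemma rowSum_succ (k : ℕ) (b : A) :
    rowSum M (k + 1) b = ∑ c, M b c * rowSum M k c := by
  rw [add_comm, rowSum_add, pow_one]

lemma pow_mul_pow_le (i j : ℕ) (b c d : A) :
    (M ^ i) b c * (M ^ j) c d ≤ (M ^ (i + j)) b d := by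
  rw [pow_add, Matrix.mul_apply]
  exact Finset.single_le_sum (f := fun c => (M ^ i) b c * (M ^ j) c d)
    (fun _ _ => Nat.zero_le _) (Finset.mem_univ c)

lemma pow_pos_add {i j : ℕ} {b c d : A} (h : 0 < (M ^ i) b c) (h' : 0 < (M ^ j) c d) :
    0 < (M ^ (i + j)) b d :=
  (Nat.mul_pos h h').trans_le (pow_mul_pow_le i j b c d)

lemma exists_of_pow_succ_pos {j : ℕ} {b d : A} (h : 0 < (M ^ (j + 1)) b d) :
    ∃ c, 0 < M b c ∧ 0 < (M ^ j) c d := by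
  rw [pow_succ', Matrix.mul_apply] at h
  obtain ⟨c, -, hc⟩ := Finset.exists_ne_zero_of_sum_ne_zero h.ne'
  exact ⟨c, Nat.pos_of_ne_zero (left_ne_zero_of_mul hc),
    Nat.pos_of_ne_zero (right_ne_zero_of_mul hc)⟩

lemma Reach.refl (b : A) : Reach M b b := ⟨0, by simp⟩

lemma Reach.trans {b c d : A} : Reach M b c → Reach M c d → Reach M b d := by
  rintro ⟨i, hi⟩ ⟨j, hj⟩
  exact ⟨i + j, pow_pos_add hi hj⟩

lemma Reach.edge {b c : A} (h : 0 < M b c) : Reach M b c := ⟨1, by simpa⟩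

lemma ClosedSet.pow_mem (hU : ClosedSet M U) (k : ℕ) {b c : A} (hb : b ∈ U)
    (h : 0 < (M ^ k) b c) : c ∈ U := by
  induction k generalizing b with
  | zero =>
    rw [pow_zero, Matrix.one_apply] at h
    split_ifs at h with hbc
    · exact hbc ▸ hb
    · simp at h
  | succ k ih =>
    obtain ⟨d, hd, hdc⟩ := exists_of_pow_succ_pos h
    exact ih (hU b hb d hd) hdc

lemma ClosedSet.reach_mem (hU : ClosedSet M U) {b c : A} (hb : b ∈ U) (h : Reach M b c) :
    c ∈ U :=
  h.elim fun k hk => hU.pow_mem k hb hk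

lemma closedSet_restr : ClosedSet (restr M U) U := by
  intro b _ c h
  by_contra hc
  simp [restr, hc] at h

open Classical in
lemma closedSet_reach (b : A) : ClosedSet M {c | Reach M b c} := by
  intro c hc d hd
  simp only [Finset.mem_filter, Finset.mem_univ, true_and] at hc ⊢
  exact hc.trans (.edge hd)

lemma pow_le_pow_of_le (h : ∀ b c, P b c ≤ Q b c) (k : ℕ) (b c : A) :
    (P ^ k) b c ≤ (Q ^ k) b c := by
  induction k generalizing b with
  | zero => simp
  | succ k ih =>
    simp only [pow_succ', Matrix.mul_apply]
    exact Finset.sum_le_sum fun d _ => Nat.mul_le_mul (h b d) (ih d)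

lemma rowSum_le_of_le (h : ∀ b c, P b c ≤ Q b c) (k : ℕ) (b : A) :
    rowSum P k b ≤ rowSum Q k b :=
  Finset.sum_le_sum fun c _ => pow_le_pow_of_le h k b c

lemma restr_le (b c : A) : restr M U b c ≤ M b c := by
  unfold restr; split_ifs <;> simp

lemma restr_mono (h : U ⊆ V) (b c : A) : restr M U b c ≤ restr M V b c := by
  unfold restr
  split_ifs with h1 h2
  · exact le_rfl
  · exact absurd (h h1) h2
  · simp
  · simp

lemma rowSum_succ_le {R : ℕ} (hR : ∀ b, rowSum M 1 b ≤ R) (k : ℕ) (b : A) :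
    rowSum M (k + 1) b ≤ R * rowSum M k b := by
  rw [rowSum_add, rowSum, Finset.mul_sum]
  refine Finset.sum_le_sum fun c _ => ?_
  rw [mul_comm]
  exact Nat.mul_le_mul_right _ (hR c)

lemma rowSum_add_le {R : ℕ} (hR : ∀ b, rowSum M 1 b ≤ R) (k j : ℕ) (b : A) :
    rowSum M (k + j) b ≤ R ^ j * rowSum M k b := by
  induction j with
  | zero => simp
  | succ j ih =>
    calc rowSum M (k + (j + 1)) b ≤ R * rowSum M (k + j) b := rowSum_succ_le hR (k + j) b
      _ ≤ R * (R ^ j * rowSum M k b) := Nat.mul_le_mul_left _ ih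
      _ = R ^ (j + 1) * rowSum M k b := by ring

lemma exists_rowSum_bound (M : Matrix A A ℕ) : ∃ R : ℕ, ∀ b, rowSum M 1 b ≤ R :=
  ⟨∑ b, rowSum M 1 b, fun b => Finset.single_le_sum (f := fun b => rowSum M 1 b)
    (fun _ _ => Nat.zero_le _) (Finset.mem_univ b)⟩

lemma rowSum_le_rowSum_add {j : ℕ} {b c : A} (h : 0 < (M ^ j) b c) (k : ℕ) :
    rowSum M k c ≤ rowSum M (j + k) b := by
  rw [rowSum_add]
  calc rowSum M k c ≤ (M ^ j) b c * rowSum M k c := Nat.le_mul_of_pos_left _ h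
    _ ≤ _ := Finset.single_le_sum (f := fun c => (M ^ j) b c * rowSum M k c)
      (fun _ _ => Nat.zero_le _) (Finset.mem_univ c)

/-- On a closed set all of whose elements have a successor, row sums are monotone. -/
lemma rowSum_mono_of_closedSet (hU : ClosedSet M U) (h : ∀ b ∈ U, ∃ c, 0 < M b c) {b : A}
    (hb : b ∈ U) : Monotone fun k => rowSum M k b := by
  refine monotone_nat_of_le_succ fun k => ?_
  rw [rowSum_add, rowSum]
  refine Finset.sum_le_sum fun c _ => ?_
  rcases Nat.eq_zero_or_pos ((M ^ k) b c) with h0 | h0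
  · simp [h0]
  · obtain ⟨d, hd⟩ := h c (hU.pow_mem k hb h0)
    refine Nat.le_mul_of_pos_right _ (hd.trans_le ?_)
    rw [rowSum_one]
    exact Finset.single_le_sum (f := fun d => M c d) (fun _ _ => Nat.zero_le _)
      (Finset.mem_univ d)

lemma Nonerasing.rowSum_mono (hM : Nonerasing M) (b : A) : Monotone fun k => rowSum M k b :=
  rowSum_mono_of_closedSet (U := Finset.univ) (fun _ _ _ _ => Finset.mem_univ _)
    (fun b _ => hM b) (Finset.mem_univ b)

lemma ClosedSet.rowSum_add_eq (hU : ClosedSet M U) {b : A} (hb : b ∈ U) (k j : ℕ) :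
    rowSum M (k + j) b = ∑ c ∈ U, (M ^ k) b c * rowSum M j c := by
  rw [rowSum_add]
  symm
  refine Finset.sum_subset (Finset.subset_univ U) fun c _ hc => ?_
  rw [Nat.eq_zero_of_not_pos fun h => hc (hU.pow_mem k hb h), zero_mul]

lemma ClosedSet.rowSum_eq (hU : ClosedSet M U) {b : A} (hb : b ∈ U) (k : ℕ) :
    rowSum M k b = ∑ c ∈ U, (M ^ k) b c := by
  simpa using hU.rowSum_add_eq hb k 0

lemma ClosedSet.rowSum_mul_le (hU : ClosedSet M U) {k x : ℕ}
    (h : ∀ b ∈ U, rowSum M k b ≤ x) (j : ℕ) : ∀ b ∈ U, rowSum M (k * j) b ≤ x ^ j := by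
  induction j with
  | zero => simp
  | succ j ih =>
    intro b hb
    rw [Nat.mul_succ, add_comm (k * j), hU.rowSum_add_eq hb]
    calc ∑ c ∈ U, (M ^ k) b c * rowSum M (k * j) c ≤ ∑ c ∈ U, (M ^ k) b c * x ^ j :=
          Finset.sum_le_sum fun c hc => Nat.mul_le_mul_left _ (ih c hc)
      _ = rowSum M k b * x ^ j := by rw [← Finset.sum_mul, hU.rowSum_eq hb]
      _ ≤ x * x ^ j := Nat.mul_le_mul_right _ (h b hb)
      _ = x ^ (j + 1) := by ring

lemma ClosedSet.le_rowSum_mul (hU : ClosedSet M U) {k x : ℕ}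
    (h : ∀ b ∈ U, x ≤ rowSum M k b) (j : ℕ) : ∀ b ∈ U, x ^ j ≤ rowSum M (k * j) b := by
  induction j with
  | zero => simp
  | succ j ih =>
    intro b hb
    rw [Nat.mul_succ, add_comm (k * j), hU.rowSum_add_eq hb]
    calc x ^ (j + 1) = x * x ^ j := by ring
      _ ≤ rowSum M k b * x ^ j := Nat.mul_le_mul_right _ (h b hb)
      _ = ∑ c ∈ U, (M ^ k) b c * x ^ j := by rw [← Finset.sum_mul, hU.rowSum_eq hb]
      _ ≤ _ := Finset.sum_le_sum fun c hc => Nat.mul_le_mul_left _ (ih c hc)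

end PathCounts

section RealSequences

/-- Two-sided comparison of `a` with `(k + 1) ^ e * β ^ k`, valid for all `k`. -/
def HasRate (a : ℕ → ℝ) (e : ℕ) (β : ℝ) : Prop :=
  ∃ K : ℝ, 0 < K ∧ ∀ k : ℕ, ((k : ℝ) + 1) ^ e * β ^ k ≤ K * a k ∧
    a k ≤ K * (((k : ℝ) + 1) ^ e * β ^ k)

lemma exists_rate_of_quasi_multiplicative {a : ℕ → ℝ} {K : ℝ} (hK : 1 ≤ K) (ha : ∀ k, 1 ≤ a k)
    (hsub : ∀ k j, a (k + j) ≤ K * (a k * a j)) (hsup : ∀ k j, a k * a j ≤ K * a (k + j)) :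
    ∃ ρ : ℝ, 1 ≤ ρ ∧ ∀ k, ρ ^ k ≤ K * a k ∧ a k ≤ K * ρ ^ k := by
  have hK0 : 0 < K := by linarith
  have ha0 : ∀ k, 0 < a k := fun k => by linarith [ha k]
  have hlog : ∀ k, 0 ≤ Real.log (a k) := fun k => Real.log_nonneg (ha k)
  have hlogK : 0 ≤ Real.log K := Real.log_nonneg hK
  have hu : Subadditive fun k => Real.log (a k) + Real.log K := by
    intro k j
    have := Real.log_le_log (ha0 _) (hsub k j)
    rw [Real.log_mul hK0.ne' (mul_pos (ha0 k) (ha0 j)).ne',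
      Real.log_mul (ha0 k).ne' (ha0 j).ne'] at this
    linarith
  have hv : Subadditive fun k => Real.log K - Real.log (a k) := by
    intro k j
    have := Real.log_le_log (mul_pos (ha0 k) (ha0 j)) (hsup k j)
    rw [Real.log_mul hK0.ne' (ha0 _).ne', Real.log_mul (ha0 k).ne' (ha0 j).ne'] at this
    linarith
  have hubdd : BddBelow (Set.range fun n : ℕ => (Real.log (a n) + Real.log K) / n) := by
    refine ⟨0, ?_⟩
    rintro _ ⟨n, rfl⟩
    have := hlog n
    positivity
  have hulim := hu.tendsto_lim hubdd
  set l := hu.lim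
  have hvlim : Tendsto (fun n : ℕ => (Real.log K - Real.log (a n)) / n) atTop (nhds (-l)) := by
    have h2 : Tendsto (fun n : ℕ => 2 * Real.log K / n) atTop (nhds 0) :=
      tendsto_const_div_atTop_nhds_zero_nat _
    have h3 := h2.sub hulim
    rw [zero_sub] at h3
    refine h3.congr fun n => ?_
    rw [← sub_div]
    ring
  have hvbdd := hvlim.bddBelow_range
  have hveq : hv.lim = -l := tendsto_nhds_unique (hv.tendsto_lim hvbdd) hvlim
  have hl0 : 0 ≤ l := by
    refine ge_of_tendsto' hulim fun n => ?_
    have := hlog n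
    positivity
  refine ⟨Real.exp l, Real.one_le_exp hl0, fun k => ?_⟩
  rcases Nat.eq_zero_or_pos k with rfl | hk
  · have h1 := hsup 0 0
    have h2 := ha 0
    constructor
    · simp only [pow_zero]; nlinarith
    · simp only [pow_zero, mul_one]
      simp only [add_zero] at h1
      exact le_of_mul_le_mul_right h1 (ha0 0)
  · have hkR : (0 : ℝ) < k := by exact_mod_cast hk
    have h1 := hu.lim_le_div hubdd hk.ne'
    have h2 := hv.lim_le_div hvbdd hk.ne'
    rw [hveq] at h2
    rw [le_div_iff₀ hkR] at h1 h2
    rw [← Real.exp_nat_mul]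
    constructor
    · calc Real.exp (k * l) ≤ Real.exp (Real.log (a k) + Real.log K) :=
            Real.exp_le_exp.2 (by rw [mul_comm]; exact h1)
        _ = K * a k := by rw [Real.exp_add, Real.exp_log (ha0 k), Real.exp_log hK0, mul_comm]
    · calc a k = Real.exp (Real.log (a k)) := (Real.exp_log (ha0 k)).symm
        _ ≤ Real.exp (Real.log K + k * l) := Real.exp_le_exp.2 (by linarith)
        _ = K * Real.exp (k * l) := by rw [Real.exp_add, Real.exp_log hK0]

lemma tendsto_poly_mul_geometric (e : ℕ) {x y : ℝ} (hx : 0 ≤ x) (hxy : x < y) :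
    Tendsto (fun k : ℕ => ((k : ℝ) + 1) ^ e * x ^ k / y ^ k) atTop (nhds 0) := by
  have hy : 0 < y := hx.trans_lt hxy
  have h := (isLittleO_pow_const_mul_const_pow_const_pow_of_norm_lt (R := ℝ) e
    (r₁ := x) (r₂ := y) (by rwa [Real.norm_of_nonneg hx])).tendsto_div_nhds_zero
  have h2 := h.const_mul ((2 : ℝ) ^ e)
  rw [mul_zero] at h2
  refine squeeze_zero' (.of_forall fun k => by positivity) ?_ h2
  filter_upwards [eventually_ge_atTop 1] with k hk
  have hkR : (1 : ℝ) ≤ k := by exact_mod_cast hk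
  rw [← mul_div_assoc, ← mul_assoc, ← mul_pow]
  gcongr
  linarith

lemma eventually_poly_mul_geometric_lt (e : ℕ) (K : ℝ) {x y : ℝ} (hx : 0 ≤ x) (hxy : x < y) :
    ∀ᶠ k : ℕ in atTop, K * (((k : ℝ) + 1) ^ e * x ^ k) < y ^ k := by
  have hy : 0 < y := hx.trans_lt hxy
  have h := (tendsto_poly_mul_geometric e hx hxy).const_mul K
  rw [mul_zero] at h
  filter_upwards [h.eventually (gt_mem_nhds one_pos)] with k hk
  rwa [← mul_div_assoc, div_lt_one (by positivity)] at hk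

lemma exists_poly_mul_geometric_le (e : ℕ) {x y : ℝ} (hx : 0 ≤ x) (hxy : x < y) :
    ∃ K : ℝ, 0 < K ∧ ∀ k : ℕ, ((k : ℝ) + 1) ^ e * x ^ k ≤ K * y ^ k := by
  have hy : 0 < y := hx.trans_lt hxy
  obtain ⟨K, hK⟩ := (tendsto_poly_mul_geometric e hx hxy).bddAbove_range
  refine ⟨max K 1, by positivity, fun k => ?_⟩
  have := hK ⟨k, rfl⟩
  rw [div_le_iff₀ (by positivity)] at this
  exact this.trans (mul_le_mul_of_nonneg_right (le_max_left _ _) (by positivity))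

lemma exists_rate_le_of_lex_le {e e' : ℕ} {β β' : ℝ} (hβ' : 1 ≤ β')
    (h : toLex (β', e') ≤ toLex (β, e)) :
    ∃ K : ℝ, 0 < K ∧
      ∀ k : ℕ, ((k : ℝ) + 1) ^ e' * β' ^ k ≤ K * (((k : ℝ) + 1) ^ e * β ^ k) := by
  rcases Prod.Lex.toLex_le_toLex.1 h with h | ⟨h1, h2⟩
  · obtain ⟨K, hK, hle⟩ := exists_poly_mul_geometric_le e' (by linarith) h
    refine ⟨K, hK, fun k => (hle k).trans ?_⟩
    have : (0 : ℝ) ≤ β ^ k := pow_nonneg (by simp only at h; linarith) k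
    gcongr
    exact le_mul_of_one_le_left this (one_le_pow₀ (by linarith [(Nat.cast_nonneg k : (0:ℝ) ≤ k)]))
  · refine ⟨1, one_pos, fun k => ?_⟩
    simp only at h1 h2
    subst h1
    rw [one_mul]
    gcongr
    linarith [(Nat.cast_nonneg k : (0:ℝ) ≤ k)]

lemma sum_geometric_mul_le_right {x y : ℝ} (hx : 0 ≤ x) (hxy : x < y) (k : ℕ) :
    ∑ i ∈ Finset.range k, x ^ i * y ^ (k - 1 - i) ≤ (y - x)⁻¹ * y ^ k := by
  have h := geom_sum₂_mul x y k
  have h1 : 0 < y - x := by linarith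
  rw [le_inv_mul_iff₀ h1]
  have : 0 ≤ x ^ k := by positivity
  linarith

lemma sum_geometric_mul_le_left {x y : ℝ} (hx : 0 ≤ x) (hxy : x < y) (k : ℕ) :
    ∑ i ∈ Finset.range k, y ^ i * x ^ (k - 1 - i) ≤ (y - x)⁻¹ * y ^ k := by
  have h := geom_sum₂_mul y x k
  have h1 : 0 < y - x := by linarith
  rw [le_inv_mul_iff₀ h1]
  have : 0 ≤ x ^ k := by positivity
  linarith

lemma convolution_le_of_eq {ρ : ℝ} (hρ : 1 ≤ ρ) (e k : ℕ) :
    ∑ i ∈ Finset.range k, ρ ^ i * ((((k - 1 - i : ℕ) : ℝ) + 1) ^ e * ρ ^ (k - 1 - i)) ≤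
      ((k : ℝ) + 1) ^ (e + 1) * ρ ^ k := by
  have hterm : ∀ i ∈ Finset.range k,
      ρ ^ i * ((((k - 1 - i : ℕ) : ℝ) + 1) ^ e * ρ ^ (k - 1 - i)) ≤ ((k : ℝ) + 1) ^ e * ρ ^ k := by
    intro i hi
    rw [Finset.mem_range] at hi
    rw [mul_left_comm, ← pow_add]
    gcongr
    all_goals omega
  refine (Finset.sum_le_sum hterm).trans ?_
  rw [Finset.sum_const, Finset.card_range, nsmul_eq_mul, pow_succ]
  have : 0 ≤ ((k : ℝ) + 1) ^ e * ρ ^ k := by positivity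
  nlinarith

lemma exists_convolution_le_of_lt {ρ β : ℝ} (hρ : 1 ≤ ρ) (h : ρ < β) (e : ℕ) :
    ∃ K : ℝ, 0 < K ∧ ∀ k : ℕ,
      ∑ i ∈ Finset.range k, ρ ^ i * ((((k - 1 - i : ℕ) : ℝ) + 1) ^ e * β ^ (k - 1 - i)) ≤
        K * (((k : ℝ) + 1) ^ e * β ^ k) := by
  refine ⟨(β - ρ)⁻¹, by simpa using h, fun k => ?_⟩
  have hβ : 0 < β := by linarith
  have hterm : ∀ i ∈ Finset.range k,
      ρ ^ i * ((((k - 1 - i : ℕ) : ℝ) + 1) ^ e * β ^ (k - 1 - i)) ≤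
        ((k : ℝ) + 1) ^ e * (ρ ^ i * β ^ (k - 1 - i)) := by
    intro i hi
    rw [mul_left_comm]
    gcongr
    omega
  refine (Finset.sum_le_sum hterm).trans ?_
  rw [← Finset.mul_sum, mul_left_comm]
  gcongr
  exact sum_geometric_mul_le_right (by linarith) h k

lemma exists_convolution_le_of_gt {ρ β : ℝ} (hβ : 1 ≤ β) (h : β < ρ) (e : ℕ) :
    ∃ K : ℝ, 0 < K ∧ ∀ k : ℕ,
      ∑ i ∈ Finset.range k, ρ ^ i * ((((k - 1 - i : ℕ) : ℝ) + 1) ^ e * β ^ (k - 1 - i)) ≤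
        K * ρ ^ k := by
  obtain ⟨γ, h1, h2⟩ := exists_between h
  obtain ⟨K, hK, hle⟩ := exists_poly_mul_geometric_le e (by linarith) h1
  have hρ : 0 < ρ := by linarith
  have h3 : 0 < ρ - γ := by linarith
  refine ⟨K * (ρ - γ)⁻¹, by positivity, fun k => ?_⟩
  calc _ ≤ ∑ i ∈ Finset.range k, ρ ^ i * (K * γ ^ (k - 1 - i)) := by
        exact Finset.sum_le_sum fun i _ => mul_le_mul_of_nonneg_left (hle _) (by positivity)
    _ = K * ∑ i ∈ Finset.range k, ρ ^ i * γ ^ (k - 1 - i) := by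
        rw [Finset.mul_sum]
        exact Finset.sum_congr rfl fun i _ => by ring
    _ ≤ K * ((ρ - γ)⁻¹ * ρ ^ k) := by
        gcongr
        exact sum_geometric_mul_le_left (by linarith) h2 k
    _ = _ := by ring

lemma succ_pow_le (n e : ℕ) : (n + 1) ^ (e + 1) ≤ n ^ (e + 1) + (e + 1) * (n + 1) ^ e := by
  induction e with
  | zero => simp
  | succ e ih =>
    have h1 : n ^ (e + 1) ≤ (n + 1) ^ (e + 1) := Nat.pow_le_pow_left (Nat.le_succ n) _
    calc (n + 1) ^ (e + 1 + 1) = (n + 1) ^ (e + 1) * (n + 1) := pow_succ _ _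
      _ ≤ (n ^ (e + 1) + (e + 1) * (n + 1) ^ e) * (n + 1) := Nat.mul_le_mul_right _ ih
      _ = n ^ (e + 1 + 1) + n ^ (e + 1) + (e + 1) * (n + 1) ^ (e + 1) := by ring
      _ ≤ n ^ (e + 1 + 1) + (n + 1) ^ (e + 1) + (e + 1) * (n + 1) ^ (e + 1) := by gcongr
      _ = _ := by ring

lemma pow_succ_le_sum (n e : ℕ) :
    n ^ (e + 1) ≤ (e + 1) * ∑ j ∈ Finset.range n, (j + 1) ^ e := by
  induction n with
  | zero => simp
  | succ n ih =>
    rw [Finset.sum_range_succ, mul_add]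
    exact (succ_pow_le n e).trans (Nat.add_le_add_right ih _)

/-- A lower bound for a convolution sampled along the multiples of `q`. -/
lemma pow_succ_mul_pow_le_convolution {ρ : ℝ} (hρ : 1 ≤ ρ) (e : ℕ) {q : ℕ} (hq : 1 ≤ q) (n : ℕ) :
    (n : ℝ) ^ (e + 1) * ρ ^ (n * q) ≤ ((e : ℝ) + 1) * ρ ^ q *
      ∑ i ∈ Finset.range n,
        ρ ^ (i * q) * (((((n - 1 - i) * q : ℕ) : ℝ) + 1) ^ e * ρ ^ ((n - 1 - i) * q)) := by
  have hterm : ∀ i ∈ Finset.range n, (((n - 1 - i : ℕ) : ℝ) + 1) ^ e * ρ ^ (n * q) ≤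
      ρ ^ q * (ρ ^ (i * q) *
        (((((n - 1 - i) * q : ℕ) : ℝ) + 1) ^ e * ρ ^ ((n - 1 - i) * q))) := by
    intro i hi
    rw [Finset.mem_range] at hi
    have h1 : n * q = q + (i * q + (n - 1 - i) * q) := by
      obtain ⟨d, rfl⟩ : ∃ d, n = i + 1 + d := ⟨n - (i + 1), by omega⟩
      have : i + 1 + d - 1 - i = d := by omega
      rw [this]; ring
    have h2 : ((n - 1 - i : ℕ) : ℝ) ≤ (((n - 1 - i) * q : ℕ) : ℝ) := by
      exact_mod_cast Nat.le_mul_of_pos_right _ hq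
    calc (((n - 1 - i : ℕ) : ℝ) + 1) ^ e * ρ ^ (n * q)
        ≤ ((((n - 1 - i) * q : ℕ) : ℝ) + 1) ^ e * ρ ^ (n * q) := by gcongr
      _ = _ := by rw [h1, pow_add, pow_add]; ring
  have hsum := Finset.sum_le_sum hterm
  rw [← Finset.sum_mul, ← Finset.mul_sum,
    Finset.sum_range_reflect (fun j : ℕ => ((j : ℝ) + 1) ^ e)] at hsum
  have h3 : (n : ℝ) ^ (e + 1) ≤ ((e : ℝ) + 1) * ∑ j ∈ Finset.range n, ((j : ℝ) + 1) ^ e := by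
    exact_mod_cast pow_succ_le_sum n e
  calc (n : ℝ) ^ (e + 1) * ρ ^ (n * q)
      ≤ (((e : ℝ) + 1) * ∑ j ∈ Finset.range n, ((j : ℝ) + 1) ^ e) * ρ ^ (n * q) := by gcongr
    _ = ((e : ℝ) + 1) * ((∑ j ∈ Finset.range n, ((j : ℝ) + 1) ^ e) * ρ ^ (n * q)) := by ring
    _ ≤ ((e : ℝ) + 1) * (ρ ^ q * _) := by gcongr
    _ = _ := by ring

end RealSequences

section Blocks

variable [Fintype A] [DecidableEq A] {M : Matrix A A ℕ}

/-- `C` is a nonempty irreducible set of indices whose paths inside `C` grow like `ρ ^ k`. -/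
def Block (M : Matrix A A ℕ) (C : Finset A) (ρ : ℝ) : Prop :=
  C.Nonempty ∧ 1 ≤ ρ ∧ (∀ c ∈ C, ∀ d ∈ C, ∃ j, 0 < (restr M C ^ j) c d) ∧
    ∃ K : ℝ, 0 < K ∧ ∀ c ∈ C, ∀ k, ρ ^ k ≤ K * rowSum (restr M C) k c ∧
      (rowSum (restr M C) k c : ℝ) ≤ K * ρ ^ k

lemma exists_block {C : Finset A} (hC : C.Nonempty)
    (hirr : ∀ c ∈ C, ∀ d ∈ C, ∃ j, 0 < (restr M C ^ j) c d)
    (hsucc : ∀ c ∈ C, ∃ d, 0 < restr M C c d) : ∃ ρ, Block M C ρ := by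
  have hcl : ClosedSet (restr M C) C := closedSet_restr
  obtain ⟨R, hR⟩ := exists_rowSum_bound (restr M C)
  obtain ⟨K, hK1, hK⟩ : ∃ K : ℕ, 1 ≤ K ∧ ∀ c ∈ C, ∀ d ∈ C, ∀ k,
      rowSum (restr M C) k d ≤ K * rowSum (restr M C) k c := by
    choose! j hj using hirr
    refine ⟨1 + ∑ c, ∑ d, R ^ j c d, by omega, fun c hc d hd k => ?_⟩
    calc rowSum (restr M C) k d ≤ rowSum (restr M C) (j c d + k) c :=
          rowSum_le_rowSum_add (hj c hc d hd) k
      _ ≤ R ^ j c d * rowSum (restr M C) k c := by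
          rw [add_comm]; exact rowSum_add_le hR k _ c
      _ ≤ _ := by
          refine Nat.mul_le_mul_right _ (le_add_left ?_)
          exact (Finset.single_le_sum (f := fun d => R ^ j c d) (fun _ _ => Nat.zero_le _)
            (Finset.mem_univ d)).trans (Finset.single_le_sum
              (f := fun c => ∑ d, R ^ j c d) (fun _ _ => Nat.zero_le _) (Finset.mem_univ c))
  obtain ⟨b, hb⟩ := hC
  have hpos : ∀ k, 1 ≤ rowSum (restr M C) k b := fun k => by
    simpa using rowSum_mono_of_closedSet hcl hsucc hb (Nat.zero_le k)
  have hsub : ∀ k j, rowSum (restr M C) (k + j) b ≤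
      K * (rowSum (restr M C) k b * rowSum (restr M C) j b) := by
    intro k j
    rw [hcl.rowSum_add_eq hb, hcl.rowSum_eq hb k, Finset.sum_mul, Finset.mul_sum]
    refine Finset.sum_le_sum fun c hc => ?_
    rw [mul_left_comm]
    exact Nat.mul_le_mul_left _ (hK b hb c hc j)
  have hsup : ∀ k j, rowSum (restr M C) k b * rowSum (restr M C) j b ≤
      K * rowSum (restr M C) (k + j) b := by
    intro k j
    rw [hcl.rowSum_add_eq hb, hcl.rowSum_eq hb k, Finset.sum_mul, Finset.mul_sum]
    refine Finset.sum_le_sum fun c hc => ?_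
    rw [mul_left_comm]
    exact Nat.mul_le_mul_left _ (hK c hc b hb j)
  obtain ⟨ρ, hρ, hab⟩ := exists_rate_of_quasi_multiplicative
    (a := fun k => (rowSum (restr M C) k b : ℝ)) (K := K) (by exact_mod_cast hK1)
    (fun k => by exact_mod_cast hpos k) (fun k j => by exact_mod_cast hsub k j)
    (fun k j => by exact_mod_cast hsup k j)
  have hK0 : (0 : ℝ) < K := by exact_mod_cast hK1
  refine ⟨ρ, ⟨b, hb⟩, hρ, hirr, K * K, by positivity, fun c hc k => ⟨?_, ?_⟩⟩
  · have h1 : (rowSum (restr M C) k b : ℝ) ≤ K * rowSum (restr M C) k c := by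
      exact_mod_cast hK c hc b hb k
    calc ρ ^ k ≤ K * rowSum (restr M C) k b := (hab k).1
      _ ≤ K * (K * rowSum (restr M C) k c) := by gcongr
      _ = _ := by ring
  · have h1 : (rowSum (restr M C) k c : ℝ) ≤ K * rowSum (restr M C) k b := by
      exact_mod_cast hK b hb c hc k
    calc (rowSum (restr M C) k c : ℝ) ≤ K * rowSum (restr M C) k b := h1
      _ ≤ K * (K * ρ ^ k) := by gcongr; exact (hab k).2
      _ = _ := by ring

/-- The strongly connected component of `b`. -/
noncomputable def component (M : Matrix A A ℕ) (b : A) : Finset A :=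
  open Classical in {c | Reach M b c ∧ Reach M c b}

lemma mem_component {b c : A} : c ∈ component M b ↔ Reach M b c ∧ Reach M c b := by
  simp [component]

lemma component_irreducible {b c d : A} (hc : c ∈ component M b) (hd : d ∈ component M b) :
    ∃ j, 0 < (restr M (component M b) ^ j) c d := by
  obtain ⟨j, hj⟩ : Reach M c d := (mem_component.1 hc).2.trans (mem_component.1 hd).1
  refine ⟨j, ?_⟩
  induction j generalizing c with
  | zero => simpa using hj
  | succ j ih =>
    obtain ⟨x, hx, hxd⟩ := exists_of_pow_succ_pos hj
    have hxC : x ∈ component M b := mem_component.2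
      ⟨(mem_component.1 hc).1.trans (.edge hx), Reach.trans ⟨j, hxd⟩ (mem_component.1 hd).2⟩
    rw [add_comm]
    refine pow_pos_add (c := x) ?_ (ih hxC hxd)
    rw [pow_one]
    simpa [restr, hxC] using hx

lemma exists_block_component {b c : A} (hc : c ∈ component M b) (hbc : 0 < M b c) :
    ∃ ρ, Block M (component M b) ρ := by
  have hb : b ∈ component M b := mem_component.2 ⟨.refl b, .refl b⟩
  refine exists_block ⟨b, hb⟩ (fun c hc d hd => component_irreducible hc hd) fun d hd => ?_
  obtain ⟨j, hj⟩ := component_irreducible hd hb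
  cases j with
  | zero =>
    rcases eq_or_ne d b with rfl | h
    · exact ⟨c, by simpa [restr, hc] using hbc⟩
    · simp [h] at hj
  | succ j =>
    obtain ⟨x, hx, -⟩ := exists_of_pow_succ_pos hj
    exact ⟨x, hx⟩

/-- If every element of `U` leads into a closed set `F` disjoint from `U`, the paths leaving `U`
for `F` at various times give a convolution lower bound for the row sums of `M`. -/
lemma exists_convolution_le_rowSum (hM : Nonerasing M) {F U : Finset A} (hF : ClosedSet M F)
    (hdisj : Disjoint U F) (h : ℕ → ℝ)
    (hr : ∀ u ∈ U, ∃ f ∈ F, Reach M u f ∧ ∀ k, h k ≤ rowSum M k f) :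
    ∃ q, 1 ≤ q ∧ ∀ n, ∀ u ∈ U, ∑ i ∈ Finset.range n,
      (rowSum (restr M U) (i * q) u : ℝ) * h ((n - 1 - i) * q) ≤ rowSum M (n * q) u := by
  choose! f hfF hf hhf using hr
  choose! j hj using hf
  have hjq : ∀ u, j u ≤ 1 + ∑ u, j u := fun u => le_add_left
    (Finset.single_le_sum (f := j) (fun _ _ => Nat.zero_le _) (Finset.mem_univ u))
  have hq1 : 1 ≤ 1 + ∑ u, j u := by omega
  generalize 1 + ∑ u, j u = q at hjq hq1
  refine ⟨q, hq1, ?_⟩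
  have hkey : ∀ u ∈ U, ∀ k, rowSum M k (f u) ≤ ∑ d ∈ F, (M ^ q) u d * rowSum M k d := by
    intro u hu k
    obtain ⟨r, rfl⟩ := Nat.exists_eq_add_of_le (hjq u)
    calc rowSum M k (f u) ≤ rowSum M (r + k) (f u) :=
          hM.rowSum_mono (f u) (Nat.le_add_left k r)
      _ = ∑ d ∈ F, (M ^ r) (f u) d * rowSum M k d := hF.rowSum_add_eq (hfF u hu) r k
      _ ≤ _ := Finset.sum_le_sum fun d _ => Nat.mul_le_mul_right _
        ((Nat.le_mul_of_pos_left _ (hj u hu)).trans (pow_mul_pow_le _ _ _ _ _))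
  have hstep : ∀ u ∈ U, ∀ k, ∑ d ∈ U, ((restr M U ^ q) u d : ℝ) * rowSum M k d + h k ≤
      rowSum M (q + k) u := by
    intro u hu k
    have h1 : ∑ d ∈ U, (restr M U ^ q) u d * rowSum M k d +
        ∑ d ∈ F, (M ^ q) u d * rowSum M k d ≤ rowSum M (q + k) u := by
      rw [rowSum_add]
      calc _ ≤ ∑ d ∈ U, (M ^ q) u d * rowSum M k d + ∑ d ∈ F, (M ^ q) u d * rowSum M k d :=
            Nat.add_le_add_right (Finset.sum_le_sum fun d _ =>
              Nat.mul_le_mul_right _ (pow_le_pow_of_le restr_le q u d)) _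
        _ = ∑ d ∈ U ∪ F, (M ^ q) u d * rowSum M k d := (Finset.sum_union hdisj).symm
        _ ≤ _ := Finset.sum_le_sum_of_subset (Finset.subset_univ _)
    have h2 := (Nat.add_le_add_left (hkey u hu k) _).trans h1
    have h3 : (∑ d ∈ U, ((restr M U ^ q) u d : ℝ) * rowSum M k d) + rowSum M k (f u) ≤
        rowSum M (q + k) u := by exact_mod_cast h2
    linarith [hhf u hu k]
  intro n
  induction n with
  | zero => simp
  | succ n ih =>
    intro u hu
    have hexp : ∀ i, (rowSum (restr M U) ((i + 1) * q) u : ℝ) =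
        ∑ d ∈ U, ((restr M U ^ q) u d : ℝ) * rowSum (restr M U) (i * q) d := fun i => by
      rw [show (i + 1) * q = q + i * q by ring,
        (closedSet_restr (M := M) (U := U)).rowSum_add_eq hu]
      push_cast
      rfl
    rw [Finset.sum_range_succ', show (n + 1) * q = q + n * q by ring]
    refine le_trans ?_ (hstep u hu (n * q))
    have h0 : (rowSum (restr M U) (0 * q) u : ℝ) * h ((n + 1 - 1 - 0) * q) = h (n * q) := by
      simp
    rw [h0]
    gcongr
    calc _ = ∑ d ∈ U, ((restr M U ^ q) u d : ℝ) * ∑ i ∈ Finset.range n,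
          (rowSum (restr M U) (i * q) d : ℝ) * h ((n - 1 - i) * q) := by
          simp only [hexp, Finset.mul_sum, Finset.sum_mul]
          rw [Finset.sum_comm]
          refine Finset.sum_congr rfl fun d _ => Finset.sum_congr rfl fun i _ => ?_
          rw [show n + 1 - 1 - (i + 1) = n - 1 - i by omega]
          ring
      _ ≤ _ := Finset.sum_le_sum fun d hd => mul_le_mul_of_nonneg_left (ih d hd) (by positivity)

end Blocks

section Rates

variable [Fintype A] [DecidableEq A] {M : Matrix A A ℕ}

lemma HasRate.of_le {a : ℕ → ℝ} {e : ℕ} {β : ℝ} (hβ : 0 ≤ β) (ha : ∀ k, 0 ≤ a k)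
    (hl : ∃ K : ℝ, 0 < K ∧ ∀ k : ℕ, ((k : ℝ) + 1) ^ e * β ^ k ≤ K * a k)
    (hu : ∃ K : ℝ, 0 < K ∧ ∀ k : ℕ, a k ≤ K * (((k : ℝ) + 1) ^ e * β ^ k)) :
    HasRate a e β := by
  obtain ⟨K₁, h₁, hl⟩ := hl
  obtain ⟨K₂, h₂, hu⟩ := hu
  refine ⟨K₁ + K₂, by positivity, fun k => ⟨(hl k).trans ?_, (hu k).trans ?_⟩⟩
  · nlinarith [mul_nonneg h₂.le (ha k)]
  · have : 0 ≤ ((k : ℝ) + 1) ^ e * β ^ k := by positivity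
    nlinarith [mul_nonneg h₁.le this]

lemma Reach.exists_rowSum_le {b c : A} (h : Reach M b c) :
    ∃ K : ℝ, 0 < K ∧ ∀ k, (rowSum M k c : ℝ) ≤ K * rowSum M k b := by
  obtain ⟨j, hj⟩ := h
  obtain ⟨R, hR⟩ := exists_rowSum_bound M
  refine ⟨(R ^ j + 1 : ℕ), by positivity, fun k => ?_⟩
  have : rowSum M k c ≤ (R ^ j + 1) * rowSum M k b :=
    calc rowSum M k c ≤ rowSum M (k + j) b := by
          rw [add_comm]; exact rowSum_le_rowSum_add hj k
      _ ≤ R ^ j * rowSum M k b := rowSum_add_le hR k j b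
      _ ≤ _ := Nat.mul_le_mul_right _ (Nat.le_succ _)
  exact_mod_cast this

/-- A lower bound along the multiples of `q` extends to all exponents. -/
lemma exists_le_rowSum_of_multiples (hM : Nonerasing M) {b : A} {ρ K : ℝ} (hρ : 1 ≤ ρ)
    (hK : 0 < K) {q e : ℕ} (hq : 1 ≤ q)
    (h : ∀ n : ℕ, (n : ℝ) ^ e * ρ ^ (n * q) ≤ K * rowSum M (n * q) b) :
    ∃ K' : ℝ, 0 < K' ∧ ∀ k : ℕ, ((k : ℝ) + 1) ^ e * ρ ^ k ≤ K' * rowSum M k b := by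
  obtain ⟨R, hR⟩ := exists_rowSum_bound M
  refine ⟨(q : ℝ) ^ e * K * (R ^ q + 1), by positivity, fun k => ?_⟩
  have hk1 : k + 1 ≤ (k / q + 1) * q := by
    have := Nat.lt_div_mul_add (a := k) (b := q) hq
    rw [add_mul]; omega
  have hk2 : (k / q + 1) * q ≤ k + q := by
    have := Nat.div_mul_le_self k q
    rw [add_mul]; omega
  have h1 : ((k : ℝ) + 1) ≤ (q : ℝ) * ((k / q + 1 : ℕ) : ℝ) := by
    rw [mul_comm]; exact_mod_cast hk1
  have h2 : (rowSum M ((k / q + 1) * q) b : ℝ) ≤ (R ^ q + 1) * rowSum M k b := by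
    have : rowSum M ((k / q + 1) * q) b ≤ (R ^ q + 1) * rowSum M k b :=
      (hM.rowSum_mono b hk2).trans ((rowSum_add_le hR k q b).trans
        (Nat.mul_le_mul_right _ (Nat.le_succ _)))
    exact_mod_cast this
  calc ((k : ℝ) + 1) ^ e * ρ ^ k
      ≤ ((q : ℝ) * ((k / q + 1 : ℕ) : ℝ)) ^ e * ρ ^ ((k / q + 1) * q) := by
        gcongr
        omega
    _ = (q : ℝ) ^ e * (((k / q + 1 : ℕ) : ℝ) ^ e * ρ ^ ((k / q + 1) * q)) := by
        rw [mul_pow]; ring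
    _ ≤ (q : ℝ) ^ e * (K * rowSum M ((k / q + 1) * q) b) := 
        mul_le_mul_of_nonneg_left (h _) (by positivity)
    _ ≤ (q : ℝ) ^ e * (K * ((R ^ q + 1) * rowSum M k b)) := by gcongr
    _ = _ := by ring

lemma rowSum_le_convolution {C : Finset A} {h : ℕ → ℝ} {K : ℝ}
    (hout : ∀ c ∈ C, ∀ k, ∑ t ∈ Cᶜ, (M c t : ℝ) * rowSum M k t ≤ K * h k) (k : ℕ) :
    ∀ c ∈ C, (rowSum M k c : ℝ) ≤ rowSum (restr M C) k c +
      K * ∑ i ∈ Finset.range k, (rowSum (restr M C) i c : ℝ) * h (k - 1 - i) := by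
  induction k with
  | zero => simp
  | succ k ih =>
    intro c hc
    have hexp : ∀ i, (rowSum (restr M C) (i + 1) c : ℝ) =
        ∑ d ∈ C, (M c d : ℝ) * rowSum (restr M C) i d := fun i => by
      rw [add_comm, (closedSet_restr (M := M) (U := C)).rowSum_add_eq hc]
      push_cast
      refine Finset.sum_congr rfl fun d hd => ?_
      simp [restr, hd]
    have hsplit : (rowSum M (k + 1) c : ℝ) =
        ∑ d ∈ C, (M c d : ℝ) * rowSum M k d + ∑ t ∈ Cᶜ, (M c t : ℝ) * rowSum M k t := by
      rw [Finset.sum_add_sum_compl, rowSum_succ]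
      push_cast
      rfl
    rw [hsplit, Finset.sum_range_succ']
    have h0 : (rowSum (restr M C) 0 c : ℝ) * h (k + 1 - 1 - 0) = h k := by simp
    rw [h0, mul_add, ← add_assoc]
    refine add_le_add ?_ (hout c hc k)
    calc ∑ d ∈ C, (M c d : ℝ) * rowSum M k d
        ≤ ∑ d ∈ C, (M c d : ℝ) * (rowSum (restr M C) k d +
          K * ∑ i ∈ Finset.range k, (rowSum (restr M C) i d : ℝ) * h (k - 1 - i)) :=
          Finset.sum_le_sum fun d hd => mul_le_mul_of_nonneg_left (ih d hd) (by positivity)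
      _ = _ := by
          simp only [mul_add, Finset.sum_add_distrib, hexp]
          congr 1
          simp only [Finset.mul_sum, Finset.sum_mul]
          rw [Finset.sum_comm]
          refine Finset.sum_congr rfl fun d _ => Finset.sum_congr rfl fun i _ => ?_
          rw [show k + 1 - 1 - (d + 1) = k - 1 - d by omega]
          ring

/-- The growth rate of a strongly connected component together with everything below it, when
the latter has the rate `(k + 1) ^ e * β ^ k`, attained at `t`. -/
lemma hasRate_of_component (hM : Nonerasing M) {b t : A} {ρ β K : ℝ} {e : ℕ}
    (hB : Block M (component M b) ρ) (hβ : 1 ≤ β) (hK : 0 < K)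
    (hout : ∀ c ∈ component M b, ∀ k, ∑ t ∈ (component M b)ᶜ, (M c t : ℝ) * rowSum M k t ≤
      K * (((k : ℝ) + 1) ^ e * β ^ k))
    (hbt : Reach M b t) (htb : ¬ Reach M t b) (ht : HasRate (fun k => rowSum M k t) e β) :
    (ρ < β ∧ HasRate (fun k => rowSum M k b) e β) ∨
    (ρ = β ∧ HasRate (fun k => rowSum M k b) (e + 1) β) ∨
    (β < ρ ∧ HasRate (fun k => rowSum M k b) 0 ρ) := by
  obtain ⟨-, hρ, -, K₂, hK₂, hB⟩ := hB
  obtain ⟨Kt, hKt, ht⟩ := ht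
  have hb : b ∈ component M b := mem_component.2 ⟨.refl b, .refl b⟩
  have hnn : ∀ k, (0 : ℝ) ≤ rowSum M k b := fun k => Nat.cast_nonneg _
  have hup : ∀ k, (rowSum M k b : ℝ) ≤ K₂ * ρ ^ k + K * (K₂ * ∑ i ∈ Finset.range k,
      ρ ^ i * ((((k - 1 - i : ℕ) : ℝ) + 1) ^ e * β ^ (k - 1 - i))) := by
    intro k
    refine (rowSum_le_convolution hout k b hb).trans ?_
    gcongr
    · exact (hB b hb k).2
    · rw [Finset.mul_sum]
      refine Finset.sum_le_sum fun i _ => ?_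
      rw [← mul_assoc K₂]
      exact mul_le_mul_of_nonneg_right (hB b hb i).2 (by positivity)
  have hone : ∀ k : ℕ, (1 : ℝ) ≤ (k : ℝ) + 1 := fun k => by
    linarith [(Nat.cast_nonneg k : (0 : ℝ) ≤ k)]
  have hone' : ∀ k n : ℕ, (1 : ℝ) ≤ ((k : ℝ) + 1) ^ n := fun k n => one_le_pow₀ (hone k)
  rcases lt_trichotomy ρ β with hlt | heq | hgt
  · refine Or.inl ⟨hlt, .of_le (by linarith) hnn ?_ ?_⟩
    · obtain ⟨K', hK', h⟩ := hbt.exists_rowSum_le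
      refine ⟨Kt * K', by positivity, fun k => (ht k).1.trans ?_⟩
      rw [mul_assoc]
      gcongr
      exact h k
    · obtain ⟨K', hK', h⟩ := exists_convolution_le_of_lt hρ hlt e
      refine ⟨K₂ + K * (K₂ * K'), by positivity, fun k => (hup k).trans ?_⟩
      rw [add_mul]
      refine add_le_add (mul_le_mul_of_nonneg_left ?_ hK₂.le) ?_
      · calc ρ ^ k ≤ β ^ k := by gcongr
          _ ≤ _ := le_mul_of_one_le_left (by positivity) (hone' k e)
      · rw [mul_assoc, mul_assoc]
        exact mul_le_mul_of_nonneg_left (mul_le_mul_of_nonneg_left (h k) hK₂.le) hK.le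
  · subst heq
    refine Or.inr (Or.inl ⟨rfl, .of_le (by linarith) hnn ?_ ?_⟩)
    · classical
      obtain ⟨q, hq, hconv⟩ := exists_convolution_le_rowSum hM (closedSet_reach (M := M) t)
        (U := component M b) (h := fun k => rowSum M k t)
        (by
          rw [Finset.disjoint_left]
          intro c hc hc'
          simp only [Finset.mem_filter, Finset.mem_univ, true_and] at hc'
          exact htb (hc'.trans (mem_component.1 hc).2))
        (fun c hc => ⟨t, by simpa using Reach.refl t, (mem_component.1 hc).2.trans hbt,
          fun _ => le_rfl⟩)
      refine exists_le_rowSum_of_multiples hM hρ (q := q)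
        (K := ((e : ℝ) + 1) * ρ ^ q * (K₂ * Kt)) (by positivity) hq fun n => ?_
      refine (pow_succ_mul_pow_le_convolution hρ e hq n).trans ?_
      rw [mul_assoc (((e : ℝ) + 1) * ρ ^ q)]
      gcongr
      refine le_trans ?_ (mul_le_mul_of_nonneg_left (hconv n b hb) (by positivity))
      rw [Finset.mul_sum]
      refine Finset.sum_le_sum fun i _ => ?_
      rw [mul_mul_mul_comm]
      exact mul_le_mul (hB b hb _).1 (ht _).1 (by positivity) (by positivity)
    · refine ⟨K₂ + K * K₂, by positivity, fun k => (hup k).trans ?_⟩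
      rw [add_mul]
      refine add_le_add (mul_le_mul_of_nonneg_left ?_ hK₂.le) ?_
      · exact le_mul_of_one_le_left (by positivity) (hone' k _)
      · rw [mul_assoc]
        exact mul_le_mul_of_nonneg_left
          (mul_le_mul_of_nonneg_left (convolution_le_of_eq hρ e k) hK₂.le) hK.le
  · refine Or.inr (Or.inr ⟨hgt, .of_le (by linarith) hnn ?_ ?_⟩)
    · refine ⟨K₂, hK₂, fun k => ?_⟩
      rw [pow_zero, one_mul]
      refine (hB b hb k).1.trans ?_
      gcongr
      exact rowSum_le_of_le restr_le k b
    · obtain ⟨K', hK', h⟩ := exists_convolution_le_of_gt hβ hgt e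
      refine ⟨K₂ + K * (K₂ * K'), by positivity, fun k => (hup k).trans ?_⟩
      rw [pow_zero, one_mul, add_mul]
      refine add_le_add le_rfl ?_
      rw [mul_assoc, mul_assoc]
      exact mul_le_mul_of_nonneg_left (mul_le_mul_of_nonneg_left (h k) hK₂.le) hK.le

/-- Every row of a nonerasing matrix has a growth rate `k ^ e * β ^ k`. The base `β` is the rate
of an accessible irreducible block, which leads out of itself as soon as `1 ≤ e`. -/
theorem exists_hasRate (hM : Nonerasing M) (b : A) :
    ∃ (β : ℝ) (e : ℕ) (C : Finset A), Block M C β ∧ (∀ c ∈ C, Reach M b c) ∧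
      HasRate (fun k => rowSum M k b) e β ∧
      (1 ≤ e → ∃ c ∈ C, ∃ d, Reach M c d ∧ ¬ Reach M d c) := by
  classical
  induction hn : (Finset.univ.filter (Reach M b)).card using Nat.strong_induction_on
    generalizing b with
  | _ n ih =>
  subst hn
  have hb : b ∈ component M b := mem_component.2 ⟨.refl b, .refl b⟩
  have hsuccT : ∀ c ∈ component M b, ∀ t ∉ component M b, 0 < M c t →
      Reach M b t ∧ ¬ Reach M t b := by
    intro c hc t ht hct
    have h1 : Reach M b t := (mem_component.1 hc).1.trans (.edge hct)
    exact ⟨h1, fun h2 => ht (mem_component.2 ⟨h1, h2⟩)⟩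
  set T : Finset A := Finset.univ.filter fun t => Reach M b t ∧ ¬ Reach M t b with hT
  have hmemT : ∀ t, t ∈ T ↔ Reach M b t ∧ ¬ Reach M t b := fun t => by simp [hT]
  have hIH : ∀ t ∈ T, ∃ (β : ℝ) (e : ℕ) (C : Finset A), Block M C β ∧ (∀ c ∈ C, Reach M t c) ∧
      HasRate (fun k => rowSum M k t) e β ∧
      (1 ≤ e → ∃ c ∈ C, ∃ d, Reach M c d ∧ ¬ Reach M d c) := by
    intro t ht
    rw [hmemT] at ht
    refine ih _ (Finset.card_lt_card ?_) t rfl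
    rw [Finset.ssubset_iff_of_subset]
    · exact ⟨b, by simpa using Reach.refl b, by simpa using ht.2⟩
    · intro c hc
      simp only [Finset.mem_filter, Finset.mem_univ, true_and] at hc ⊢
      exact ht.1.trans hc
  choose! β e C hC hreach hrate hout using hIH
  rcases T.eq_empty_or_nonempty with hT0 | hT0
  · have hno : ∀ c ∈ component M b, ∀ t, 0 < M c t → t ∈ component M b := by
      intro c hc t hct
      by_contra ht
      have := (hmemT t).2 (hsuccT c hc t ht hct)
      simp [hT0] at this
    obtain ⟨c, hc⟩ := hM b
    obtain ⟨ρ, hB⟩ := exists_block_component (hno b hb c hc) hc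
    refine ⟨ρ, 0, _, hB, fun c hc => (mem_component.1 hc).1, ?_, by simp⟩
    obtain ⟨-, hρ, -, K, hK, hle⟩ := hB
    refine .of_le (by linarith) (fun k => Nat.cast_nonneg _) ⟨K, hK, fun k => ?_⟩
      ⟨K, hK, fun k => ?_⟩
    · rw [pow_zero, one_mul]
      refine (hle b hb k).1.trans ?_
      gcongr
      exact rowSum_le_of_le restr_le k b
    · rw [pow_zero, one_mul]
      refine le_trans ?_ (hle b hb k).2
      have := rowSum_le_convolution (M := M) (C := component M b) (h := fun _ => 0) (K := 0)
        (fun c hc k => by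
          rw [mul_zero]
          refine (Finset.sum_eq_zero fun t ht => ?_).le
          rw [Finset.mem_compl] at ht
          rw [Nat.eq_zero_of_not_pos fun h => ht (hno c hc t h)]
          simp) k b hb
      simpa using this
  · obtain ⟨t, ht, hmax⟩ := T.exists_max_image (fun t => toLex (β t, e t)) hT0
    have hβ : ∀ t ∈ T, 1 ≤ β t := fun t ht => (hC t ht).2.1
    have hbound : ∀ s ∈ T, ∃ K : ℝ, 0 < K ∧
        ∀ k : ℕ, (rowSum M k s : ℝ) ≤ K * (((k : ℝ) + 1) ^ e t * β t ^ k) := by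
      intro s hs
      obtain ⟨K, hK, h⟩ := hrate s hs
      obtain ⟨K', hK', h'⟩ := exists_rate_le_of_lex_le (hβ s hs) (hmax s hs)
      refine ⟨K * K', by positivity, fun k => (h k).2.trans ?_⟩
      rw [mul_assoc]
      exact mul_le_mul_of_nonneg_left (h' k) hK.le
    choose! K hK hKle using hbound
    obtain ⟨K', hK', hout'⟩ : ∃ K' : ℝ, 0 < K' ∧ ∀ c ∈ component M b, ∀ k,
        ∑ t ∈ (component M b)ᶜ, (M c t : ℝ) * rowSum M k t ≤
          K' * (((k : ℝ) + 1) ^ e t * β t ^ k) := by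
      refine ⟨1 + ∑ c, ∑ s, (M c s : ℝ) * |K s|, by positivity, fun c hc k => ?_⟩
      have hh : 0 ≤ ((k : ℝ) + 1) ^ e t * β t ^ k := by
        have := hβ t ht
        positivity
      calc ∑ s ∈ (component M b)ᶜ, (M c s : ℝ) * rowSum M k s
          ≤ ∑ s ∈ (component M b)ᶜ,
              (M c s : ℝ) * |K s| * (((k : ℝ) + 1) ^ e t * β t ^ k) := by
            refine Finset.sum_le_sum fun s hs => ?_
            rw [Finset.mem_compl] at hs
            rcases Nat.eq_zero_or_pos (M c s) with h0 | h0
            · simp [h0]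
            · rw [mul_assoc]
              gcongr
              refine (hKle s ((hmemT s).2 (hsuccT c hc s hs h0)) k).trans ?_
              gcongr
              exact le_abs_self _
        _ = (∑ s ∈ (component M b)ᶜ, (M c s : ℝ) * |K s|) * _ := by rw [Finset.sum_mul]
        _ ≤ (1 + ∑ c, ∑ s, (M c s : ℝ) * |K s|) * _ := by
            gcongr
            calc ∑ s ∈ (component M b)ᶜ, (M c s : ℝ) * |K s|
                ≤ ∑ s, (M c s : ℝ) * |K s| :=
                  Finset.sum_le_sum_of_subset_of_nonneg (Finset.subset_univ _)
                    fun _ _ _ => by positivity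
              _ ≤ ∑ c, ∑ s, (M c s : ℝ) * |K s| :=
                  Finset.single_le_sum (f := fun c => ∑ s, (M c s : ℝ) * |K s|)
                    (fun _ _ => Finset.sum_nonneg fun _ _ => by positivity) (Finset.mem_univ c)
              _ ≤ _ := by linarith
    have htT := (hmemT t).1 ht
    have hinherit : HasRate (fun k => rowSum M k b) (e t) (β t) →
        ∃ (β : ℝ) (e : ℕ) (C : Finset A), Block M C β ∧ (∀ c ∈ C, Reach M b c) ∧
          HasRate (fun k => rowSum M k b) e β ∧
          (1 ≤ e → ∃ c ∈ C, ∃ d, Reach M c d ∧ ¬ Reach M d c) := fun h =>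
      ⟨β t, e t, C t, hC t ht, fun c hc => htT.1.trans (hreach t ht c hc), h, hout t ht⟩
    by_cases htriv : ∃ c ∈ component M b, 0 < M b c
    · obtain ⟨c, hc, hbc⟩ := htriv
      obtain ⟨ρ, hB⟩ := exists_block_component hc hbc
      have hreachC : ∀ c ∈ component M b, Reach M b c := fun c hc => (mem_component.1 hc).1
      rcases hasRate_of_component hM hB (hβ t ht) hK' hout' htT.1 htT.2 (hrate t ht) with
        ⟨-, h⟩ | ⟨rfl, h⟩ | ⟨-, h⟩
      · exact hinherit h
      · exact ⟨_, _, _, hB, hreachC, h, fun _ => ⟨b, hb, t, htT⟩⟩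
      · exact ⟨_, _, _, hB, hreachC, h, by simp⟩
    · push Not at htriv
      refine hinherit (.of_le (by linarith [hβ t ht]) (fun k => Nat.cast_nonneg _) ?_ ?_)
      · obtain ⟨K₁, hK₁, h⟩ := hrate t ht
        obtain ⟨K₂, hK₂, h'⟩ := htT.1.exists_rowSum_le
        refine ⟨K₁ * K₂, by positivity, fun k => (h k).1.trans ?_⟩
        rw [mul_assoc]
        gcongr
        exact h' k
      · refine ⟨K', hK', fun k => le_trans ?_ (hout' b hb k)⟩
        have h1 : rowSum M k b ≤ ∑ c, M b c * rowSum M k c := by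
          rw [← rowSum_succ]
          exact hM.rowSum_mono b (Nat.le_succ k)
        have h2 : ∑ c, M b c * rowSum M k c = ∑ c ∈ (component M b)ᶜ, M b c * rowSum M k c := by
          symm
          refine Finset.sum_subset (Finset.subset_univ _) fun c _ hc => ?_
          rw [Finset.mem_compl, not_not] at hc
          rw [Nat.le_zero.1 (htriv c hc), zero_mul]
        rw [h2] at h1
        exact_mod_cast h1

end Rates

section Separation

/-- The rate of a block is an eigenvalue of the block. -/
lemma Block.exists_eigenvector [Fintype A] [DecidableEq A] {M : Matrix A A ℕ} {C : Finset A}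
    {ρ : ℝ} (hB : Block M C ρ) :
    ∃ v : A → ℝ, v ≠ 0 ∧ ((restr M C).map (Nat.cast : ℕ → ℝ)).mulVec v = ρ • v := by
  obtain ⟨⟨c, hc⟩, hρ, -, K, hK, hB⟩ := hB
  have hρ0 : 0 < ρ := by linarith
  set N := (restr M C).map (Nat.cast : ℕ → ℝ) with hN
  by_contra hv
  have hdet : IsUnit (Matrix.scalar A ρ - N).det := by
    rw [isUnit_iff_ne_zero]
    intro h0
    obtain ⟨v, hv0, hv1⟩ := Matrix.exists_mulVec_eq_zero_iff.2 h0
    refine hv ⟨v, hv0, ?_⟩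
    rw [Matrix.sub_mulVec, sub_eq_zero] at hv1
    rw [← hv1, Matrix.scalar_apply]
    ext i
    simp [Matrix.mulVec_diagonal]
  obtain ⟨R, hR⟩ := exists_rowSum_bound M
  have hbd : ∀ k b, (rowSum (restr M C) k b : ℝ) ≤ (1 + R * K) * ρ ^ k := by
    intro k b
    cases k with
    | zero =>
      simp only [rowSum_zero, Nat.cast_one, pow_zero, mul_one]
      nlinarith [mul_nonneg (Nat.cast_nonneg R : (0 : ℝ) ≤ R) hK.le]
    | succ k =>
      rw [rowSum_succ]
      push_cast
      have h1 : ∀ d, ((restr M C b d : ℕ) : ℝ) * rowSum (restr M C) k d ≤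
          (M b d : ℝ) * (K * ρ ^ k) := by
        intro d
        by_cases hd : d ∈ C
        · simp only [restr, hd, if_true]
          exact mul_le_mul_of_nonneg_left (hB d hd k).2 (Nat.cast_nonneg _)
        · simp only [restr, hd, if_false, Nat.cast_zero, zero_mul]
          positivity
      refine (Finset.sum_le_sum fun d _ => h1 d).trans ?_
      rw [← Finset.sum_mul]
      have h2 : ∑ d, (M b d : ℝ) ≤ R := by
        have := hR b
        rw [rowSum_one] at this
        exact_mod_cast this
      have h3 : ρ ^ k ≤ ρ ^ (k + 1) := pow_le_pow_right₀ hρ (Nat.le_succ k)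
      have h4 : 0 ≤ ρ ^ (k + 1) := by positivity
      calc (∑ d, (M b d : ℝ)) * (K * ρ ^ k) ≤ R * (K * ρ ^ (k + 1)) := by gcongr
        _ ≤ _ := by nlinarith
  set S : ℕ → A → ℝ := fun n b => ∑ k ∈ Finset.range n, (rowSum (restr M C) k b : ℝ) / ρ ^ k
    with hS
  have hstep : ∀ n, (Matrix.scalar A ρ - N).mulVec (S n) =
      fun b => ρ * (1 - (rowSum (restr M C) n b : ℝ) / ρ ^ n) := by
    intro n
    ext b
    rw [Matrix.sub_mulVec, Pi.sub_apply, Matrix.scalar_apply, Matrix.mulVec_diagonal]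
    have h1 : N.mulVec (S n) b =
        ∑ k ∈ Finset.range n, (rowSum (restr M C) (k + 1) b : ℝ) / ρ ^ k := by
      simp only [Matrix.mulVec, dotProduct, hS, Finset.mul_sum, rowSum_succ, Nat.cast_sum,
        Nat.cast_mul, Finset.sum_div, hN, Matrix.map_apply]
      rw [Finset.sum_comm]
      refine Finset.sum_congr rfl fun k _ => Finset.sum_congr rfl fun d _ => ?_
      rw [mul_div_assoc]
    rw [h1]
    clear h1
    induction n with
    | zero => simp [hS]
    | succ n ih =>
      simp only [hS] at ih ⊢
      rw [Finset.sum_range_succ, Finset.sum_range_succ, mul_add, add_sub_add_comm, ih, pow_succ]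
      field_simp
      ring
  have hinv : ∀ n, S n c = ∑ b, (Matrix.scalar A ρ - N)⁻¹ c b *
      (ρ * (1 - (rowSum (restr M C) n b : ℝ) / ρ ^ n)) := by
    intro n
    have := congrFun (congrArg ((Matrix.scalar A ρ - N)⁻¹.mulVec) (hstep n)) c
    rw [Matrix.mulVec_mulVec, Matrix.nonsing_inv_mul _ hdet, Matrix.one_mulVec] at this
    exact this
  have hlow : ∀ n : ℕ, (n : ℝ) ≤ K * S n c := by
    intro n
    rw [hS]
    simp only [Finset.mul_sum]
    calc (n : ℝ) = ∑ k ∈ Finset.range n, (1 : ℝ) := by simp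
      _ ≤ _ := Finset.sum_le_sum fun k _ => by
        rw [← mul_div_assoc, le_div_iff₀ (by positivity), one_mul]
        exact (hB c hc k).1
  have hup : ∀ n, S n c ≤ ∑ b, |(Matrix.scalar A ρ - N)⁻¹ c b| * (ρ * (2 + R * K)) := by
    intro n
    rw [hinv]
    refine Finset.sum_le_sum fun b _ => (le_abs_self _).trans ?_
    rw [abs_mul, abs_mul, abs_of_pos hρ0]
    gcongr
    have h1 : (rowSum (restr M C) n b : ℝ) / ρ ^ n ≤ 1 + R * K := by
      rw [div_le_iff₀ (by positivity)]
      exact hbd n b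
    have h2 : 0 ≤ (rowSum (restr M C) n b : ℝ) / ρ ^ n := by positivity
    have h3 : 0 ≤ R * K := by positivity
    rw [abs_le]
    constructor <;> linarith
  obtain ⟨n, hn⟩ := exists_nat_gt (K * ∑ b, |(Matrix.scalar A ρ - N)⁻¹ c b| * (ρ * (2 + R * K)))
  exact absurd ((hlow n).trans (mul_le_mul_of_nonneg_left (hup n) hK.le)) (not_le.2 hn)

/-- Nonzero real eigenvalues of integer matrices are bounded away from zero. -/
lemma one_le_abs_eigenvalue_mul {n : Type*} [Fintype n] [DecidableEq n] {D : Matrix n n ℤ} {R : ℕ}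
    (hR : ∀ i, ∑ j, |D i j| ≤ R) {δ : ℝ} (hδ : δ ≠ 0) {v : n → ℝ} (hv : v ≠ 0)
    (h : (D.map (Int.cast : ℤ → ℝ)).mulVec v = δ • v) :
    1 ≤ |δ| * ((Fintype.card n + 1) * ((R + 1) ^ Fintype.card n * 2 ^ Fintype.card n)) := by
  set d := Fintype.card n with hd
  set B : ℝ := ((R : ℝ) + 1) ^ d * 2 ^ d with hBdef
  have hR1 : (1 : ℝ) ≤ (R : ℝ) + 1 := by linarith [(Nat.cast_nonneg R : (0 : ℝ) ≤ R)]
  have hB : 1 ≤ B := one_le_mul_of_one_le_of_one_le (one_le_pow₀ hR1) (one_le_pow₀ (by norm_num))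
  have hdeg : D.charpoly.natDegree = d := Matrix.charpoly_natDegree_eq_dim D
  have hcoeff : ∀ i, |(D.charpoly.coeff i : ℝ)| ≤ B := by
    intro i
    have hroots : ∀ z ∈ (D.charpoly.map (Int.castRingHom ℂ)).roots, ‖z‖ ≤ (R : ℝ) := by
      intro z hz
      rw [← Matrix.charpoly_map] at hz
      have hev : Module.End.HasEigenvalue (Matrix.toLin' (D.map (Int.castRingHom ℂ))) z := by
        rw [Module.End.hasEigenvalue_iff_isRoot_charpoly, ← Matrix.toLin_eq_toLin',
          Matrix.charpoly_toLin]
        exact Polynomial.isRoot_of_mem_roots hz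
      obtain ⟨k, hk⟩ := eigenvalue_mem_ball hev
      rw [mem_closedBall_iff_norm] at hk
      have hkR : ∑ j, |((D k j : ℤ) : ℝ)| ≤ R := by exact_mod_cast hR k
      calc ‖z‖ ≤ ‖(D.map (Int.castRingHom ℂ)) k k‖ +
            ‖z - (D.map (Int.castRingHom ℂ)) k k‖ := norm_le_norm_add_norm_sub' _ _
        _ ≤ ‖(D.map (Int.castRingHom ℂ)) k k‖ +
            ∑ j ∈ Finset.univ.erase k, ‖(D.map (Int.castRingHom ℂ)) k j‖ := by gcongr
        _ = ∑ j, ‖(D.map (Int.castRingHom ℂ)) k j‖ :=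
            Finset.add_sum_erase _ (fun j => ‖(D.map (Int.castRingHom ℂ)) k j‖)
              (Finset.mem_univ k)
        _ = ∑ j, |((D k j : ℤ) : ℝ)| := by simp
        _ ≤ R := hkR
    have h1 := Polynomial.coeff_bdd_of_roots_le (d := d) (Int.castRingHom ℂ)
      (Matrix.charpoly_monic D) (IsAlgClosed.splits _) hdeg.le hroots i
    rw [Polynomial.coeff_map, eq_intCast, Complex.norm_intCast] at h1
    refine h1.trans ?_
    rw [hBdef]
    gcongr
    · exact max_le (by linarith) hR1
    · exact_mod_cast Nat.choose_le_two_pow d (d / 2)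
  rcases le_or_gt 1 |δ| with h1 | h1
  · have : (1 : ℝ) ≤ (d + 1) * B :=
      one_le_mul_of_one_le_of_one_le (by linarith [(Nat.cast_nonneg d : (0 : ℝ) ≤ d)]) hB
    exact one_le_mul_of_one_le_of_one_le h1 this
  · have hroot : ∑ i ∈ Finset.range (d + 1), (D.charpoly.coeff i : ℝ) * δ ^ i = 0 := by
      have hev : Module.End.HasEigenvalue (Matrix.toLin' (D.map (Int.castRingHom ℝ))) δ := by
        refine Module.End.hasEigenvalue_of_hasEigenvector (x := v) ⟨?_, hv⟩
        rw [Module.End.mem_eigenspace_iff, Matrix.toLin'_apply]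
        exact h
      rw [Module.End.hasEigenvalue_iff_isRoot_charpoly, ← Matrix.toLin_eq_toLin',
          Matrix.charpoly_toLin, Matrix.charpoly_map, Polynomial.IsRoot,
          Polynomial.eval_map, Polynomial.eval₂_eq_sum_range, hdeg] at hev
      simpa using hev
    set j := D.charpoly.natTrailingDegree with hj
    have hP : D.charpoly ≠ 0 := (Matrix.charpoly_monic D).ne_zero
    have hcj : D.charpoly.coeff j ≠ 0 := by
      simpa [hj, Polynomial.trailingCoeff] using hP
    have hjd : j ∈ Finset.range (d + 1) := by
      rw [Finset.mem_range, ← hdeg]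
      exact Nat.lt_succ_of_le (Polynomial.natTrailingDegree_le_natDegree _)
    have hone : (1 : ℝ) ≤ |(D.charpoly.coeff j : ℝ)| := by
      exact_mod_cast Int.one_le_abs hcj
    have hδ0 : 0 < |δ| := abs_pos.2 hδ
    rw [← Finset.add_sum_erase _ _ hjd] at hroot
    have hmain : |δ| ^ j ≤ (d + 1) * (B * |δ| ^ (j + 1)) := by
      calc |δ| ^ j ≤ |(D.charpoly.coeff j : ℝ)| * |δ| ^ j :=
            le_mul_of_one_le_left (by positivity) hone
        _ = |∑ i ∈ (Finset.range (d + 1)).erase j, (D.charpoly.coeff i : ℝ) * δ ^ i| := by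
            rw [← abs_pow, ← abs_mul, eq_neg_of_add_eq_zero_left hroot, abs_neg]
        _ ≤ ∑ i ∈ (Finset.range (d + 1)).erase j, |(D.charpoly.coeff i : ℝ) * δ ^ i| :=
            Finset.abs_sum_le_sum_abs _ _
        _ ≤ ∑ i ∈ (Finset.range (d + 1)).erase j, B * |δ| ^ (j + 1) := by
            refine Finset.sum_le_sum fun i hi => ?_
            rw [abs_mul, abs_pow]
            rcases lt_or_gt_of_ne (Finset.ne_of_mem_erase hi) with hij | hij
            · rw [Polynomial.coeff_eq_zero_of_lt_natTrailingDegree hij]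
              simp only [Int.cast_zero, abs_zero, zero_mul]
              positivity
            · exact mul_le_mul (hcoeff i) (pow_le_pow_of_le_one hδ0.le h1.le hij)
                (by positivity) (by positivity)
        _ ≤ ∑ i ∈ Finset.range (d + 1), B * |δ| ^ (j + 1) :=
            Finset.sum_le_sum_of_subset_of_nonneg (Finset.erase_subset _ _)
              fun _ _ _ => by positivity
        _ = _ := by simp
    have hpos : 0 < |δ| ^ j := by positivity
    rw [pow_succ] at hmain
    nlinarith

/-- Distinct real eigenvalues of two matrices with natural entries are uniformly separated. -/
lemma one_le_abs_sub_eigenvalue_mul [Fintype A] [DecidableEq A] {M N : Matrix A A ℕ} {R : ℕ}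
    (hM : ∀ i, ∑ j, M i j ≤ R) (hN : ∀ i, ∑ j, N i j ≤ R) {α β : ℝ} (hαβ : α ≠ β)
    (hα : ∃ v : A → ℝ, v ≠ 0 ∧ (M.map (Nat.cast : ℕ → ℝ)).mulVec v = α • v)
    (hβ : ∃ v : A → ℝ, v ≠ 0 ∧ (N.map (Nat.cast : ℕ → ℝ)).mulVec v = β • v) :
    1 ≤ |α - β| * ((Fintype.card A ^ 2 + 1) *
      ((2 * R + 1) ^ (Fintype.card A ^ 2) * 2 ^ (Fintype.card A ^ 2))) := by
  obtain ⟨v, hv, hMv⟩ := hα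
  obtain ⟨w, hw, hNw⟩ := hβ
  have hMv' : ∀ i, ∑ j, (M i j : ℝ) * v j = α * v i := fun i => by
    simpa [Matrix.mulVec, dotProduct] using congrFun hMv i
  have hNw' : ∀ i, ∑ j, (N i j : ℝ) * w j = β * w i := fun i => by
    simpa [Matrix.mulVec, dotProduct] using congrFun hNw i
  let D : Matrix (A × A) (A × A) ℤ := fun p q =>
    (if p.2 = q.2 then (M p.1 q.1 : ℤ) else 0) - if p.1 = q.1 then (N p.2 q.2 : ℤ) else 0
  have hcard : Fintype.card (A × A) = Fintype.card A ^ 2 := by rw [Fintype.card_prod, sq]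
  have hD : ∀ p, ∑ q, |D p q| ≤ ((2 * R : ℕ) : ℤ) := by
    rintro ⟨a, b⟩
    calc ∑ q, |D (a, b) q| ≤ ∑ q : A × A, ((if b = q.2 then (M a q.1 : ℤ) else 0) +
          if a = q.1 then (N b q.2 : ℤ) else 0) := by
          refine Finset.sum_le_sum fun q _ => (abs_sub _ _).trans (le_of_eq ?_)
          congr 1 <;> split_ifs <;> simp
      _ = ((∑ j, M a j + ∑ j, N b j : ℕ) : ℤ) := by
          rw [Finset.sum_add_distrib, Fintype.sum_prod_type, Fintype.sum_prod_type]
          simp [Finset.sum_ite_irrel]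
      _ ≤ _ := by
          have := hM a
          have := hN b
          exact_mod_cast (by omega)
  have hvw : (fun p : A × A => v p.1 * w p.2) ≠ 0 := by
    obtain ⟨i, hi⟩ := Function.ne_iff.1 hv
    obtain ⟨j, hj⟩ := Function.ne_iff.1 hw
    exact Function.ne_iff.2 ⟨(i, j), mul_ne_zero hi hj⟩
  have := one_le_abs_eigenvalue_mul hD (sub_ne_zero.2 hαβ) hvw (by
    ext ⟨a, b⟩
    have h1 : ∀ q : A × A, (D (a, b) q : ℝ) * (v q.1 * w q.2) =
        (if b = q.2 then (M a q.1 : ℝ) * v q.1 * w q.2 else 0) -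
          if a = q.1 then v q.1 * ((N b q.2 : ℝ) * w q.2) else 0 := fun q => by
      simp only [D]
      push_cast
      split_ifs <;> ring
    simp only [Matrix.mulVec, dotProduct, Matrix.map_apply, h1, Finset.sum_sub_distrib,
      Fintype.sum_prod_type, Pi.smul_apply, smul_eq_mul]
    simp only [Finset.sum_ite_eq, Finset.mem_univ, if_true, Finset.sum_ite_irrel,
      Finset.sum_const_zero, ← Finset.sum_mul, ← Finset.mul_sum, hMv', hNw']
    ring)
  rw [hcard] at this
  exact_mod_cast this

/-- Separation constant for the rates of blocks of a matrix of size and row sums at most `H`. -/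
def sepBound (H : ℕ) : ℕ := H * ((H ^ 2 + 1) * ((2 * H + 1) ^ (H ^ 2) * 2 ^ (H ^ 2)))

variable [Fintype A] [DecidableEq A] {M : Matrix A A ℕ}

lemma Block.le_bound {C : Finset A} {ρ : ℝ} (hB : Block M C ρ) {H : ℕ}
    (hH : ∀ b, rowSum M 1 b ≤ H) : ρ ≤ H := by
  obtain ⟨⟨c, hc⟩, hρ, -, K, hK, hB⟩ := hB
  by_contra hlt
  obtain ⟨k, hk⟩ := (eventually_poly_mul_geometric_lt 0 K (Nat.cast_nonneg H)
    (not_le.1 hlt)).exists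
  refine absurd ((hB c hc k).1.trans (mul_le_mul_of_nonneg_left ?_ hK.le)) (not_le.2 hk)
  have h1 : rowSum (restr M C) k c ≤ H ^ k := by
    refine (rowSum_le_of_le restr_le k c).trans ?_
    simpa using rowSum_add_le hH 0 k c
  rw [pow_zero, one_mul]
  exact_mod_cast h1

lemma Block.separation {C C' : Finset A} {ρ ρ' : ℝ} (hB : Block M C ρ) (hB' : Block M C' ρ')
    {H : ℕ} (hH : ∀ b, rowSum M 1 b ≤ H) (hA : Fintype.card A ≤ H) (hlt : ρ < ρ') :
    ((sepBound H : ℝ) + 1) * ρ ≤ sepBound H * ρ' := by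
  have hrow : ∀ (U : Finset A) i, ∑ j, restr M U i j ≤ H := fun U i => by
    refine (Finset.sum_le_sum fun j _ => ?_).trans ((rowSum_one (M := M) i).symm.le.trans (hH i))
    exact restr_le i j
  have h := one_le_abs_sub_eigenvalue_mul (hrow C') (hrow C) hlt.ne' hB'.exists_eigenvector
    hB.exists_eigenvector
  rw [abs_of_pos (sub_pos.2 hlt)] at h
  have hρH := hB.le_bound hH
  have hL : ((Fintype.card A : ℝ) ^ 2 + 1) *
      ((2 * H + 1) ^ (Fintype.card A ^ 2) * 2 ^ (Fintype.card A ^ 2)) ≤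
      ((H : ℝ) ^ 2 + 1) * ((2 * H + 1) ^ (H ^ 2) * 2 ^ (H ^ 2)) := by
    have hH0 : (1 : ℝ) ≤ 2 * (H : ℝ) + 1 := by linarith [(Nat.cast_nonneg H : (0 : ℝ) ≤ H)]
    gcongr
    norm_num
  have h' := h.trans (mul_le_mul_of_nonneg_left hL (sub_pos.2 hlt).le)
  have h2 := mul_le_mul_of_nonneg_left h' (Nat.cast_nonneg H : (0 : ℝ) ≤ H)
  simp only [sepBound]
  push_cast
  nlinarith

end Separation

section Certificates

lemma le_of_forall_pow_le {x y K : ℝ} (e : ℕ) (hx : 0 ≤ x)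
    (h : ∀ j : ℕ, y ^ j ≤ K * (((j : ℝ) + 1) ^ e * x ^ j)) : y ≤ x := by
  by_contra hlt
  obtain ⟨j, hj⟩ := (eventually_poly_mul_geometric_lt e K hx (not_le.1 hlt)).exists
  exact absurd (h j) (not_le.2 hj)

lemma HasRate.le_pow {a : ℕ → ℝ} {e k : ℕ} {β y : ℝ} (ha : HasRate a e β) (hβ : 0 ≤ β)
    (h : ∀ j : ℕ, y ^ j ≤ a (k * j)) : y ≤ β ^ k := by
  obtain ⟨K, hK, ha⟩ := ha
  refine le_of_forall_pow_le (K := K * ((k : ℝ) + 1) ^ e) e (by positivity) fun j => ?_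
  refine ((h j).trans (ha _).2).trans ?_
  rw [mul_assoc, ← mul_assoc (((k : ℝ) + 1) ^ e), ← mul_pow, ← pow_mul]
  gcongr
  push_cast
  nlinarith [(Nat.cast_nonneg k : (0 : ℝ) ≤ k), (Nat.cast_nonneg j : (0 : ℝ) ≤ j)]

lemma HasRate.pow_le {a : ℕ → ℝ} {e k : ℕ} {β x : ℝ} (ha : HasRate a e β) (hβ : 0 ≤ β)
    (hx : 0 ≤ x) (h : ∀ j : ℕ, a (k * j) ≤ x ^ j) : β ^ k ≤ x := by
  obtain ⟨K, hK, ha⟩ := ha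
  refine le_of_forall_pow_le (K := K) 0 hx fun j => ?_
  rw [pow_zero, one_mul, ← pow_mul]
  refine le_trans ?_ ((ha _).1.trans (mul_le_mul_of_nonneg_left (h j) hK.le))
  refine le_mul_of_one_le_left (by positivity) (one_le_pow₀ ?_)
  linarith [(Nat.cast_nonneg (k * j) : (0 : ℝ) ≤ (k * j : ℕ))]

variable [Fintype A] [DecidableEq A] {M : Matrix A A ℕ} {N k : ℕ} {F U : Finset A}

/-- All letters have doubled after `k` steps. -/
def Doubling (M : Matrix A A ℕ) (k : ℕ) : Prop := ∀ b, 2 ≤ rowSum M k b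

/-- The row sums at exponent `k` differ by a factor less than `(1 + 1 / N) ^ k`. -/
def Near (M : Matrix A A ℕ) (N k : ℕ) : Prop :=
  ∀ b c, N ^ k * rowSum M k b < (N + 1) ^ k * rowSum M k c

/-- Finite certificate for quasi-uniformity. -/
def CertQU (M : Matrix A A ℕ) (N k : ℕ) (F U : Finset A) : Prop :=
  Doubling M k ∧ Near M N k ∧ ClosedSet M F ∧
    (∀ b ∈ F, ∀ c, 0 < M b c → ∃ j < k, 0 < (M ^ j) c b) ∧ (∀ b, b ∈ F ∨ b ∈ U) ∧
    ∀ b ∈ U, ∀ c, rowSum (restr M U) k b < rowSum M k c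

/-- Finite certificate for polynomial divergence. -/
def CertPD (M : Matrix A A ℕ) (N k : ℕ) (F U : Finset A) : Prop :=
  Doubling M k ∧ Near M N k ∧ ClosedSet M F ∧ U.Nonempty ∧ ∀ u ∈ U, u ∉ F ∧
    (∃ f ∈ F, ∃ j < k, 0 < (M ^ j) u f) ∧ (∀ v ∈ U, ∃ j < k, 0 < (restr M U ^ j) u v) ∧
    ∀ b, N ^ k * rowSum M k b < (N + 1) ^ k * rowSum (restr M U) k u

/-- Finite certificate for exponential divergence. -/
def CertED (M : Matrix A A ℕ) (k : ℕ) (F U : Finset A) : Prop :=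
  Doubling M k ∧ ClosedSet M F ∧ F.Nonempty ∧ U.Nonempty ∧
    ∀ b ∈ F, ∀ u ∈ U, rowSum M k b < rowSum (restr M U) k u

/-- All rows have the rate `β ^ k`, for a common base. -/
def UniformRates (M : Matrix A A ℕ) : Prop :=
  ∃ β : ℝ, 1 < β ∧ ∀ b, HasRate (fun k => rowSum M k b) 0 β

/-- All rows have rates `k ^ e * β ^ k` for a common base, not all with `e = 0`. -/
def PolyRates (M : Matrix A A ℕ) : Prop :=
  ∃ β : ℝ, 1 < β ∧ ∃ e : A → ℕ, (∀ b, HasRate (fun k => rowSum M k b) (e b) β) ∧ ∃ b, 1 ≤ e b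

/-- The rows have rates `k ^ e * β ^ k` with different bases. -/
def ExpRates (M : Matrix A A ℕ) : Prop :=
  ∃ (β : A → ℝ) (e : A → ℕ),
    (∀ b, 1 < β b ∧ HasRate (fun k => rowSum M k b) (e b) (β b)) ∧ ∃ b c, β b ≠ β c

lemma closedSet_univ : ClosedSet M Finset.univ := fun _ _ _ _ => Finset.mem_univ _

lemma exists_pos_of_one_lt_rowSum {b : A} (h : 1 < rowSum M k b) : ∃ c, 0 < M b c := by
  by_contra hb
  push Not at hb
  cases k with
  | zero => simp at h
  | succ k =>
    rw [rowSum_succ, Finset.sum_eq_zero fun c _ => by rw [Nat.le_zero.1 (hb c), zero_mul]] at h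
    omega

lemma Doubling.nonerasing (h : Doubling M k) : Nonerasing M := fun b =>
  exists_pos_of_one_lt_rowSum (h b)

lemma Doubling.exists_rates (h : Doubling M k) :
    ∃ (β : A → ℝ) (e : A → ℕ) (C : A → Finset A), ∀ b, 1 < β b ∧ Block M (C b) (β b) ∧
      HasRate (fun k => rowSum M k b) (e b) (β b) ∧
      (1 ≤ e b → ∃ c ∈ C b, ∃ d, Reach M c d ∧ ¬ Reach M d c) := by
  choose β e C hC _ hrate hout using exists_hasRate h.nonerasing
  refine ⟨β, e, C, fun b => ⟨?_, hC b, hrate b, hout b⟩⟩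
  have h1 : (2 : ℝ) ≤ β b ^ k := by
    refine (hrate b).le_pow (by linarith [(hC b).2.1]) fun j => ?_
    exact_mod_cast closedSet_univ.le_rowSum_mul (fun b _ => h b) j b (Finset.mem_univ b)
  by_contra hle
  have := pow_le_one₀ (n := k) (by linarith [(hC b).2.1]) (not_lt.1 hle)
  linarith

lemma le_pow_of_forall_le_rowSum {b : A} {e y : ℕ} {β : ℝ} (hβ : 1 ≤ β)
    (hrate : HasRate (fun k => rowSum M k b) e β) (hb : b ∈ U)
    (h : ∀ u ∈ U, y ≤ rowSum (restr M U) k u) : (y : ℝ) ≤ β ^ k := by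
  refine hrate.le_pow (by linarith) fun j => ?_
  have := (closedSet_restr.le_rowSum_mul h j b hb).trans (rowSum_le_of_le restr_le (k * j) b)
  exact_mod_cast this

lemma pow_le_of_forall_rowSum_le {b : A} {e x : ℕ} {β : ℝ} (hβ : 1 ≤ β)
    (hrate : HasRate (fun k => rowSum M k b) e β) (hF : ClosedSet M F) (hb : b ∈ F)
    (h : ∀ c ∈ F, rowSum M k c ≤ x) : β ^ k ≤ (x : ℝ) := by
  refine hrate.pow_le (by linarith) (Nat.cast_nonneg x) fun j => ?_
  exact_mod_cast hF.rowSum_mul_le h j b hb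

lemma restr_univ : restr M Finset.univ = M := by
  ext b c
  simp [restr]

lemma le_of_near {H : ℕ} (hH : ∀ b, rowSum M 1 b ≤ H) (hA : Fintype.card A ≤ H) {b : A}
    {e : ℕ} {β ρ : ℝ} {C C' : Finset A}
    (hβ : Block M C β) (hb : HasRate (fun k => rowSum M k b) e β) (hρ : Block M C' ρ)
    (hlow : ∀ y : ℕ, (∀ u ∈ U, y ≤ rowSum (restr M U) k u) → (y : ℝ) ≤ ρ ^ k) (hU : U.Nonempty)
    (h : ∀ u ∈ U, ∀ b, sepBound H ^ k * rowSum M k b <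
      (sepBound H + 1) ^ k * rowSum (restr M U) k u) : β ≤ ρ := by
  by_contra hlt
  have hsep := hρ.separation hβ hH hA (not_le.1 hlt)
  obtain ⟨u, hu, humin⟩ := U.exists_min_image (rowSum (restr M U) k) hU
  obtain ⟨d, -, hdmax⟩ := Finset.univ.exists_max_image (rowSum M k) ⟨b, Finset.mem_univ b⟩
  have h1 := pow_le_of_forall_rowSum_le hβ.2.1 hb closedSet_univ (Finset.mem_univ b) hdmax
  have h2 := hlow _ humin
  have h3 : (sepBound H : ℝ) ^ k * rowSum M k d <
      ((sepBound H : ℝ) + 1) ^ k * rowSum (restr M U) k u := by exact_mod_cast h u hu d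
  have hρ1 := hρ.2.1
  have h4 := pow_le_pow_left₀ (by positivity) hsep k
  rw [mul_pow, mul_pow] at h4
  have h5 : ((sepBound H : ℝ) + 1) ^ k * rowSum (restr M U) k u ≤
      ((sepBound H : ℝ) + 1) ^ k * ρ ^ k :=
    mul_le_mul_of_nonneg_left h2 (by positivity)
  have h6 : (sepBound H : ℝ) ^ k * β ^ k ≤ (sepBound H : ℝ) ^ k * rowSum M k d :=
    mul_le_mul_of_nonneg_left h1 (by positivity)
  linarith

lemma Near.base_eq {H : ℕ} (hH : ∀ b, rowSum M 1 b ≤ H) (hA : Fintype.card A ≤ H)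
    (h : Near M (sepBound H) k) {β : A → ℝ} {e : A → ℕ} {C : A → Finset A}
    (hβ : ∀ b, Block M (C b) (β b))
    (hrate : ∀ b, HasRate (fun k => rowSum M k b) (e b) (β b)) (b c : A) : β b = β c := by
  have key : ∀ b c, β b ≤ β c := fun b c =>
    le_of_near hH hA (U := Finset.univ) (hβ b) (hrate b) (hβ c)
      (fun y hy => le_pow_of_forall_le_rowSum (hβ c).2.1 (hrate c) (Finset.mem_univ c) hy)
      ⟨c, Finset.mem_univ c⟩ (fun u _ d => by rw [restr_univ]; exact h d u)
  exact le_antisymm (key b c) (key c b)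

lemma reach_symm_of_closedSet (hF : ClosedSet M F)
    (h : ∀ b ∈ F, ∀ c, 0 < M b c → Reach M c b) {b c : A} (hb : b ∈ F) (hbc : Reach M b c) :
    Reach M c b := by
  obtain ⟨j, hj⟩ := hbc
  induction j generalizing b with
  | zero =>
    rw [pow_zero, Matrix.one_apply] at hj
    split_ifs at hj with h1
    · exact h1 ▸ .refl b
    · omega
  | succ j ih =>
    obtain ⟨d, hd, hdc⟩ := exists_of_pow_succ_pos hj
    exact (ih (hF b hb d hd) hdc).trans (h b hb d hd)

lemma Block.reach {C : Finset A} {ρ : ℝ} (hB : Block M C ρ) {c d : A} (hc : c ∈ C) (hd : d ∈ C) :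
    Reach M c d := by
  obtain ⟨j, hj⟩ := hB.2.2.1 c hc d hd
  exact ⟨j, hj.trans_le (pow_le_pow_of_le restr_le j c d)⟩

theorem CertQU.uniformRates {H : ℕ} (hH : ∀ b, rowSum M 1 b ≤ H) (hA : Fintype.card A ≤ H)
    (h : CertQU M (sepBound H) k F U) : UniformRates M := by
  obtain ⟨hdbl, hnear, hF, hback, hcover, hsmall⟩ := h
  obtain ⟨β, e, C, hrates⟩ := hdbl.exists_rates
  have heq := hnear.base_eq hH hA (fun b => (hrates b).2.1) (fun b => (hrates b).2.2.1)
  rcases isEmpty_or_nonempty A with hemp | ⟨⟨a⟩⟩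
  · exact ⟨2, by norm_num, fun b => hemp.elim b⟩
  have he : ∀ b, e b = 0 := by
    intro b
    by_contra hb
    obtain ⟨hβ, hB, -, hout⟩ := hrates b
    obtain ⟨c, hc, d, hcd, hdc⟩ := hout (Nat.one_le_iff_ne_zero.2 hb)
    have hCF : ∀ x ∈ C b, x ∉ F := fun x hx hxF =>
      hdc (reach_symm_of_closedSet hF
        (fun b hb c hbc => let ⟨j, _, hj⟩ := hback b hb c hbc; ⟨j, hj⟩)
        (hF.reach_mem hxF (hB.reach hx hc)) hcd)
    have hCU : C b ⊆ U := fun x hx => (hcover x).resolve_left (hCF x hx)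
    obtain ⟨y, -, hy⟩ := Finset.univ.exists_min_image (rowSum M k) ⟨a, Finset.mem_univ a⟩
    have h1 : (rowSum M k y : ℝ) ≤ β b ^ k := by
      rw [heq b y]
      exact le_pow_of_forall_le_rowSum (U := Finset.univ) (hrates y).1.le (hrates y).2.2.1
        (Finset.mem_univ y) (by rw [restr_univ]; exact hy)
    have h2 : β b ^ k ≤ ((rowSum M k y - 1 : ℕ) : ℝ) := by
      obtain ⟨-, -, -, K, hK, hle⟩ := hB
      refine le_of_forall_pow_le (K := K) 0 (Nat.cast_nonneg _) fun j => ?_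
      rw [← pow_mul, pow_zero, one_mul]
      refine (hle c hc (k * j)).1.trans (mul_le_mul_of_nonneg_left ?_ hK.le)
      have h3 := (rowSum_le_of_le (restr_mono (M := M) hCU) (k * j) c).trans
        (closedSet_restr.rowSum_mul_le (x := rowSum M k y - 1)
          (fun u hu => Nat.le_sub_one_of_lt (hsmall u hu y)) j c (hCU hc))
      exact_mod_cast h3
    have h3 : rowSum M k y ≤ rowSum M k y - 1 := by exact_mod_cast h1.trans h2
    have := hdbl y
    omega
  refine ⟨β a, (hrates a).1, fun b => ?_⟩
  rw [heq a b, ← he b]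
  exact (hrates b).2.2.1

/-- If all rows have the same purely geometric rate, then the rows of the restriction to a set
leading into a closed set have a smaller rate. -/
lemma tendsto_rowSum_restr_div (hM : Nonerasing M) {β : ℝ} (hβ : 1 ≤ β) (hF : ClosedSet M F)
    (hdisj : Disjoint U F) (hr : ∀ u ∈ U, ∃ f ∈ F, Reach M u f)
    (h0 : ∀ b, HasRate (fun k => rowSum M k b) 0 β) :
    ∃ q, 1 ≤ q ∧ ∀ u ∈ U,
      Tendsto (fun i => (rowSum (restr M U) (i * q) u : ℝ) / β ^ (i * q)) atTop (nhds 0) := by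
  choose L hL h0 using h0
  have hβ0 : 0 < β := by linarith
  set S : ℝ := 1 + ∑ b, L b with hS
  have hLS : ∀ b, L b ≤ S := fun b => by
    have := Finset.single_le_sum (fun b _ => (hL b).le) (Finset.mem_univ b)
    linarith
  have hS0 : 0 < S := by
    have := Finset.sum_nonneg fun b (_ : b ∈ Finset.univ) => (hL b).le
    linarith
  obtain ⟨q, hq, hconv⟩ := exists_convolution_le_rowSum hM hF hdisj (fun k => β ^ k / S)
    (fun u hu => by
      obtain ⟨f, hf, huf⟩ := hr u hu
      refine ⟨f, hf, huf, fun k => ?_⟩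
      rw [div_le_iff₀ hS0, mul_comm]
      have := (h0 f k).1
      rw [pow_zero, one_mul] at this
      exact this.trans (mul_le_mul_of_nonneg_right (hLS f) (Nat.cast_nonneg _)))
  refine ⟨q, hq, fun u hu => Summable.tendsto_atTop_zero ?_⟩
  refine summable_of_sum_range_le (c := L u * S * β ^ q) (fun i => by positivity) fun n => ?_
  have h2 := (h0 u (n * q)).2
  rw [pow_zero, one_mul] at h2
  have h1 := (hconv n u hu).trans h2
  have hterm : ∀ i ∈ Finset.range n, (rowSum (restr M U) (i * q) u : ℝ) / β ^ (i * q) =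
      (S * β ^ q / β ^ (n * q)) *
        ((rowSum (restr M U) (i * q) u : ℝ) * (β ^ ((n - 1 - i) * q) / S)) := by
    intro i hi
    have hi := Finset.mem_range.1 hi
    have h3 : β ^ (i * q) * β ^ ((n - 1 - i) * q) * β ^ q = β ^ (n * q) := by
      rw [← pow_add, ← pow_add]
      congr 1
      obtain ⟨t, rfl⟩ := Nat.exists_eq_add_of_lt hi
      rw [show i + t + 1 - 1 - i = t by omega]
      ring
    rw [← h3]
    field_simp
  rw [Finset.sum_congr rfl hterm, ← Finset.mul_sum]
  refine (mul_le_mul_of_nonneg_left h1 (by positivity)).trans (le_of_eq ?_)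
  field_simp

lemma not_uniform_of_block (hM : Nonerasing M) {β : ℝ} (hB : Block M U β) (hF : ClosedSet M F)
    (hdisj : Disjoint U F) (hr : ∀ u ∈ U, ∃ f ∈ F, Reach M u f)
    (h0 : ∀ b, HasRate (fun k => rowSum M k b) 0 β) : False := by
  obtain ⟨⟨u, hu⟩, hβ, -, K, hK, hB⟩ := hB
  obtain ⟨q, -, hlim⟩ := tendsto_rowSum_restr_div hM hβ hF hdisj hr h0
  obtain ⟨i, hi⟩ := ((hlim u hu).eventually_lt_const (show 0 < 1 / K by positivity)).exists
  rw [div_lt_div_iff₀ (by positivity) hK, one_mul, mul_comm] at hi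
  exact absurd (hB u hu _).1 (not_le.2 hi)

theorem CertPD.polyRates {H : ℕ} (hH : ∀ b, rowSum M 1 b ≤ H) (hA : Fintype.card A ≤ H)
    (h : CertPD M (sepBound H) k F U) : PolyRates M := by
  obtain ⟨hdbl, hnear, hF, ⟨u, hu⟩, hU⟩ := h
  obtain ⟨β, e, C, hrates⟩ := hdbl.exists_rates
  have heq := hnear.base_eq hH hA (fun b => (hrates b).2.1) (fun b => (hrates b).2.2.1)
  obtain ⟨ρ, hB⟩ : ∃ ρ, Block M U ρ := by
    refine exists_block ⟨u, hu⟩ (fun c hc d hd => ?_) fun c hc => ?_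
    · obtain ⟨j, -, hj⟩ := (hU c hc).2.2.1 d hd
      exact ⟨j, hj⟩
    · have h1 : 0 < rowSum (restr M U) k c :=
        Nat.pos_of_mul_pos_left ((Nat.zero_le _).trans_lt ((hU c hc).2.2.2 c))
      by_contra hno
      push Not at hno
      cases k with
      | zero => simpa using hdbl u
      | succ k =>
        rw [rowSum_succ,
          Finset.sum_eq_zero fun d _ => by rw [Nat.le_zero.1 (hno d), zero_mul]] at h1
        omega
  obtain ⟨hβ1, hCu, hru, -⟩ := hrates u
  have hρβ : ρ ≤ β u := by
    obtain ⟨-, -, -, K, hK, hle⟩ := hB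
    obtain ⟨L, hL, hru⟩ := hru
    refine le_of_forall_pow_le (K := K * L) (e u) (by linarith) fun j => ?_
    rw [mul_assoc]
    refine (hle u hu j).1.trans (mul_le_mul_of_nonneg_left (le_trans ?_ (hru j).2) hK.le)
    exact Nat.cast_le.2 (rowSum_le_of_le restr_le j u)
  have hβρ : β u ≤ ρ := by
    refine le_of_near hH hA hCu hru hB (fun y hy => ?_) ⟨u, hu⟩ fun v hv => (hU v hv).2.2.2
    obtain ⟨-, hρ1, -, K, hK, hle⟩ := hB
    refine le_of_forall_pow_le (K := K) 0 (by positivity) fun j => ?_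
    rw [pow_zero, one_mul, ← pow_mul]
    refine le_trans ?_ (hle u hu (k * j)).2
    exact_mod_cast closedSet_restr.le_rowSum_mul hy j u hu
  have hρ : ρ = β u := le_antisymm hρβ hβρ
  refine ⟨β u, hβ1, e, fun b => heq u b ▸ (hrates b).2.2.1, ?_⟩
  by_contra hno
  push Not at hno
  refine not_uniform_of_block hdbl.nonerasing (hρ ▸ hB) hF
    (Finset.disjoint_left.2 fun v hv => (hU v hv).1) (fun v hv => ?_) fun b => ?_
  · obtain ⟨f, hf, j, -, hj⟩ := (hU v hv).2.1
    exact ⟨f, hf, j, hj⟩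
  · rw [heq u b, ← Nat.lt_one_iff.1 (hno b)]
    exact (hrates b).2.2.1

theorem CertED.expRates (h : CertED M k F U) : ExpRates M := by
  obtain ⟨hdbl, hF, hF0, hU0, hlt⟩ := h
  obtain ⟨β, e, C, hrates⟩ := hdbl.exists_rates
  obtain ⟨b, hb, hbmax⟩ := F.exists_max_image (rowSum M k) hF0
  obtain ⟨u, hu, humin⟩ := U.exists_min_image (rowSum (restr M U) k) hU0
  refine ⟨β, e, fun b => ⟨(hrates b).1, (hrates b).2.2.1⟩, b, u, fun hbu => ?_⟩
  have h1 := pow_le_of_forall_rowSum_le (hrates b).1.le (hrates b).2.2.1 hF hb hbmax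
  have h2 := le_pow_of_forall_le_rowSum (hrates u).1.le (hrates u).2.2.1 hu humin
  rw [hbu] at h1
  exact absurd (hlt b hb u hu) (not_lt.2 (by exact_mod_cast h2.trans h1))

end Certificates

section Completeness

variable [Fintype A] [DecidableEq A] {M : Matrix A A ℕ} {F U : Finset A}

lemma eventually_doubling (h : ∀ b, Tendsto (fun k => rowSum M k b) atTop atTop) :
    ∀ᶠ k in atTop, Doubling M k :=
  eventually_all.2 fun b => (h b).eventually_ge_atTop 2

lemma eventually_reach_lt (M : Matrix A A ℕ) :
    ∀ᶠ k in atTop, ∀ b c, Reach M b c → ∃ j < k, 0 < (M ^ j) b c := by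
  refine eventually_all.2 fun b => eventually_all.2 fun c => ?_
  by_cases h : Reach M b c
  · obtain ⟨j, hj⟩ := h
    filter_upwards [eventually_gt_atTop j] with k hk _ using ⟨j, hk, hj⟩
  · exact Eventually.of_forall fun k hk => absurd hk h

/-- A row sum is eventually dominated by any sequence of a faster geometric growth. -/
lemma eventually_mul_rowSum_lt {a : ℕ → ℕ} {b : A} {e x y : ℕ} {β γ K : ℝ} (hβ : 0 ≤ β)
    (hb : HasRate (fun k => rowSum M k b) e β) (hK : 0 < K) (ha : ∀ k, γ ^ k ≤ K * a k)
    (hlt : x * β < y * γ) : ∀ᶠ k in atTop, x ^ k * rowSum M k b < y ^ k * a k := by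
  obtain ⟨L, hL, hb⟩ := hb
  filter_upwards [eventually_poly_mul_geometric_lt e (K * L) (by positivity) hlt] with k hk
  rw [mul_pow, mul_pow] at hk
  have h1 : (x : ℝ) ^ k * rowSum M k b ≤ x ^ k * (L * (((k : ℝ) + 1) ^ e * β ^ k)) :=
    mul_le_mul_of_nonneg_left (hb k).2 (by positivity)
  have h2 : (y : ℝ) ^ k * γ ^ k ≤ y ^ k * (K * a k) :=
    mul_le_mul_of_nonneg_left (ha k) (by positivity)
  have h3 : K * ((x : ℝ) ^ k * rowSum M k b) < K * (y ^ k * a k) := by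
    have := mul_le_mul_of_nonneg_left h1 hK.le
    nlinarith
  have h4 := lt_of_mul_lt_mul_left h3 hK.le
  exact_mod_cast h4

lemma HasRate.exists_pow_le {a : ℕ → ℝ} {e : ℕ} {β : ℝ} (ha : HasRate a e β) (hβ : 0 ≤ β) :
    ∃ K : ℝ, 0 < K ∧ ∀ k, β ^ k ≤ K * a k := by
  obtain ⟨K, hK, ha⟩ := ha
  refine ⟨K, hK, fun k => le_trans ?_ (ha k).1⟩
  refine le_mul_of_one_le_left (by positivity) (one_le_pow₀ ?_)
  linarith [(Nat.cast_nonneg k : (0 : ℝ) ≤ k)]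

lemma eventually_near {N : ℕ} {β : ℝ} {e : A → ℕ} (hβ : 1 ≤ β)
    (h : ∀ b, HasRate (fun k => rowSum M k b) (e b) β) : ∀ᶠ k in atTop, Near M N k := by
  refine eventually_all.2 fun b => eventually_all.2 fun c => ?_
  obtain ⟨K, hK, hc⟩ := (h c).exists_pow_le (by linarith)
  refine eventually_mul_rowSum_lt (by linarith) (h b) hK hc ?_
  push_cast
  linarith

/-- Every letter reaches one from which all accessible letters lead back. -/
lemma exists_reach_terminal (M : Matrix A A ℕ) (b : A) :
    ∃ f, Reach M b f ∧ ∀ c, Reach M f c → Reach M c f := by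
  classical
  obtain ⟨f, hf, hmin⟩ := (Finset.univ.filter (Reach M b)).exists_min_image
    (fun f => (Finset.univ.filter (Reach M f)).card) ⟨b, by simpa using Reach.refl b⟩
  simp only [Finset.mem_filter, Finset.mem_univ, true_and] at hf hmin
  refine ⟨f, hf, fun c hc => ?_⟩
  by_contra hcf
  refine absurd (hmin c (hf.trans hc)) (not_le.2 (Finset.card_lt_card ?_))
  rw [Finset.ssubset_iff_of_subset]
  · exact ⟨f, by simpa using Reach.refl f, by simpa using hcf⟩
  · intro d hd
    simp only [Finset.mem_filter, Finset.mem_univ, true_and] at hd ⊢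
    exact hc.trans hd

lemma exists_certQU (h : ∀ b, Tendsto (fun k => rowSum M k b) atTop atTop) (N : ℕ) {β : ℝ}
    (hβ : 1 < β) (hrate : ∀ b, HasRate (fun k => rowSum M k b) 0 β) :
    ∃ k F U, CertQU M N k F U := by
  classical
  obtain ⟨k₀, hk₀⟩ := (eventually_doubling h).exists
  have hM := hk₀.nonerasing
  set F : Finset A := Finset.univ.filter fun b => ∀ c, Reach M b c → Reach M c b with hFdef
  have hmem : ∀ b, b ∈ F ↔ ∀ c, Reach M b c → Reach M c b := fun b => by simp [hFdef]
  have hF : ClosedSet M F := by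
    intro b hb c hbc
    rw [hmem] at hb ⊢
    exact fun d hcd => (hb d (.trans (.edge hbc) hcd)).trans (.edge hbc)
  obtain ⟨q, hq, hlim⟩ := tendsto_rowSum_restr_div hM hβ.le hF (U := Fᶜ) disjoint_compl_left
    (fun u _ => by
      obtain ⟨f, hf, hf'⟩ := exists_reach_terminal M u
      exact ⟨f, (hmem f).2 hf', hf⟩) hrate
  have hsmall : ∀ᶠ i in atTop, ∀ b, b ∈ Fᶜ → ∀ c,
      rowSum (restr M Fᶜ) (i * q) b < rowSum M (i * q) c := by
    refine eventually_all.2 fun b => ?_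
    by_cases hb : b ∈ Fᶜ
    · refine (eventually_all.2 fun c => ?_).mono fun i hi _ => hi
      obtain ⟨K, hK, hc⟩ := (hrate c).exists_pow_le (by linarith)
      filter_upwards [(hlim b hb).eventually_lt_const (show 0 < 1 / K by positivity)] with i hi
      rw [div_lt_div_iff₀ (by positivity) hK, one_mul, mul_comm] at hi
      exact_mod_cast lt_of_mul_lt_mul_left (hi.trans_le (hc _)) hK.le
    · exact Eventually.of_forall fun i hi => absurd hi hb
  have htend : Tendsto (fun i => i * q) atTop atTop :=
    tendsto_atTop_mono (fun i => Nat.le_mul_of_pos_right i hq) tendsto_id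
  obtain ⟨i, hi₁, hi₂, hi₃, hi₄⟩ := (hsmall.and ((htend.eventually (eventually_doubling h)).and
    ((htend.eventually (eventually_near (N := N) hβ.le hrate)).and
      (htend.eventually (eventually_reach_lt M))))).exists
  refine ⟨i * q, F, Fᶜ, hi₂, hi₃, hF, fun b hb c hbc => ?_, fun b => ?_, hi₁⟩
  · exact hi₄ c b ((hmem b).1 hb c (.edge hbc))
  · rw [Finset.mem_compl]
    exact em _

lemma exists_certPD (h : ∀ b, Tendsto (fun k => rowSum M k b) atTop atTop) (N : ℕ) {β : ℝ}
    {e : A → ℕ} (hrate : ∀ b, HasRate (fun k => rowSum M k b) (e b) β) {C : Finset A}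
    (hC : Block M C β) (hout : ∃ c ∈ C, ∃ d, Reach M c d ∧ ¬ Reach M d c) :
    ∃ k F U, CertPD M N k F U := by
  classical
  obtain ⟨c, hc, d, hcd, hdc⟩ := hout
  have hβ : 1 ≤ β := hC.2.1
  have hnear : ∀ᶠ k in atTop, ∀ u, u ∈ C → ∀ b,
      N ^ k * rowSum M k b < (N + 1) ^ k * rowSum (restr M C) k u := by
    refine eventually_all.2 fun u => ?_
    by_cases hu : u ∈ C
    · refine (eventually_all.2 fun b => ?_).mono fun i hi _ => hi
      obtain ⟨-, -, -, K, hK, hle⟩ := hC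
      refine eventually_mul_rowSum_lt (by linarith) (hrate b) hK (fun k => (hle u hu k).1) ?_
      push_cast
      linarith
    · exact Eventually.of_forall fun i hi => absurd hi hu
  obtain ⟨k, hk₁, hk₂, hk₃, hk₄, hk₅⟩ := (hnear.and ((eventually_doubling h).and
    ((eventually_near (N := N) hβ hrate).and ((eventually_reach_lt M).and
      (eventually_reach_lt (restr M C)))))).exists
  refine ⟨k, Finset.univ.filter fun x => Reach M d x, C, hk₂, hk₃, closedSet_reach d, hC.1,
    fun u hu => ⟨?_, ?_, ?_, ?_⟩⟩
  · simp only [Finset.mem_filter, Finset.mem_univ, true_and]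
    exact fun hdu => hdc (hdu.trans (hC.reach hu hc))
  · exact ⟨d, by simpa using Reach.refl d, hk₄ u d ((hC.reach hu hc).trans hcd)⟩
  · exact fun v hv => hk₅ u v (hC.2.2.1 u hu v hv)
  · exact hk₁ u hu

lemma exists_certED (h : ∀ b, Tendsto (fun k => rowSum M k b) atTop atTop) {b : A} {β γ : ℝ}
    {e : ℕ} (hβ : 1 ≤ β) (hrate : HasRate (fun k => rowSum M k b) e β) {C : Finset A}
    (hC : Block M C γ) (hlt : β < γ) : ∃ k F U, CertED M k F U := by
  classical
  have hsmall : ∀ᶠ k in atTop, ∀ f u, Reach M b f → u ∈ C →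
      rowSum M k f < rowSum (restr M C) k u := by
    refine eventually_all.2 fun f => eventually_all.2 fun u => ?_
    by_cases hf : Reach M b f
    · by_cases hu : u ∈ C
      · obtain ⟨R, hR, hle⟩ := hf.exists_rowSum_le
        obtain ⟨-, -, -, K, hK, hB⟩ := hC
        obtain ⟨L, hL, hb⟩ := hrate
        filter_upwards [eventually_poly_mul_geometric_lt e (K * (R * L)) (by linarith) hlt]
          with k hk _ _
        have h1 : K * (rowSum M k f : ℝ) ≤ K * (R * L) * (((k : ℝ) + 1) ^ e * β ^ k) := by
          rw [mul_assoc, mul_assoc]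
          exact mul_le_mul_of_nonneg_left ((hle k).trans
            (mul_le_mul_of_nonneg_left (hb k).2 hR.le)) hK.le
        exact_mod_cast lt_of_mul_lt_mul_left ((h1.trans_lt hk).trans_le (hB u hu k).1) hK.le
      · exact Eventually.of_forall fun i _ hi => absurd hi hu
    · exact Eventually.of_forall fun i hi => absurd hi hf
  obtain ⟨k, hk₁, hk₂⟩ := (hsmall.and (eventually_doubling h)).exists
  refine ⟨k, Finset.univ.filter fun x => Reach M b x, C, hk₂, closedSet_reach b,
    ⟨b, by simpa using Reach.refl b⟩, hC.1,
    fun f hf u hu => hk₁ f u (by simpa using hf) hu⟩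

theorem exists_cert (h : ∀ b, Tendsto (fun k => rowSum M k b) atTop atTop) (N : ℕ) :
    ∃ k F U, CertQU M N k F U ∨ CertPD M N k F U ∨ CertED M k F U := by
  obtain ⟨k₀, hk₀⟩ := (eventually_doubling h).exists
  obtain ⟨β, e, C, hrates⟩ := hk₀.exists_rates
  rcases isEmpty_or_nonempty A with hemp | ⟨⟨a⟩⟩
  · obtain ⟨k, F, U, hc⟩ := exists_certQU h N (β := 2) (by norm_num) (fun b => hemp.elim b)
    exact ⟨k, F, U, .inl hc⟩
  by_cases heq : ∀ b, β b = β a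
  · by_cases he : ∃ b, 1 ≤ e b
    · obtain ⟨b, hb⟩ := he
      obtain ⟨k, F, U, hc⟩ := exists_certPD h N (e := e)
        (fun c => (heq b).trans (heq c).symm ▸ (hrates c).2.2.1) (hrates b).2.1
        ((hrates b).2.2.2 hb)
      exact ⟨k, F, U, .inr (.inl hc)⟩
    · push Not at he
      obtain ⟨k, F, U, hc⟩ := exists_certQU h N (hrates a).1 (fun c => by
        rw [← heq c, ← Nat.lt_one_iff.1 (he c)]
        exact (hrates c).2.2.1)
      exact ⟨k, F, U, .inl hc⟩
  · push Not at heq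
    obtain ⟨b, hb⟩ := heq
    rcases lt_or_gt_of_ne hb with hlt | hlt
    · obtain ⟨k, F, U, hc⟩ := exists_certED h (hrates b).1.le (hrates b).2.2.1 (hrates a).2.1 hlt
      exact ⟨k, F, U, .inr (.inr hc)⟩
    · obtain ⟨k, F, U, hc⟩ := exists_certED h (hrates a).1.le (hrates a).2.2.1 (hrates b).2.1 hlt
      exact ⟨k, F, U, .inr (.inr hc)⟩

end Completeness

section Classes

lemma poly_mul_pow_pos {β : ℝ} (hβ : 1 < β) (e : ℕ) {k : ℕ} (hk : 1 ≤ k) :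
    0 < (k : ℝ) ^ e * β ^ k := by
  have : (0 : ℝ) < k := by exact_mod_cast hk
  positivity

lemma HasRate.isTheta {a : ℕ → ℝ} {e : ℕ} {β : ℝ} (h : HasRate a e β) (hβ : 1 < β) :
    a =Θ[atTop] fun k : ℕ => (k : ℝ) ^ e * β ^ k := by
  obtain ⟨K, hK, h⟩ := h
  constructor
  · refine IsBigO.of_bound (K * 2 ^ e) ?_
    filter_upwards [eventually_ge_atTop 1] with k hk
    have hk' : (1 : ℝ) ≤ k := by exact_mod_cast hk
    have hpos := poly_mul_pow_pos hβ e hk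
    have ha : 0 ≤ a k := by
      have h1 := (h k).1
      have h2 : 0 ≤ ((k : ℝ) + 1) ^ e * β ^ k := by positivity
      nlinarith
    rw [Real.norm_of_nonneg ha, Real.norm_of_nonneg hpos.le]
    refine (h k).2.trans ?_
    rw [mul_assoc, ← mul_assoc (2 ^ e), ← mul_pow]
    gcongr
    linarith
  · refine IsBigO.of_bound K ?_
    filter_upwards [eventually_ge_atTop 1] with k hk
    have hpos := poly_mul_pow_pos hβ e hk
    rw [Real.norm_of_nonneg hpos.le]
    calc (k : ℝ) ^ e * β ^ k ≤ ((k : ℝ) + 1) ^ e * β ^ k := by gcongr; linarith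
      _ ≤ K * a k := (h k).1
      _ ≤ K * ‖a k‖ := mul_le_mul_of_nonneg_left (le_abs_self _) hK.le

lemma tendsto_poly_mul_pow {β : ℝ} (hβ : 1 < β) (e : ℕ) :
    Tendsto (fun k : ℕ => (k : ℝ) ^ e * β ^ k) atTop atTop := by
  refine tendsto_atTop_mono' atTop ?_ (tendsto_pow_atTop_atTop_of_one_lt hβ)
  filter_upwards [eventually_ge_atTop 1] with k hk
  have hk' : (1 : ℝ) ≤ k := by exact_mod_cast hk
  exact le_mul_of_one_le_left (by positivity) (one_le_pow₀ hk')

lemma base_le_of_isBigO {β γ : ℝ} (hβ : 1 < β) (hγ : 1 < γ) {e d : ℕ}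
    (h : (fun k : ℕ => (k : ℝ) ^ e * β ^ k) =O[atTop] fun k : ℕ => (k : ℝ) ^ d * γ ^ k) :
    β ≤ γ := by
  by_contra hlt
  obtain ⟨K, hK, h⟩ := h.exists_pos
  obtain ⟨k, hk1, hk2, hk3⟩ := (h.bound.and ((eventually_poly_mul_geometric_lt d K (by linarith)
    (not_le.1 hlt)).and (eventually_ge_atTop 1))).exists
  rw [Real.norm_of_nonneg (poly_mul_pow_pos hβ e hk3).le,
    Real.norm_of_nonneg (poly_mul_pow_pos hγ d hk3).le] at hk1
  have hk' : (1 : ℝ) ≤ k := by exact_mod_cast hk3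
  have h1 : β ^ k ≤ (k : ℝ) ^ e * β ^ k :=
    le_mul_of_one_le_left (by positivity) (one_le_pow₀ hk')
  have h2 : K * ((k : ℝ) ^ d * γ ^ k) ≤ K * (((k : ℝ) + 1) ^ d * γ ^ k) := by
    gcongr
    linarith
  linarith

lemma exponent_le_of_isBigO {β : ℝ} (hβ : 1 < β) {e d : ℕ}
    (h : (fun k : ℕ => (k : ℝ) ^ e * β ^ k) =O[atTop] fun k : ℕ => (k : ℝ) ^ d * β ^ k) :
    e ≤ d := by
  by_contra hlt
  obtain ⟨K, hK, h⟩ := h.exists_pos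
  obtain ⟨n, hn⟩ := exists_nat_gt K
  obtain ⟨k, hk1, hk2, hk3⟩ := (h.bound.and ((eventually_ge_atTop n).and
    (eventually_ge_atTop 1))).exists
  rw [Real.norm_of_nonneg (poly_mul_pow_pos hβ e hk3).le,
    Real.norm_of_nonneg (poly_mul_pow_pos hβ d hk3).le, ← mul_assoc] at hk1
  have h1 := le_of_mul_le_mul_right hk1 (by positivity)
  have hk' : (1 : ℝ) ≤ k := by exact_mod_cast hk3
  have hnk : (n : ℝ) ≤ k := by exact_mod_cast hk2
  have h2 : (k : ℝ) ^ (d + 1) ≤ (k : ℝ) ^ e := pow_le_pow_right₀ hk' (not_le.1 hlt)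
  have h3 : 0 < (k : ℝ) ^ d := by positivity
  rw [pow_succ] at h2
  nlinarith

lemma rate_unique {a : ℕ → ℝ} {β γ : ℝ} (hβ : 1 < β) (hγ : 1 < γ) {e d : ℕ}
    (h₁ : a =Θ[atTop] fun k : ℕ => (k : ℝ) ^ e * β ^ k)
    (h₂ : a =Θ[atTop] fun k : ℕ => (k : ℝ) ^ d * γ ^ k) : β = γ ∧ e = d := by
  have h := h₁.symm.trans h₂
  obtain rfl := le_antisymm (base_le_of_isBigO hβ hγ h.1) (base_le_of_isBigO hγ hβ h.2)
  exact ⟨rfl, le_antisymm (exponent_le_of_isBigO hβ h.1) (exponent_le_of_isBigO hβ h.2)⟩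

lemma tendsto_of_isTheta {a : ℕ → ℕ} {β : ℝ} (hβ : 1 < β) {e : ℕ}
    (h : (fun k => (a k : ℝ)) =Θ[atTop] fun k : ℕ => (k : ℝ) ^ e * β ^ k) :
    Tendsto a atTop atTop := by
  obtain ⟨K, hK, h⟩ := h.2.exists_pos
  rw [← tendsto_natCast_atTop_iff (R := ℝ)]
  refine tendsto_atTop_mono' atTop ?_ ((tendsto_poly_mul_pow hβ e).atTop_div_const hK)
  filter_upwards [h.bound] with k hk
  rw [div_le_iff₀ hK, mul_comm _ K]
  simpa using (le_abs_self _).trans hk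

variable {φ : A → List A}

lemma quasiUniform_isTheta {b : A} {β : ℝ}
    (h : (fun k => (((wordMap φ)^[k] [b]).length : ℝ)) =Θ[atTop] (fun k => β ^ k)) :
    (fun k => (((wordMap φ)^[k] [b]).length : ℝ)) =Θ[atTop] fun k : ℕ => (k : ℝ) ^ 0 * β ^ k := by
  simpa using h

lemma growing_of_quasiUniform (h : QuasiUniform φ) : Growing φ := by
  obtain ⟨β, hβ, h⟩ := h
  exact fun b => tendsto_of_isTheta hβ (quasiUniform_isTheta (h b))

lemma growing_of_polyDivergent (h : PolyDivergent φ) : Growing φ := by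
  obtain ⟨β, hβ, e, h, -⟩ := h
  exact fun b => tendsto_of_isTheta hβ (h b)

lemma growing_of_expDivergent (h : ExpDivergent φ) : Growing φ := by
  obtain ⟨β, e, h, -⟩ := h
  exact fun b => tendsto_of_isTheta (h b).1 (h b).2

lemma not_polyDivergent_of_quasiUniform (h : QuasiUniform φ) : ¬ PolyDivergent φ := by
  rintro ⟨β, hβ, e, h', b, hb⟩
  obtain ⟨γ, hγ, h⟩ := h
  have := (rate_unique hγ hβ (quasiUniform_isTheta (h b)) (h' b)).2
  omega

lemma not_expDivergent_of_quasiUniform (h : QuasiUniform φ) : ¬ ExpDivergent φ := by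
  rintro ⟨β, e, h', b, c, hbc⟩
  obtain ⟨γ, hγ, h⟩ := h
  have h1 := fun b => (rate_unique hγ (h' b).1 (quasiUniform_isTheta (h b)) (h' b).2).1
  exact hbc ((h1 b).symm.trans (h1 c))

lemma not_expDivergent_of_polyDivergent (h : PolyDivergent φ) : ¬ ExpDivergent φ := by
  rintro ⟨β, e, h', b, c, hbc⟩
  obtain ⟨γ, hγ, d, h, -⟩ := h
  have h1 := fun b => (rate_unique hγ (h' b).1 (h b) (h' b).2).1
  exact hbc ((h1 b).symm.trans (h1 c))

/-- An eventually periodic orbit of words witnesses a bounded letter. -/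
lemma not_growing_of_iterate_eq {b : A} {i k : ℕ} (hik : i < k)
    (h : (wordMap φ)^[i] [b] = (wordMap φ)^[k] [b]) : ¬ Growing φ := by
  intro hg
  obtain ⟨p, rfl⟩ := Nat.exists_eq_add_of_lt hik
  have hper : ∀ n, (wordMap φ)^[(p + 1) * n + i] [b] = (wordMap φ)^[i] [b] := by
    intro n
    induction n with
    | zero => simp
    | succ n ih =>
      rw [show (p + 1) * (n + 1) + i = (p + 1) * n + (i + p + 1) by ring,
        Function.iterate_add_apply, ← h, ← Function.iterate_add_apply, ih]
  obtain ⟨K, hK⟩ := (tendsto_atTop_atTop.1 (hg b)) (((wordMap φ)^[i] [b]).length + 1)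
  have := hK ((p + 1) * K + i) (by nlinarith)
  rw [hper] at this
  omega

lemma exists_iterate_eq_of_not_growing [Finite A] (h : ¬ Growing φ) :
    ∃ b, ∃ i k, i < k ∧ (wordMap φ)^[i] [b] = (wordMap φ)^[k] [b] := by
  simp only [Growing, not_forall] at h
  obtain ⟨b, hb⟩ := h
  rw [GrowingLetter, tendsto_atTop] at hb
  push Not at hb
  obtain ⟨n, hn⟩ := hb
  have hinf : {k | ((wordMap φ)^[k] [b]).length < n}.Infinite := by
    rw [← Nat.frequently_atTop_iff_infinite]
    simpa using hn
  obtain ⟨i, -, k, -, hik, heq⟩ := hinf.exists_lt_map_eq_of_mapsTo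
    (f := fun k => (wordMap φ)^[k] [b]) (t := {l : List A | l.length < n}) (fun k hk => hk)
    (List.finite_length_lt A n)
  exact ⟨b, i, k, hik, heq⟩

variable [Fintype A] [DecidableEq A]

/-- The incidence matrix of a morphism. -/
def incidence (φ : A → List A) : Matrix A A ℕ := fun b c => (φ b).count c

lemma count_wordMap (w : List A) (c : A) :
    (wordMap φ w).count c = ∑ b, w.count b * incidence φ b c := by
  induction w with
  | nil => simp [wordMap]
  | cons a w ih =>
    have h1 : wordMap φ (a :: w) = φ a ++ wordMap φ w := rfl
    simp only [h1, List.count_append, ih, List.count_cons, add_mul, Finset.sum_add_distrib]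
    rw [add_comm]
    congr 1
    simp [incidence, ite_mul]

lemma count_iterate (k : ℕ) (w : List A) (c : A) :
    ((wordMap φ)^[k] w).count c = ∑ b, w.count b * (incidence φ ^ k) b c := by
  induction k generalizing w with
  | zero => simp [Matrix.one_apply]
  | succ k ih =>
    rw [Function.iterate_succ_apply, ih]
    simp only [count_wordMap, pow_succ', Matrix.mul_apply, Finset.sum_mul, Finset.mul_sum]
    rw [Finset.sum_comm]
    simp only [mul_assoc]

lemma count_iterate_letter (k : ℕ) (b c : A) :
    ((wordMap φ)^[k] [b]).count c = (incidence φ ^ k) b c := by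
  rw [count_iterate]
  simp [List.count_singleton]

lemma mem_iterate_letter {k : ℕ} {b c : A} :
    c ∈ (wordMap φ)^[k] [b] ↔ 0 < (incidence φ ^ k) b c := by
  rw [← count_iterate_letter, List.count_pos_iff]

lemma length_iterate_letter (k : ℕ) (b : A) :
    ((wordMap φ)^[k] [b]).length = rowSum (incidence φ) k b := by
  simp only [rowSum, ← count_iterate_letter]
  have := Multiset.sum_count_eq_card (s := Finset.univ)
    (m := (((wordMap φ)^[k] [b] : List A) : Multiset A)) (fun a _ => Finset.mem_univ a)
  simpa using this.symm

lemma growing_iff : Growing φ ↔ ∀ b, Tendsto (fun k => rowSum (incidence φ) k b) atTop atTop := by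
  simp [Growing, GrowingLetter, length_iterate_letter]

lemma UniformRates.quasiUniform (h : UniformRates (incidence φ)) : QuasiUniform φ := by
  obtain ⟨β, hβ, h⟩ := h
  refine ⟨β, hβ, fun b => ?_⟩
  simpa [length_iterate_letter] using (h b).isTheta hβ

lemma PolyRates.polyDivergent (h : PolyRates (incidence φ)) : PolyDivergent φ := by
  obtain ⟨β, hβ, e, h, he⟩ := h
  refine ⟨β, hβ, e, fun b => ?_, he⟩
  simpa [length_iterate_letter] using (h b).isTheta hβ

lemma ExpRates.expDivergent (h : ExpRates (incidence φ)) : ExpDivergent φ := by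
  obtain ⟨β, e, h, hne⟩ := h
  refine ⟨β, e, fun b => ⟨(h b).1, ?_⟩, hne⟩
  simpa [length_iterate_letter] using (h b).2.isTheta (h b).1

lemma incidence_filter (U : Finset A) :
    incidence (fun b => (φ b).filter (· ∈ U)) = restr (incidence φ) U := by
  ext b c
  simp only [incidence, restr]
  split_ifs with h
  · exact List.count_filter (by simpa using h)
  · exact List.count_eq_zero.2 fun hc => h (by simpa using (List.mem_filter.1 hc).2)

end Classes

section ListCertificates

/-! Words, morphisms and certificates coded by lists of natural numbers. -/

/-- The image of the letter `b` under the `k`-th iterate of the morphism coded by `x`. -/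
def codeIter (x : List (List ℕ)) (k b : ℕ) : List ℕ :=
  (fun w : List ℕ => w.flatMap fun i => x.getD i [])^[k] [b]

/-- The code of the morphism that keeps only the letters of `U` in the images of letters. -/
def codeRestr (x : List (List ℕ)) (U : List ℕ) : List (List ℕ) :=
  x.map fun l => l.filter (· ∈ U)

def CodeDoubling (x : List (List ℕ)) (k : ℕ) : Prop :=
  ∀ b ∈ List.range x.length, 2 ≤ (codeIter x k b).length

def CodeNear (x : List (List ℕ)) (N k : ℕ) : Prop :=
  ∀ b ∈ List.range x.length, ∀ c ∈ List.range x.length,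
    N ^ k * (codeIter x k b).length < (N + 1) ^ k * (codeIter x k c).length

def CodeClosed (x : List (List ℕ)) (F : List ℕ) : Prop :=
  ∀ b ∈ F, ∀ c ∈ codeIter x 1 b, c ∈ F

def CodeReach (x : List (List ℕ)) (k b c : ℕ) : Prop :=
  ∃ j ∈ List.range k, c ∈ codeIter x j b

def CodeCertQU (x : List (List ℕ)) (N k : ℕ) (F U : List ℕ) : Prop :=
  CodeDoubling x k ∧ CodeNear x N k ∧ CodeClosed x F ∧
    (∀ b ∈ F, ∀ c ∈ codeIter x 1 b, CodeReach x k c b) ∧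
    (∀ b ∈ List.range x.length, b ∈ F ∨ b ∈ U) ∧
    ∀ b ∈ U, ∀ c ∈ List.range x.length,
      (codeIter (codeRestr x U) k b).length < (codeIter x k c).length

def CodeCertPD (x : List (List ℕ)) (N k : ℕ) (F U : List ℕ) : Prop :=
  CodeDoubling x k ∧ CodeNear x N k ∧ CodeClosed x F ∧ U ≠ [] ∧
    ∀ u ∈ U, u ∉ F ∧ (∃ f ∈ F, CodeReach x k u f) ∧
      (∀ v ∈ U, CodeReach (codeRestr x U) k u v) ∧
      ∀ b ∈ List.range x.length,
        N ^ k * (codeIter x k b).length <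
          (N + 1) ^ k * (codeIter (codeRestr x U) k u).length

def CodeCertED (x : List (List ℕ)) (k : ℕ) (F U : List ℕ) : Prop :=
  CodeDoubling x k ∧ CodeClosed x F ∧ F ≠ [] ∧ U ≠ [] ∧
    ∀ b ∈ F, ∀ u ∈ U, (codeIter x k b).length < (codeIter (codeRestr x U) k u).length

/-- Some letter has an eventually periodic orbit, with a repetition at time `k`. -/
def CodePeriodic (x : List (List ℕ)) (k : ℕ) : Prop :=
  ∃ b ∈ List.range x.length, ∃ i ∈ List.range k, codeIter x i b = codeIter x k b

def CodeValid (x : List (List ℕ)) (l : List ℕ) : Prop :=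
  ∀ i ∈ l, i < x.length

/-- A bound for both the number of letters and the lengths of the images of letters. -/
def codeSize (x : List (List ℕ)) : ℕ := x.length + x.flatten.length

end ListCertificates

section Computability

variable {α β σ : Type*} [Primcodable α] [Primcodable β] [Primcodable σ]

lemma primrecPred_forall_mem {L : α → List β} {R : α → β → Prop} (hL : Primrec L)
    (hR : PrimrecPred fun p : α × β => R p.1 p.2) : PrimrecPred fun a => ∀ b ∈ L a, R a b := by
  have h : PrimrecRel fun (b : β) (a : α) => R a b := hR.comp (Primrec.snd.pair Primrec.fst)
  exact h.forall_mem_list.comp hL Primrec.id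

lemma primrecPred_exists_mem {L : α → List β} {R : α → β → Prop} (hL : Primrec L)
    (hR : PrimrecPred fun p : α × β => R p.1 p.2) : PrimrecPred fun a => ∃ b ∈ L a, R a b := by
  have h : PrimrecRel fun (b : β) (a : α) => R a b := hR.comp (Primrec.snd.pair Primrec.fst)
  exact h.exists_mem_list.comp hL Primrec.id

lemma primrecPred_mem {L : α → List β} {b : α → β} (hL : Primrec L) (hb : Primrec b) :
    PrimrecPred fun a => b a ∈ L a :=
  (primrecPred_exists_mem hL (R := fun a c => c = b a)
    (Primrec.eq.comp Primrec.snd (hb.comp Primrec.fst))).of_eq fun a => by simp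

lemma primrec_pow {f g : α → ℕ} (hf : Primrec f) (hg : Primrec g) :
    Primrec fun a => f a ^ g a := by
  have h : Primrec₂ fun a b : ℕ => a ^ b := Primrec₂.unpaired'.1 Nat.Primrec.pow
  exact h.comp hf hg

lemma primrec_sepBound : Primrec sepBound := by
  have hH : Primrec fun H : ℕ => H := Primrec.id
  have hsq := primrec_pow hH (Primrec.const 2)
  refine Primrec.nat_mul.comp hH (Primrec.nat_mul.comp (Primrec.succ.comp hsq)
    (Primrec.nat_mul.comp (primrec_pow (Primrec.succ.comp
      (Primrec.nat_mul.comp (Primrec.const 2) hH)) hsq) (primrec_pow (Primrec.const 2) hsq)))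

lemma primrec_codeSize : Primrec codeSize :=
  Primrec.nat_add.comp Primrec.list_length (Primrec.list_length.comp Primrec.list_flatten)

lemma primrec_codeIter {x : α → List (List ℕ)} {k b : α → ℕ} (hx : Primrec x) (hk : Primrec k)
    (hb : Primrec b) : Primrec fun a => codeIter (x a) (k a) (b a) := by
  refine Primrec.nat_iterate hk (Primrec.list_cons.comp hb (Primrec.const [])) ?_
  refine Primrec.list_flatMap Primrec.snd ?_
  exact (Primrec.list_getD []).comp (hx.comp (Primrec.fst.comp Primrec.fst)) Primrec.snd

lemma primrec_codeRestr {x : α → List (List ℕ)} {U : α → List ℕ} (hx : Primrec x)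
    (hU : Primrec U) : Primrec fun a => codeRestr (x a) (U a) := by
  refine Primrec.list_map hx ?_
  have h : PrimrecRel fun (i : ℕ) (V : List ℕ) => i ∈ V :=
    primrecPred_mem Primrec.snd Primrec.fst
  exact h.listFilter.comp Primrec.snd (hU.comp Primrec.fst)

lemma primrec_range_length {x : α → List β} (hx : Primrec x) :
    Primrec fun a => List.range (x a).length :=
  Primrec.list_range.comp (Primrec.list_length.comp hx)

variable {x : α → List (List ℕ)} {N k : α → ℕ} {F U : α → List ℕ}

lemma primrecPred_codeDoubling (hx : Primrec x) (hk : Primrec k) :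
    PrimrecPred fun a => CodeDoubling (x a) (k a) :=
  primrecPred_forall_mem (primrec_range_length hx) <|
    Primrec.nat_le.comp (Primrec.const 2) <| Primrec.list_length.comp <|
      primrec_codeIter (hx.comp .fst) (hk.comp .fst) .snd

lemma primrecPred_near {s t : α → ℕ} (hN : Primrec N) (hk : Primrec k) (hs : Primrec s)
    (ht : Primrec t) : PrimrecPred fun a => N a ^ k a * s a < (N a + 1) ^ k a * t a :=
  Primrec.nat_lt.comp (Primrec.nat_mul.comp (primrec_pow hN hk) hs)
    (Primrec.nat_mul.comp (primrec_pow (Primrec.succ.comp hN) hk) ht)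

lemma primrecPred_codeNear (hx : Primrec x) (hN : Primrec N) (hk : Primrec k) :
    PrimrecPred fun a => CodeNear (x a) (N a) (k a) := by
  have h2 : Primrec fun p : (α × ℕ) × ℕ => p.1.1 := Primrec.fst.comp .fst
  refine primrecPred_forall_mem (primrec_range_length hx) <|
    primrecPred_forall_mem (primrec_range_length (hx.comp .fst)) <|
      primrecPred_near (hN.comp h2) (hk.comp h2)
        (Primrec.list_length.comp ?_) (Primrec.list_length.comp ?_)
  · exact primrec_codeIter (hx.comp h2) (hk.comp h2) (Primrec.snd.comp .fst)
  · exact primrec_codeIter (hx.comp h2) (hk.comp h2) .snd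

lemma primrecPred_codeClosed (hx : Primrec x) (hF : Primrec F) :
    PrimrecPred fun a => CodeClosed (x a) (F a) :=
  primrecPred_forall_mem hF <|
    primrecPred_forall_mem (primrec_codeIter (hx.comp .fst) (Primrec.const 1) .snd) <|
      primrecPred_mem (hF.comp (Primrec.fst.comp .fst)) .snd

lemma primrecPred_codeReach {b c : α → ℕ} (hx : Primrec x) (hk : Primrec k) (hb : Primrec b)
    (hc : Primrec c) : PrimrecPred fun a => CodeReach (x a) (k a) (b a) (c a) :=
  primrecPred_exists_mem (Primrec.list_range.comp hk) <|
    primrecPred_mem (primrec_codeIter (hx.comp .fst) .snd (hb.comp .fst)) (hc.comp .fst)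

lemma primrecPred_codeCertQU (hx : Primrec x) (hN : Primrec N) (hk : Primrec k)
    (hF : Primrec F) (hU : Primrec U) :
    PrimrecPred fun a => CodeCertQU (x a) (N a) (k a) (F a) (U a) := by
  have h2 : Primrec fun p : (α × ℕ) × ℕ => p.1.1 := Primrec.fst.comp .fst
  refine (primrecPred_codeDoubling hx hk).and <| (primrecPred_codeNear hx hN hk).and <|
    (primrecPred_codeClosed hx hF).and <| .and ?_ <| .and ?_ ?_
  · exact primrecPred_forall_mem hF <|
      primrecPred_forall_mem (primrec_codeIter (hx.comp .fst) (Primrec.const 1) .snd) <|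
        primrecPred_codeReach (hx.comp h2) (hk.comp h2) .snd (Primrec.snd.comp .fst)
  · exact primrecPred_forall_mem (primrec_range_length hx) <|
      (primrecPred_mem (hF.comp .fst) .snd).or (primrecPred_mem (hU.comp .fst) .snd)
  · refine primrecPred_forall_mem hU <|
      primrecPred_forall_mem (primrec_range_length (hx.comp .fst)) <|
        Primrec.nat_lt.comp (Primrec.list_length.comp ?_) (Primrec.list_length.comp ?_)
    · exact primrec_codeIter (primrec_codeRestr (hx.comp h2) (hU.comp h2)) (hk.comp h2)
        (Primrec.snd.comp .fst)
    · exact primrec_codeIter (hx.comp h2) (hk.comp h2) .snd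

lemma primrecPred_ne_nil (hU : Primrec U) : PrimrecPred fun a => U a ≠ [] :=
  (Primrec.eq.comp hU (Primrec.const [])).not

lemma primrecPred_codeCertPD (hx : Primrec x) (hN : Primrec N) (hk : Primrec k)
    (hF : Primrec F) (hU : Primrec U) :
    PrimrecPred fun a => CodeCertPD (x a) (N a) (k a) (F a) (U a) := by
  have h2 : Primrec fun p : (α × ℕ) × ℕ => p.1.1 := Primrec.fst.comp .fst
  have hr := primrec_codeRestr (hx.comp h2) (hU.comp h2)
  refine (primrecPred_codeDoubling hx hk).and <| (primrecPred_codeNear hx hN hk).and <|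
    (primrecPred_codeClosed hx hF).and <| (primrecPred_ne_nil hU).and <|
    primrecPred_forall_mem hU <| (primrecPred_mem (hF.comp .fst) .snd).not.and <|
    .and ?_ <| .and ?_ ?_
  · exact primrecPred_exists_mem (hF.comp .fst) <|
      primrecPred_codeReach (hx.comp h2) (hk.comp h2) (Primrec.snd.comp .fst) .snd
  · exact primrecPred_forall_mem (hU.comp .fst) <|
      primrecPred_codeReach hr (hk.comp h2) (Primrec.snd.comp .fst) .snd
  · refine primrecPred_forall_mem (primrec_range_length (hx.comp .fst)) <|
      primrecPred_near (hN.comp h2) (hk.comp h2)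
        (Primrec.list_length.comp ?_) (Primrec.list_length.comp ?_)
    · exact primrec_codeIter (hx.comp h2) (hk.comp h2) .snd
    · exact primrec_codeIter hr (hk.comp h2) (Primrec.snd.comp .fst)

lemma primrecPred_codeCertED (hx : Primrec x) (hk : Primrec k) (hF : Primrec F)
    (hU : Primrec U) : PrimrecPred fun a => CodeCertED (x a) (k a) (F a) (U a) := by
  have h2 : Primrec fun p : (α × ℕ) × ℕ => p.1.1 := Primrec.fst.comp .fst
  refine (primrecPred_codeDoubling hx hk).and <| (primrecPred_codeClosed hx hF).and <|
    (primrecPred_ne_nil hF).and <| (primrecPred_ne_nil hU).and <|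
    primrecPred_forall_mem hF <| primrecPred_forall_mem (hU.comp .fst) <|
    Primrec.nat_lt.comp (Primrec.list_length.comp ?_) (Primrec.list_length.comp ?_)
  · exact primrec_codeIter (hx.comp h2) (hk.comp h2) (Primrec.snd.comp .fst)
  · exact primrec_codeIter (primrec_codeRestr (hx.comp h2) (hU.comp h2)) (hk.comp h2) .snd

lemma primrecPred_codePeriodic (hx : Primrec x) (hk : Primrec k) :
    PrimrecPred fun a => CodePeriodic (x a) (k a) := by
  have h2 : Primrec fun p : (α × ℕ) × ℕ => p.1.1 := Primrec.fst.comp .fst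
  refine primrecPred_exists_mem (primrec_range_length hx) <|
    primrecPred_exists_mem (Primrec.list_range.comp (hk.comp .fst)) <| Primrec.eq.comp ?_ ?_
  · exact primrec_codeIter (hx.comp h2) .snd (Primrec.snd.comp .fst)
  · exact primrec_codeIter (hx.comp h2) (hk.comp h2) (Primrec.snd.comp .fst)

lemma primrecPred_codeValid {l : α → List ℕ} (hx : Primrec x) (hl : Primrec l) :
    PrimrecPred fun a => CodeValid (x a) (l a) :=
  primrecPred_forall_mem hl <|
    Primrec.nat_lt.comp .snd (Primrec.list_length.comp (hx.comp .fst))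

/-- An unbounded search that always succeeds yields a total computable function. -/
lemma exists_computable_of_search {C : α → β → Option σ} (hC : Primrec₂ C)
    (h : ∀ a, ∃ b, (C a b).isSome) :
    ∃ f : α → σ, Computable f ∧ ∀ a, ∃ b, C a b = some (f a) := by
  let g : α → ℕ → Option σ := fun a n => (Encodable.decode (α := β) n).bind (C a)
  have hg : Primrec₂ g := Primrec.option_bind (Primrec.decode.comp .snd)
    (hC.comp (Primrec.fst.comp .fst) .snd)
  have hdom : ∀ a, (Nat.rfindOpt (g a)).Dom := fun a => by
    obtain ⟨b, hb⟩ := h a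
    obtain ⟨s, hs⟩ := Option.isSome_iff_exists.1 hb
    exact Nat.rfindOpt_dom.2 ⟨Encodable.encode b, s, by simp [g, hs]⟩
  refine ⟨fun a => (Nat.rfindOpt (g a)).get (hdom a), ?_, fun a => ?_⟩
  · exact (Partrec.rfindOpt hg.to_comp).of_eq fun a => (Part.some_get (hdom a)).symm
  · obtain ⟨n, hn⟩ := Nat.rfindOpt_spec (Part.get_mem (hdom a))
    obtain ⟨b, -, hb⟩ := Option.bind_eq_some_iff.1 hn
    exact ⟨b, hb⟩

end Computability

section Encoding

variable {m : ℕ} {φ : Fin m → List (Fin m)}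

lemma length_encodeMorphism : (encodeMorphism φ).length = m := by
  simp [encodeMorphism]

lemma getD_encodeMorphism (b : Fin m) : (encodeMorphism φ).getD b [] = (φ b).map Fin.val := by
  simp [encodeMorphism, List.getD_eq_getElem?_getD]

lemma codeIter_encodeMorphism (k : ℕ) (b : Fin m) :
    codeIter (encodeMorphism φ) k b = ((wordMap φ)^[k] [b]).map Fin.val := by
  induction k with
  | zero => rfl
  | succ k ih =>
    rw [codeIter] at ih ⊢
    rw [Function.iterate_succ_apply', Function.iterate_succ_apply', ih, wordMap,
      List.flatMap_map, List.map_flatMap]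
    simp only [getD_encodeMorphism]

lemma length_codeIter (k : ℕ) (b : Fin m) :
    (codeIter (encodeMorphism φ) k b).length = rowSum (incidence φ) k b := by
  rw [codeIter_encodeMorphism, List.length_map, length_iterate_letter]

lemma forall_mem_codeIter {k : ℕ} {b : Fin m} {p : ℕ → Prop} :
    (∀ c ∈ codeIter (encodeMorphism φ) k b, p c) ↔
      ∀ c : Fin m, 0 < (incidence φ ^ k) b c → p c := by
  simp only [codeIter_encodeMorphism, List.forall_mem_map, mem_iterate_letter]

lemma mem_codeIter {k : ℕ} {b c : Fin m} :
    c.val ∈ codeIter (encodeMorphism φ) k b ↔ 0 < (incidence φ ^ k) b c := by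
  rw [codeIter_encodeMorphism, List.mem_map_of_injective Fin.val_injective, mem_iterate_letter]

lemma forall_mem_range_encodeMorphism {p : ℕ → Prop} :
    (∀ b ∈ List.range (encodeMorphism φ).length, p b) ↔ ∀ b : Fin m, p b := by
  simp only [length_encodeMorphism, List.mem_range, Fin.forall_iff]

/-- The list `l` of natural numbers has the same elements as the finset `s`. -/
def Codes (l : List ℕ) (s : Finset (Fin m)) : Prop :=
  ∀ n, n ∈ l ↔ ∃ i ∈ s, i.val = n

lemma exists_codes (s : Finset (Fin m)) : ∃ l, Codes l s :=
  ⟨s.toList.map Fin.val, fun n => by simp⟩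

lemma exists_codes_of_valid {l : List ℕ} (h : CodeValid (encodeMorphism φ) l) :
    ∃ s : Finset (Fin m), Codes l s := by
  refine ⟨Finset.univ.filter fun i => i.val ∈ l, fun n => ⟨fun hn => ?_, ?_⟩⟩
  · have := h n hn
    rw [length_encodeMorphism] at this
    exact ⟨⟨n, this⟩, by simpa using hn, rfl⟩
  · rintro ⟨i, hi, rfl⟩
    simpa using hi

namespace Codes

variable {l F U : List ℕ} {s F' U' : Finset (Fin m)}

lemma valid (h : Codes l s) : CodeValid (encodeMorphism φ) l := by
  intro n hn
  obtain ⟨i, -, rfl⟩ := (h n).1 hn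
  exact i.isLt.trans_eq length_encodeMorphism.symm

lemma mem_iff (h : Codes l s) {i : Fin m} : i.val ∈ l ↔ i ∈ s := by
  simp [h i.val, Fin.val_inj]

lemma forall_mem (h : Codes l s) {p : ℕ → Prop} : (∀ n ∈ l, p n) ↔ ∀ i ∈ s, p i.val := by
  simp only [h _, forall_exists_index, and_imp]
  exact ⟨fun H i hi => H _ i hi rfl, by rintro H _ i hi rfl; exact H i hi⟩

lemma exists_mem (h : Codes l s) {p : ℕ → Prop} : (∃ n ∈ l, p n) ↔ ∃ i ∈ s, p i.val := by
  simp only [h _]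
  exact ⟨by rintro ⟨_, ⟨i, hi, rfl⟩, H⟩; exact ⟨i, hi, H⟩,
    fun ⟨i, hi, H⟩ => ⟨_, ⟨i, hi, rfl⟩, H⟩⟩

lemma ne_nil_iff (h : Codes l s) : l ≠ [] ↔ s.Nonempty := by
  have := h.exists_mem (p := fun _ => True)
  rw [← List.isEmpty_eq_false_iff, List.isEmpty_eq_false_iff_exists_mem]
  simpa [Finset.Nonempty] using this

lemma codeRestr_eq (h : Codes U U') :
    codeRestr (encodeMorphism φ) U = encodeMorphism fun b => (φ b).filter (· ∈ U') := by
  simp only [codeRestr, encodeMorphism, List.map_map]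
  refine List.map_congr_left fun b _ => ?_
  simp only [Function.comp_apply, List.filter_map]
  congr 2
  funext i
  simp [h.mem_iff]

lemma length_codeIter_codeRestr (h : Codes U U') (k : ℕ) (b : Fin m) :
    (codeIter (codeRestr (encodeMorphism φ) U) k b).length =
      rowSum (restr (incidence φ) U') k b := by
  rw [h.codeRestr_eq, length_codeIter, incidence_filter]

lemma codeClosed_iff (h : Codes F F') :
    CodeClosed (encodeMorphism φ) F ↔ ClosedSet (incidence φ) F' := by
  simp only [CodeClosed, h.forall_mem, forall_mem_codeIter, h.mem_iff, pow_one, ClosedSet]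

end Codes

lemma codeReach_iff {k : ℕ} {b c : Fin m} :
    CodeReach (encodeMorphism φ) k b c ↔ ∃ j < k, 0 < (incidence φ ^ j) b c := by
  simp only [CodeReach, List.mem_range, mem_codeIter]

lemma codeDoubling_iff {k : ℕ} :
    CodeDoubling (encodeMorphism φ) k ↔ Doubling (incidence φ) k := by
  simp only [CodeDoubling, forall_mem_range_encodeMorphism, length_codeIter, Doubling]

lemma codeNear_iff {N k : ℕ} :
    CodeNear (encodeMorphism φ) N k ↔ Near (incidence φ) N k := by
  simp only [CodeNear, forall_mem_range_encodeMorphism, length_codeIter, Near]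

variable {N k : ℕ} {F U : List ℕ} {F' U' : Finset (Fin m)}

lemma codeCertQU_iff (hF : Codes F F') (hU : Codes U U') :
    CodeCertQU (encodeMorphism φ) N k F U ↔ CertQU (incidence φ) N k F' U' := by
  simp only [CodeCertQU, CertQU, codeDoubling_iff, codeNear_iff, hF.codeClosed_iff,
    hF.forall_mem, hU.forall_mem, forall_mem_codeIter, pow_one, codeReach_iff,
    forall_mem_range_encodeMorphism, hF.mem_iff, hU.mem_iff, hU.length_codeIter_codeRestr,
    length_codeIter]

lemma codeCertPD_iff (hF : Codes F F') (hU : Codes U U') :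
    CodeCertPD (encodeMorphism φ) N k F U ↔ CertPD (incidence φ) N k F' U' := by
  simp only [CodeCertPD, CertPD, codeDoubling_iff, codeNear_iff, hF.codeClosed_iff,
    hF.exists_mem, hU.forall_mem, hU.ne_nil_iff,
    hU.codeRestr_eq, codeReach_iff, incidence_filter,
    forall_mem_range_encodeMorphism, hF.mem_iff, length_codeIter]

lemma codeCertED_iff (hF : Codes F F') (hU : Codes U U') :
    CodeCertED (encodeMorphism φ) k F U ↔ CertED (incidence φ) k F' U' := by
  simp only [CodeCertED, CertED, codeDoubling_iff, hF.codeClosed_iff, hF.ne_nil_iff,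
    hU.ne_nil_iff, hF.forall_mem, hU.forall_mem, hU.length_codeIter_codeRestr, length_codeIter]

lemma codePeriodic_iff :
    CodePeriodic (encodeMorphism φ) k ↔
      ∃ b, ∃ i < k, (wordMap φ)^[i] [b] = (wordMap φ)^[k] [b] := by
  simp only [CodePeriodic, List.mem_range, length_encodeMorphism]
  constructor
  · rintro ⟨b, hb, i, hi, h⟩
    rw [codeIter_encodeMorphism (b := ⟨b, hb⟩), codeIter_encodeMorphism (b := ⟨b, hb⟩)] at h
    exact ⟨⟨b, hb⟩, i, hi, List.map_injective_iff.2 Fin.val_injective h⟩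
  · rintro ⟨b, i, hi, h⟩
    exact ⟨b, b.isLt, i, hi, by rw [codeIter_encodeMorphism, codeIter_encodeMorphism, h]⟩

lemma codeValid_flatten_encodeMorphism :
    CodeValid (encodeMorphism φ) (encodeMorphism φ).flatten := by
  intro n hn
  simp only [encodeMorphism, List.mem_flatten, List.mem_map] at hn
  obtain ⟨_, ⟨i, -, rfl⟩, hn⟩ := hn
  obtain ⟨j, -, rfl⟩ := List.mem_map.1 hn
  exact j.isLt.trans_eq length_encodeMorphism.symm

lemma exists_eq_encodeMorphism {x : List (List ℕ)} (h : CodeValid x x.flatten) :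
    ∃ (m : ℕ) (φ : Fin m → List (Fin m)), x = encodeMorphism φ := by
  have hx : ∀ i : Fin x.length, ∀ n ∈ x[i], n < x.length := fun i n hn =>
    h n (List.mem_flatten.2 ⟨_, List.getElem_mem i.isLt, hn⟩)
  refine ⟨x.length, fun i => x[i].pmap Fin.mk (hx i), ?_⟩
  refine List.ext_getElem (by simp [encodeMorphism]) fun i h1 h2 => ?_
  simp [encodeMorphism, List.map_pmap]

lemma card_le_codeSize : Fintype.card (Fin m) ≤ codeSize (encodeMorphism φ) := by
  simp [codeSize, length_encodeMorphism]

lemma rowSum_one_le_codeSize (b : Fin m) :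
    rowSum (incidence φ) 1 b ≤ codeSize (encodeMorphism φ) := by
  have h : (φ b).map Fin.val ∈ encodeMorphism φ :=
    List.mem_map.2 ⟨b, List.mem_finRange b, rfl⟩
  rw [← length_iterate_letter]
  have h1 := (List.sublist_flatten_of_mem h).length_le
  simp only [List.length_map] at h1
  simp only [Function.iterate_one, wordMap, List.flatMap_singleton, codeSize]
  omega

end Encoding

section Decision

/-- The verdict of a candidate certificate `(k, F, U)` on the morphism coded by `x`. -/
noncomputable def verdict (x : List (List ℕ)) (p : ℕ × List ℕ × List ℕ) : Option (Fin 4) :=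
  open Classical in
  if ¬ CodeValid x x.flatten ∨ CodePeriodic x p.1 then some 0
  else if ¬ CodeValid x p.2.1 ∨ ¬ CodeValid x p.2.2 then none
  else if CodeCertQU x (sepBound (codeSize x)) p.1 p.2.1 p.2.2 then some 1
  else if CodeCertPD x (sepBound (codeSize x)) p.1 p.2.1 p.2.2 then some 2
  else if CodeCertED x p.1 p.2.1 p.2.2 then some 3
  else none

lemma primrec_verdict : Primrec₂ verdict := by
  classical
  have hx : Primrec fun q : List (List ℕ) × ℕ × List ℕ × List ℕ => q.1 := .fst
  have hk : Primrec fun q : List (List ℕ) × ℕ × List ℕ × List ℕ => q.2.1 :=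
    Primrec.fst.comp .snd
  have hF : Primrec fun q : List (List ℕ) × ℕ × List ℕ × List ℕ => q.2.2.1 :=
    Primrec.fst.comp (Primrec.snd.comp .snd)
  have hU : Primrec fun q : List (List ℕ) × ℕ × List ℕ × List ℕ => q.2.2.2 :=
    Primrec.snd.comp (Primrec.snd.comp .snd)
  have hN := primrec_sepBound.comp (primrec_codeSize.comp hx)
  refine Primrec.ite ((primrecPred_codeValid hx (Primrec.list_flatten.comp hx)).not.or
      (primrecPred_codePeriodic hx hk)) (.const _) <|
    Primrec.ite ((primrecPred_codeValid hx hF).not.or (primrecPred_codeValid hx hU).not)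
      (.const _) <|
    Primrec.ite (primrecPred_codeCertQU hx hN hk hF hU) (.const _) <|
    Primrec.ite (primrecPred_codeCertPD hx hN hk hF hU) (.const _) <|
    Primrec.ite (primrecPred_codeCertED hx hk hF hU) (.const _) (.const _)

variable {m : ℕ} {φ : Fin m → List (Fin m)}

lemma exists_verdict (x : List (List ℕ)) : ∃ p, (verdict x p).isSome := by
  by_cases hx : CodeValid x x.flatten
  · obtain ⟨m, φ, rfl⟩ := exists_eq_encodeMorphism hx
    by_cases hφ : Growing φ
    · obtain ⟨k, F', U', h⟩ :=
        exists_cert (growing_iff.1 hφ) (sepBound (codeSize (encodeMorphism φ)))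
      obtain ⟨F, hF⟩ := exists_codes F'
      obtain ⟨U, hU⟩ := exists_codes U'
      rw [← codeCertQU_iff hF hU, ← codeCertPD_iff hF hU, ← codeCertED_iff hF hU] at h
      refine ⟨(k, F, U), ?_⟩
      have hF' := hF.valid (φ := φ)
      have hU' := hU.valid (φ := φ)
      simp only [verdict]
      split_ifs <;> simp_all
    · obtain ⟨b, i, k, hik, h⟩ := exists_iterate_eq_of_not_growing hφ
      refine ⟨(k, [], []), ?_⟩
      simp [verdict, codePeriodic_iff.2 ⟨b, i, hik, h⟩]
  · exact ⟨(0, [], []), by simp [verdict, hx]⟩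

lemma verdict_sound {p : ℕ × List ℕ × List ℕ} {r : Fin 4}
    (h : verdict (encodeMorphism φ) p = some r) :
    (r = 0 ∧ ¬ Growing φ) ∨ (r = 1 ∧ QuasiUniform φ) ∨ (r = 2 ∧ PolyDivergent φ) ∨
      (r = 3 ∧ ExpDivergent φ) := by
  obtain ⟨k, F, U⟩ := p
  simp only [verdict] at h
  split_ifs at h with h0 hv h1 h2 h3
  · obtain ⟨b, i, hi, h'⟩ :=
      codePeriodic_iff.1 (h0.resolve_left (not_not.2 codeValid_flatten_encodeMorphism))
    exact .inl ⟨(Option.some.inj h).symm, not_growing_of_iterate_eq hi h'⟩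
  all_goals
    rw [not_or, not_not, not_not] at hv
    obtain ⟨F', hF⟩ := exists_codes_of_valid hv.1
    obtain ⟨U', hU⟩ := exists_codes_of_valid hv.2
  · exact .inr <| .inl ⟨(Option.some.inj h).symm, (CertQU.uniformRates rowSum_one_le_codeSize
      card_le_codeSize ((codeCertQU_iff hF hU).1 h1)).quasiUniform⟩
  · exact .inr <| .inr <| .inl ⟨(Option.some.inj h).symm, (CertPD.polyRates
      rowSum_one_le_codeSize card_le_codeSize ((codeCertPD_iff hF hU).1 h2)).polyDivergent⟩
  · exact .inr <| .inr <| .inr ⟨(Option.some.inj h).symm,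
      (CertED.expRates ((codeCertED_iff hF hU).1 h3)).expDivergent⟩

end Decision

end MorphismGrowth

open MorphismGrowth

/-- There is a computable function deciding whether a morphism is growing, and if so to which of
the three mutually exclusive classes (quasi-uniform, polynomially divergent, exponentially
divergent) it belongs: output 0 = not growing, 1, 2, 3 = the respective classes. -/
theorem growth_class_decidable :
    ∃ f : List (List ℕ) → Fin 4, Computable f ∧
      ∀ (m : ℕ) (φ : Fin m → List (Fin m)),
        (f (encodeMorphism φ) = 0 ↔ ¬ Growing φ) ∧
        (f (encodeMorphism φ) = 1 ↔ QuasiUniform φ) ∧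
        (f (encodeMorphism φ) = 2 ↔ PolyDivergent φ) ∧
        (f (encodeMorphism φ) = 3 ↔ ExpDivergent φ) := by
  obtain ⟨f, hf, hv⟩ := exists_computable_of_search primrec_verdict exists_verdict
  refine ⟨f, hf, fun m φ => ?_⟩
  obtain ⟨p, hp⟩ := hv (encodeMorphism φ)
  have h := verdict_sound hp
  have g1 := growing_of_quasiUniform (φ := φ)
  have g2 := growing_of_polyDivergent (φ := φ)
  have g3 := growing_of_expDivergent (φ := φ)
  have h12 := not_polyDivergent_of_quasiUniform (φ := φ)
  have h13 := not_expDivergent_of_quasiUniform (φ := φ)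
  have h23 := not_expDivergent_of_polyDivergent (φ := φ)
  rcases h with ⟨hr, h⟩ | ⟨hr, h⟩ | ⟨hr, h⟩ | ⟨hr, h⟩ <;> rw [hr] <;> simp <;> tauto
end

section
/- For any morphism φ on a finite alphabet, the three classes quasi-uniform, polynomially divergent, and exponentially divergent are mutually exclusive, and φ belongs to one of them if and only if φ is growing. -/
open Filter Asymptotics

variable {A : Type*}

theorem pow_mul_pow_isLittleO {β β' : ℝ} {e e' : ℕ} (hβ : 0 ≤ β) (hβ' : 0 < β')
    (h : β < β' ∨ β = β' ∧ e < e') :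
    (fun k : ℕ => (k : ℝ) ^ e * β ^ k) =o[atTop] (fun k : ℕ => (k : ℝ) ^ e' * β' ^ k) := by
  rcases h with h | ⟨rfl, h⟩
  · refine (isLittleO_pow_const_mul_const_pow_const_pow_of_norm_lt (R := ℝ) e
      (by rwa [Real.norm_of_nonneg hβ])).trans_isBigO ?_
    refine IsBigO.of_bound' ?_
    filter_upwards [eventually_ge_atTop 1] with k hk
    rw [norm_mul]
    refine le_mul_of_one_le_left (norm_nonneg _) ?_
    rw [norm_pow, Real.norm_natCast]
    exact one_le_pow₀ (by exact_mod_cast hk)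
  · exact ((isLittleO_pow_pow_atTop_of_lt (𝕜 := ℝ) h).comp_tendsto
      tendsto_natCast_atTop_atTop).mul_isBigO (isBigO_refl _ _)

theorem rate_unique {f : ℕ → ℝ} {β β' : ℝ} {e e' : ℕ} (hβ : 0 < β) (hβ' : 0 < β')
    (h : f =Θ[atTop] (fun k : ℕ => (k : ℝ) ^ e * β ^ k))
    (h' : f =Θ[atTop] (fun k : ℕ => (k : ℝ) ^ e' * β' ^ k)) : β = β' ∧ e = e' := by
  have key : ∀ {β β' : ℝ} {e e' : ℕ}, 0 < β → 0 < β' →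
      (fun k : ℕ => (k : ℝ) ^ e' * β' ^ k) =O[atTop] (fun k : ℕ => (k : ℝ) ^ e * β ^ k) →
      ¬ (β < β' ∨ β = β' ∧ e < e') := by
    intro β β' e e' hβ hβ' hO hlt
    refine (pow_mul_pow_isLittleO hβ.le hβ' hlt).not_isBigO
      (Eventually.frequently ?_) hO
    filter_upwards [eventually_ge_atTop 1] with k hk
    have : (0 : ℝ) < k := by exact_mod_cast hk
    positivity
  have h1 := key hβ hβ' (h'.symm.trans h).isBigO
  have h2 := key hβ' hβ (h.symm.trans h').isBigO
  push Not at h1 h2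
  have hb : β = β' := le_antisymm h2.1 h1.1
  exact ⟨hb, le_antisymm (h2.2 hb.symm) (h1.2 hb)⟩

theorem growingLetter_of_isTheta {A : Type*} {φ : A → List A} {b : A} {β : ℝ} {e : ℕ} (hβ : 1 < β)
    (h : (fun k => (((wordMap φ)^[k] [b]).length : ℝ)) =Θ[atTop]
      (fun k => (k : ℝ) ^ e * β ^ k)) : GrowingLetter φ b := by
  have h1 : Tendsto (fun k : ℕ => ‖(k : ℝ) ^ e * β ^ k‖) atTop atTop := by
    refine tendsto_atTop_mono' _ ?_ (tendsto_pow_atTop_atTop_of_one_lt hβ)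
    filter_upwards [eventually_ge_atTop 1] with k hk
    refine le_trans ?_ (le_abs_self _)
    exact le_mul_of_one_le_left (by positivity) (one_le_pow₀ (by exact_mod_cast hk))
  have h2 := h.tendsto_norm_atTop_iff.2 h1
  exact tendsto_natCast_atTop_iff.1 (by simpa [Function.comp_def] using h2)

/-- The length of `φ ^ k`, letter by letter, is the `k`-th iterate of this operator applied
to the constant vector `1`. -/
noncomputable def lengthOperator {A : Type*} (φ : A → List A) : Module.End ℂ (A → ℂ) where
  toFun x b := ((φ b).map x).sum
  map_add' x y := by
    ext b
    exact List.sum_map_add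
  map_smul' r x := by
    ext b
    exact List.sum_map_mul_left (φ b) x r

theorem wordMap_iterate_append {A : Type*} (φ : A → List A) (k : ℕ) (u v : List A) :
    (wordMap φ)^[k] (u ++ v) = (wordMap φ)^[k] u ++ (wordMap φ)^[k] v := by
  induction k generalizing u v with
  | zero => rfl
  | succ k ih =>
    simp only [Function.iterate_succ_apply, wordMap, List.flatMap_append] at ih ⊢
    rw [ih]

theorem length_wordMap_iterate {A : Type*} (φ : A → List A) (k : ℕ) (w : List A) :
    ((wordMap φ)^[k] w).length = (w.map fun c => ((wordMap φ)^[k] [c]).length).sum := by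
  induction w with
  | nil =>
    have : ∀ k, (wordMap φ)^[k] ([] : List A) = [] := fun k => by
      induction k with
      | zero => rfl
      | succ k ih => rw [Function.iterate_succ_apply]; exact ih
    simp [this]
  | cons c w ih =>
    rw [← List.singleton_append, wordMap_iterate_append, List.length_append, ih]
    simp

theorem lengthOperator_pow_apply {A : Type*} (φ : A → List A) (k : ℕ) (b : A) :
    ((lengthOperator φ ^ k) 1) b = (((wordMap φ)^[k] [b]).length : ℂ) := by
  induction k generalizing b with
  | zero => simp
  | succ k ih =>
    rw [pow_succ', Module.End.mul_apply, Function.iterate_succ_apply,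
      show wordMap φ [b] = φ b by simp [wordMap], length_wordMap_iterate]
    have : (lengthOperator φ ^ k) 1 = fun c => (((wordMap φ)^[k] [c]).length : ℂ) := funext ih
    rw [this]
    simp [lengthOperator, Nat.cast_list_sum, Function.comp_def]

/-- The sequence `k ↦ (k choose j) * μ ^ k`. -/
noncomputable def expPoly (p : ℂˣ × ℕ) (k : ℕ) : ℂ := (k.choose p.2 : ℂ) * (p.1 : ℂ) ^ k

/-- Orbits of an endomorphism of a finite-dimensional space are eventually exponential polynomials. -/
theorem eventually_pow_apply_eq_linearCombination {V : Type*} [AddCommGroup V] [Module ℂ V]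
    [FiniteDimensional ℂ V] (T : Module.End ℂ V) (ℓ : V →ₗ[ℂ] ℂ) (v : V) :
    ∃ c : ℂˣ × ℕ →₀ ℂ,
      ∀ᶠ k in atTop, ℓ ((T ^ k) v) = Finsupp.linearCombination ℂ expPoly c k := by
  have hv : v ∈ ⨆ μ : ℂ, T.maxGenEigenspace μ := by
    rw [Module.End.iSup_maxGenEigenspace_eq_top]; trivial
  induction hv using Submodule.iSup_induction' with
  | zero => exact ⟨0, by simp⟩
  | add x y _ _ hx hy =>
    obtain ⟨c, hc⟩ := hx
    obtain ⟨d, hd⟩ := hy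
    refine ⟨c + d, ?_⟩
    filter_upwards [hc, hd] with k h1 h2
    simp [h1, h2]
  | mem μ x hx =>
    obtain ⟨m, hm⟩ := (Module.End.mem_maxGenEigenspace _ _ _).1 hx
    set N := T - μ • (1 : Module.End ℂ V) with hN
    have hNj : ∀ j, m ≤ j → (N ^ j) x = 0 := fun j hj => by
      rw [← Nat.sub_add_cancel hj, pow_add, Module.End.mul_apply, hm, map_zero]
    by_cases hμ : μ = 0
    · refine ⟨0, ?_⟩
      filter_upwards [eventually_ge_atTop m] with k hk
      have := hNj k hk
      rw [hN, hμ, zero_smul, sub_zero] at this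
      simp [this]
    · refine ⟨∑ j ∈ Finset.range m,
        Finsupp.single (Units.mk0 μ hμ, j) ((μ ^ j)⁻¹ * ℓ ((N ^ j) x)), ?_⟩
      filter_upwards [eventually_ge_atTop m] with k hk
      have hT : T = N + μ • (1 : Module.End ℂ V) := by rw [hN]; abel
      have hcomm : Commute N (μ • (1 : Module.End ℂ V)) :=
        (Commute.one_right N).smul_right μ
      rw [hT, hcomm.add_pow]
      simp only [map_sum, LinearMap.sum_apply, Finsupp.linearCombination_single, Finset.sum_apply,
        Pi.smul_apply, smul_eq_mul, expPoly, Units.val_mk0]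
      have hterm : ∀ j, ℓ ((N ^ j * (μ • (1 : Module.End ℂ V)) ^ (k - j) *
          (k.choose j : Module.End ℂ V)) x) = (k.choose j : ℂ) * μ ^ (k - j) * ℓ ((N ^ j) x) := by
        intro j
        have : (k.choose j : Module.End ℂ V) = (k.choose j : ℂ) • (1 : Module.End ℂ V) := by
          rw [Nat.cast_smul_eq_nsmul, nsmul_one]
        rw [this, smul_pow, one_pow, mul_smul_comm, mul_smul_comm, mul_one, mul_one, smul_smul,
          LinearMap.smul_apply, map_smul, smul_eq_mul]
      simp only [hterm]
      rw [← Finset.sum_subset (Finset.range_mono (show m ≤ k + 1 by omega))]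
      · refine Finset.sum_congr rfl fun j hj => ?_
        have hjk : j ≤ k := by have := Finset.mem_range.1 hj; omega
        rw [pow_sub₀ _ hμ hjk]
        ring
      · intro j _ hj
        rw [hNj j (by simpa using hj), map_zero, mul_zero]

theorem norm_expPoly_le (p : ℂˣ × ℕ) (k : ℕ) :
    ‖expPoly p k‖ ≤ (k : ℝ) ^ p.2 * ‖(p.1 : ℂ)‖ ^ k := by
  rw [expPoly, norm_mul, norm_pow, Complex.norm_natCast]
  gcongr
  exact_mod_cast Nat.choose_le_pow k p.2

theorem expPoly_isLittleO (p : ℂˣ × ℕ) {β : ℝ} {e : ℕ} (hβ : 0 < β)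
    (h : ‖(p.1 : ℂ)‖ < β ∨ ‖(p.1 : ℂ)‖ = β ∧ p.2 < e) :
    expPoly p =o[atTop] (fun k : ℕ => (k : ℝ) ^ e * β ^ k) := by
  refine IsBigO.trans_isLittleO (IsBigO.of_bound' (Eventually.of_forall fun k => ?_))
    (pow_mul_pow_isLittleO (norm_nonneg (p.1 : ℂ)) hβ h)
  exact (norm_expPoly_le p k).trans (le_abs_self _)

theorem expPoly_sub_isLittleO (p : ℂˣ × ℕ) :
    (fun k : ℕ => expPoly p k -
      ((k : ℝ) ^ p.2 * ‖(p.1 : ℂ)‖ ^ k : ℝ) *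
        ((p.2.factorial : ℂ)⁻¹ * ((p.1 : ℂ) / ‖(p.1 : ℂ)‖) ^ k)) =o[atTop]
      (fun k : ℕ => (k : ℝ) ^ p.2 * ‖(p.1 : ℂ)‖ ^ k) := by
  have hchoose : (fun k : ℕ => (k.choose p.2 : ℝ) - (k : ℝ) ^ p.2 / p.2.factorial) =o[atTop]
      (fun k : ℕ => (k : ℝ) ^ p.2) := by
    refine (isEquivalent_choose p.2).isLittleO.trans_isBigO ?_
    simp only [div_eq_mul_inv]
    simpa only [mul_comm] using isBigO_const_mul_self ((p.2.factorial : ℝ)⁻¹)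
      (fun k : ℕ => (k : ℝ) ^ p.2) atTop
  have hpow : (fun k : ℕ => (p.1 : ℂ) ^ k) =O[atTop] (fun k : ℕ => ‖(p.1 : ℂ)‖ ^ k) :=
    IsBigO.of_bound' (Eventually.of_forall fun k => by simp)
  have hchoose' : (fun k : ℕ => (((k.choose p.2 : ℝ) - (k : ℝ) ^ p.2 / p.2.factorial : ℝ) : ℂ))
      =o[atTop] (fun k : ℕ => (k : ℝ) ^ p.2) :=
    IsLittleO.of_norm_left (by simpa only [Complex.norm_real] using hchoose.norm_left)
  refine (hchoose'.mul_isBigO hpow).congr_left fun k => ?_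
  have : (‖(p.1 : ℂ)‖ : ℂ) ≠ 0 := by simp
  rw [expPoly, div_pow]
  push_cast
  field_simp

/-- A nontrivial combination of powers of distinct unimodular numbers is bounded away from zero
at least once in every window of some fixed length. -/
theorem exists_le_norm_sum_pow {ι : Type*} (S : Finset ι) (z a : ι → ℂ)
    (hz : Set.InjOn z S) (hz1 : ∀ i ∈ S, ‖z i‖ = 1) {i₀ : ι} (hi₀ : i₀ ∈ S) (ha : a i₀ ≠ 0) :
    ∃ ε > 0, ∃ d : ℕ, ∀ k : ℕ, ∃ j ≤ d, ε ≤ ‖∑ i ∈ S, a i * z i ^ (k + j)‖ := by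
  classical
  set P : Polynomial ℂ := ∏ i ∈ S.erase i₀, (Polynomial.X - Polynomial.C (z i)) with hP
  have hP0 : P.eval (z i₀) ≠ 0 := by
    rw [hP, Polynomial.eval_prod, Finset.prod_ne_zero_iff]
    intro i hi
    rw [Polynomial.eval_sub, Polynomial.eval_X, Polynomial.eval_C, sub_ne_zero]
    exact fun h => Finset.ne_of_mem_erase hi (hz hi₀ (Finset.mem_of_mem_erase hi) h).symm
  have hPi : ∀ i ∈ S, i ≠ i₀ → P.eval (z i) = 0 := by
    intro i hi hne
    rw [hP, Polynomial.eval_prod]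
    exact Finset.prod_eq_zero (Finset.mem_erase.2 ⟨hne, hi⟩) (by simp)
  have hsum : ∀ k : ℕ, ∑ j ∈ Finset.range (P.natDegree + 1),
      P.coeff j * ∑ i ∈ S, a i * z i ^ (k + j) = a i₀ * z i₀ ^ k * P.eval (z i₀) := by
    intro k
    simp only [Finset.mul_sum]
    rw [Finset.sum_comm, Finset.sum_eq_single_of_mem i₀ hi₀]
    · rw [Polynomial.eval_eq_sum_range, Finset.mul_sum]
      exact Finset.sum_congr rfl fun j _ => by ring
    · intro i hi hne
      have h0 := hPi i hi hne
      rw [Polynomial.eval_eq_sum_range] at h0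
      calc _ = a i * z i ^ k * ∑ j ∈ Finset.range (P.natDegree + 1), P.coeff j * z i ^ j := by
            rw [Finset.mul_sum]
            exact Finset.sum_congr rfl fun j _ => by ring
        _ = 0 := by rw [h0, mul_zero]
  set B : ℝ := ∑ j ∈ Finset.range (P.natDegree + 1), ‖P.coeff j‖ with hB
  have hB0 : 0 ≤ B := Finset.sum_nonneg fun _ _ => norm_nonneg _
  have hδ : 0 < ‖a i₀‖ * ‖P.eval (z i₀)‖ := by positivity
  refine ⟨‖a i₀‖ * ‖P.eval (z i₀)‖ / (B + 1), by positivity, P.natDegree, fun k => ?_⟩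
  by_contra! hlt
  set ε := ‖a i₀‖ * ‖P.eval (z i₀)‖ / (B + 1) with hε
  have hle : ‖a i₀‖ * ‖P.eval (z i₀)‖ ≤ B * ε := by
    calc _ = ‖a i₀ * z i₀ ^ k * P.eval (z i₀)‖ := by simp [hz1 i₀ hi₀]
      _ ≤ ∑ j ∈ Finset.range (P.natDegree + 1), ‖P.coeff j‖ * ε := by
          rw [← hsum k]
          refine norm_sum_le_of_le _ fun j hj => ?_
          rw [norm_mul]
          exact mul_le_mul_of_nonneg_left
            (hlt j (Nat.lt_succ_iff.1 (Finset.mem_range.1 hj))).le (norm_nonneg _)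
      _ = B * ε := by rw [hB, Finset.sum_mul]
  have hε' : (B + 1) * ε = ‖a i₀‖ * ‖P.eval (z i₀)‖ := by
    rw [hε]; field_simp
  have : 0 < ε := by positivity
  linarith

theorem pow_mul_pow_add_le {β : ℝ} (hβ : 0 < β) (e d j k : ℕ) (hj : j ≤ d) (hk : 1 ≤ k) :
    ((k + d : ℕ) : ℝ) ^ e * β ^ (k + d) ≤
      ((1 + d : ℝ) ^ e * max 1 β ^ d) * (((k + j : ℕ) : ℝ) ^ e * β ^ (k + j)) := by
  have h1 : ((k + d : ℕ) : ℝ) ≤ (1 + d) * ((k + j : ℕ) : ℝ) := by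
    have : k + d ≤ (1 + d) * (k + j) := by nlinarith
    exact_mod_cast this
  have h2 : β ^ (k + d) ≤ max 1 β ^ d * β ^ (k + j) := by
    obtain ⟨i, rfl⟩ := Nat.exists_eq_add_of_le hj
    calc β ^ (k + (j + i)) = β ^ i * β ^ (k + j) := by ring
      _ ≤ max 1 β ^ (j + i) * β ^ (k + j) := by
        gcongr
        calc β ^ i ≤ max 1 β ^ i := by gcongr; exact le_max_right _ _
          _ ≤ max 1 β ^ (j + i) := pow_le_pow_right₀ (le_max_left _ _) (by omega)
  calc _ ≤ ((1 + d) * ((k + j : ℕ) : ℝ)) ^ e * (max 1 β ^ d * β ^ (k + j)) := by gcongr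
    _ = _ := by rw [mul_pow]; ring

/-- A positive monotone sequence that is eventually an exponential polynomial has a growth rate
of the form `k ^ e * β ^ k`. -/
theorem exists_isTheta_of_monotone {f : ℕ → ℝ} (hmono : Monotone f) (hpos : ∀ k, 0 < f k)
    {c : ℂˣ × ℕ →₀ ℂ}
    (hc : ∀ᶠ k in atTop, (f k : ℂ) = Finsupp.linearCombination ℂ expPoly c k) :
    ∃ (β : ℝ) (e : ℕ), 0 < β ∧ f =Θ[atTop] (fun k : ℕ => (k : ℝ) ^ e * β ^ k) := by
  classical
  have hne : c.support.Nonempty := by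
    rw [Finsupp.support_nonempty_iff]
    rintro rfl
    obtain ⟨k, hk⟩ := hc.exists
    exact (hpos k).ne' (by simpa using hk)
  obtain ⟨p₀, hp₀, hmax⟩ := Finset.exists_max_image c.support
    (fun p => toLex (‖(p.1 : ℂ)‖, p.2)) hne
  obtain ⟨β, hβdef⟩ : ∃ β, β = ‖(p₀.1 : ℂ)‖ := ⟨_, rfl⟩
  obtain ⟨e, hedef⟩ : ∃ e, e = p₀.2 := ⟨_, rfl⟩
  have hβ : 0 < β := by rw [hβdef]; simp
  set h : ℕ → ℝ := fun k => (k : ℝ) ^ e * β ^ k with hh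
  have hh0 : ∀ k, 0 ≤ h k := fun k => by positivity
  set S := c.support.filter (fun p => ‖(p.1 : ℂ)‖ = β ∧ p.2 = e) with hS
  set z : ℂˣ × ℕ → ℂ := fun p => (p.1 : ℂ) / ‖(p.1 : ℂ)‖ with hz
  set a : ℂˣ × ℕ → ℂ := fun p => c p * (e.factorial : ℂ)⁻¹ with ha
  set u : ℕ → ℂ := fun k => ∑ p ∈ S, a p * z p ^ k with hu
  have hz1 : ∀ p ∈ S, ‖z p‖ = 1 := fun p _ => by simp [hz]
  have happrox : (fun k => (f k : ℂ) - (h k : ℂ) * u k) =o[atTop] h := by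
    have hsum : (fun k => ∑ p ∈ c.support, (c p * expPoly p k -
        if p ∈ S then (h k : ℂ) * (a p * z p ^ k) else 0)) =o[atTop] h := by
      refine IsLittleO.fun_sum fun p hp => ?_
      by_cases hpS : p ∈ S
      · obtain ⟨h1, h2⟩ := (Finset.mem_filter.1 hpS).2
        have := (expPoly_sub_isLittleO p).const_mul_left (c p)
        rw [h1, h2] at this
        refine this.congr_left fun k => ?_
        simp only [if_pos hpS, hh, ha, hz, h1]
        ring
      · simp only [if_neg hpS, sub_zero]
        refine (expPoly_isLittleO p hβ ?_).const_mul_left (c p)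
        have hle := Prod.Lex.toLex_le_toLex.1 (hmax p hp)
        simp only [← hβdef, ← hedef] at hle
        refine hle.imp id fun hle => ⟨hle.1, lt_of_le_of_ne hle.2 fun he => hpS ?_⟩
        exact Finset.mem_filter.2 ⟨hp, hle.1, he⟩
    refine hsum.congr' ?_ EventuallyEq.rfl
    filter_upwards [hc] with k hk
    rw [hk, Finset.sum_sub_distrib, Finset.sum_ite_mem,
      Finset.inter_eq_right.2 (Finset.filter_subset _ _), hu, Finset.mul_sum,
      Finsupp.linearCombination_apply, Finsupp.sum, Finset.sum_apply]
    rfl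
  refine ⟨β, e, hβ, ?_, ?_⟩
  · have hu_le : (fun k => (h k : ℂ) * u k) =O[atTop] h := by
      refine IsBigO.of_bound (∑ p ∈ S, ‖a p‖) (Eventually.of_forall fun k => ?_)
      rw [norm_mul, Complex.norm_real, mul_comm]
      gcongr
      refine norm_sum_le_of_le _ fun p hp => ?_
      rw [norm_mul, norm_pow, hz1 p hp, one_pow, mul_one]
    have := (happrox.isBigO.add hu_le).norm_left
    simp only [sub_add_cancel, Complex.norm_real] at this
    exact this.of_norm_left
  · have hinj : Set.InjOn z S := by
      intro p hp q hq hpq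
      obtain ⟨h1, h2⟩ := (Finset.mem_filter.1 hp).2
      obtain ⟨h3, h4⟩ := (Finset.mem_filter.1 hq).2
      simp only [hz, h1, h3] at hpq
      refine Prod.ext (Units.ext ?_) (h2.trans h4.symm)
      exact (div_left_inj' (by exact_mod_cast hβ.ne')).1 hpq
    have ha0 : a p₀ ≠ 0 :=
      mul_ne_zero (Finsupp.mem_support_iff.1 hp₀)
        (inv_ne_zero (by exact_mod_cast e.factorial_ne_zero))
    obtain ⟨ε, hε, d, hd⟩ := exists_le_norm_sum_pow S z a hinj hz1
      (Finset.mem_filter.2 ⟨hp₀, hβdef.symm, hedef.symm⟩) ha0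
    obtain ⟨K, hK⟩ := eventually_atTop.1 (happrox.bound (half_pos hε))
    set C : ℝ := (1 + d : ℝ) ^ e * max 1 β ^ d with hC
    have hC0 : 0 ≤ C := by positivity
    refine IsBigO.of_bound (C * (2 / ε)) ?_
    filter_upwards [eventually_ge_atTop (K + 1 + d)] with n hn
    obtain ⟨k, rfl⟩ : ∃ k, n = k + d := ⟨n - d, by omega⟩
    obtain ⟨j, hj, hjε⟩ := hd k
    have hclose := hK (k + j) (by omega)
    have hlow : ε / 2 * h (k + j) ≤ f (k + d) := by
      have hfle : f (k + j) ≤ f (k + d) := hmono (by omega)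
      have htri := norm_sub_norm_le ((h (k + j) : ℂ) * u (k + j)) (f (k + j) : ℂ)
      rw [norm_sub_rev, norm_mul, Complex.norm_real, Complex.norm_real,
        Real.norm_of_nonneg (hh0 _), Real.norm_of_nonneg (hpos _).le] at htri
      rw [Real.norm_of_nonneg (hh0 _)] at hclose
      have := mul_le_mul_of_nonneg_left hjε (hh0 (k + j))
      simp only [hu] at htri hclose
      linarith
    rw [Real.norm_of_nonneg (hh0 _), Real.norm_of_nonneg (hpos _).le]
    calc h (k + d) ≤ C * h (k + j) := pow_mul_pow_add_le hβ e d j k hj (by omega)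
      _ = C * (2 / ε) * (ε / 2 * h (k + j)) := by field_simp
      _ ≤ C * (2 / ε) * f (k + d) := by gcongr

theorem length_le_length_wordMap {A : Type*} {φ : A → List A} (hφ : ∀ b, φ b ≠ [])
    (w : List A) : w.length ≤ (wordMap φ w).length := by
  rw [wordMap, List.length_flatMap]
  simpa using List.card_nsmul_le_sum (w.map fun b => (φ b).length) 1 (by
    intro n hn
    obtain ⟨b, _, rfl⟩ := List.mem_map.1 hn
    exact List.length_pos_iff.2 (hφ b))

theorem Growing.ne_nil {A : Type*} {φ : A → List A} (h : Growing φ) (b : A) : φ b ≠ [] := by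
  intro hb
  obtain ⟨k, hk, hk1⟩ := (((h b).eventually_ge_atTop 1).and (eventually_ge_atTop 1)).exists
  obtain ⟨k, rfl⟩ := Nat.exists_eq_add_of_le' hk1
  rw [Function.iterate_succ_apply, show wordMap φ [b] = [] by simp [wordMap, hb],
    length_wordMap_iterate] at hk
  simp at hk

theorem Growing.monotone_length {A : Type*} {φ : A → List A} (h : Growing φ) (b : A) :
    Monotone fun k => ((wordMap φ)^[k] [b]).length :=
  monotone_nat_of_le_succ fun k => by
    rw [Function.iterate_succ_apply']
    exact length_le_length_wordMap h.ne_nil _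

theorem Growing.exists_two_pow_le {A : Type*} [Finite A] {φ : A → List A} (h : Growing φ) :
    ∃ n, ∀ b k, 2 ^ k ≤ ((wordMap φ)^[n * k] [b]).length := by
  obtain ⟨n, hn⟩ := (eventually_all.2 fun b => (h b).eventually_ge_atTop 2).exists
  refine ⟨n, fun b k => ?_⟩
  induction k with
  | zero => simp
  | succ k ih =>
    rw [Nat.mul_succ, Nat.add_comm (n * k), Function.iterate_add_apply, length_wordMap_iterate]
    have := List.card_nsmul_le_sum
      (((wordMap φ)^[n * k] [b]).map fun c => ((wordMap φ)^[n] [c]).length) 2 (by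
      intro m hm
      obtain ⟨c, _, rfl⟩ := List.mem_map.1 hm
      exact hn c)
    simp only [List.length_map, smul_eq_mul] at this
    rw [pow_succ]
    omega

/-- Every letter of a growing morphism has a growth rate `k ^ e * β ^ k` with `1 < β`. -/
theorem Growing.exists_rate {A : Type*} [Finite A] {φ : A → List A} (h : Growing φ) (b : A) :
    ∃ (β : ℝ) (e : ℕ), 1 < β ∧ (fun k => (((wordMap φ)^[k] [b]).length : ℝ)) =Θ[atTop]
      (fun k => (k : ℝ) ^ e * β ^ k) := by
  obtain ⟨c, hc⟩ := eventually_pow_apply_eq_linearCombination (lengthOperator φ)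
    (LinearMap.proj b) 1
  obtain ⟨β, e, hβ, hΘ⟩ := exists_isTheta_of_monotone
    (f := fun k => (((wordMap φ)^[k] [b]).length : ℝ))
    (Nat.mono_cast.comp (h.monotone_length b))
    (fun k => by
      have := h.monotone_length b (Nat.zero_le k)
      have h1 : 1 ≤ ((wordMap φ)^[k] [b]).length := by simpa using this
      exact_mod_cast h1)
    (c := c) (by
      filter_upwards [hc] with k hk
      rw [← hk, LinearMap.proj_apply, lengthOperator_pow_apply]
      simp)
  refine ⟨β, e, ?_, hΘ⟩
  by_contra! hβ1
  obtain ⟨n, hn⟩ := h.exists_two_pow_le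
  have hn0 : n ≠ 0 := by
    rintro rfl
    have := hn b 1
    simp at this
  have hpoly : (fun k : ℕ => (((wordMap φ)^[k] [b]).length : ℝ)) =O[atTop]
      (fun k : ℕ => (k : ℝ) ^ e) := by
    refine hΘ.isBigO.trans (IsBigO.of_bound' (Eventually.of_forall fun k => ?_))
    rw [norm_mul]
    refine mul_le_of_le_one_right (norm_nonneg _) ?_
    rw [Real.norm_of_nonneg (by positivity)]
    exact pow_le_one₀ hβ.le hβ1
  have hsub := hpoly.comp_tendsto (tendsto_id.const_mul_atTop' (Nat.pos_of_ne_zero hn0))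
  have htwo : (fun k : ℕ => (2 : ℝ) ^ k) =O[atTop] (fun k : ℕ => (k : ℝ) ^ e) := by
    refine (IsBigO.of_bound' (Eventually.of_forall fun k => ?_)).trans (hsub.trans ?_)
    · rw [Real.norm_of_nonneg (by positivity), Function.comp_apply, Real.norm_natCast]
      exact_mod_cast hn b k
    · refine (isBigO_const_mul_self ((n : ℝ) ^ e) (fun k : ℕ => (k : ℝ) ^ e) atTop).congr_left
        fun k => ?_
      simp [mul_pow]
  refine (isLittleO_pow_const_const_pow_of_one_lt (R := ℝ) e one_lt_two).not_isBigO
    (Eventually.frequently ?_) htwo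
  filter_upwards [eventually_ge_atTop 1] with k hk
  have : (0 : ℝ) < k := by exact_mod_cast hk
  positivity

/-- The classes quasi-uniform, polynomially divergent and exponentially divergent are mutually
exclusive, and a morphism belongs to one of them iff it is growing. -/
theorem growth_trichotomy {A : Type*} [Fintype A] (φ : A → List A) :
    ¬ (QuasiUniform φ ∧ PolyDivergent φ) ∧
    ¬ (QuasiUniform φ ∧ ExpDivergent φ) ∧
    ¬ (PolyDivergent φ ∧ ExpDivergent φ) ∧
    ((QuasiUniform φ ∨ PolyDivergent φ ∨ ExpDivergent φ) ↔ Growing φ) := by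
  have hquasi : QuasiUniform φ → ∃ β : ℝ, 1 < β ∧ ∀ b,
      (fun k => (((wordMap φ)^[k] [b]).length : ℝ)) =Θ[atTop] (fun k => (k : ℝ) ^ 0 * β ^ k) := by
    rintro ⟨β, hβ, h⟩
    exact ⟨β, hβ, fun b => by simpa using h b⟩
  refine ⟨?_, ?_, ?_, ?_, ?_⟩
  · rintro ⟨hq, β', hβ', e, h', b, hb⟩
    obtain ⟨β, hβ, h⟩ := hquasi hq
    have := (rate_unique (by linarith) (by linarith) (h b) (h' b)).2
    omega
  · rintro ⟨hq, β', e, h', b, c, hbc⟩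
    obtain ⟨β, hβ, h⟩ := hquasi hq
    have key : ∀ a, β = β' a := fun a =>
      (rate_unique (by linarith) (by linarith [(h' a).1]) (h a) (h' a).2).1
    exact hbc ((key b).symm.trans (key c))
  · rintro ⟨⟨β, hβ, e, h, -⟩, β', e', h', b, c, hbc⟩
    have key : ∀ a, β = β' a := fun a =>
      (rate_unique (by linarith) (by linarith [(h' a).1]) (h a) (h' a).2).1
    exact hbc ((key b).symm.trans (key c))
  · rintro (hq | ⟨β, hβ, e, h, -⟩ | ⟨β, e, h, -⟩) b
    · obtain ⟨β, hβ, h⟩ := hquasi hq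
      exact growingLetter_of_isTheta hβ (h b)
    · exact growingLetter_of_isTheta hβ (h b)
    · exact growingLetter_of_isTheta (h b).1 (h b).2
  · intro hg
    choose β e hβ h using hg.exists_rate
    by_cases hne : ∃ b c, β b ≠ β c
    · exact Or.inr (Or.inr ⟨β, e, fun b => ⟨hβ b, h b⟩, hne⟩)
    push Not at hne
    rcases isEmpty_or_nonempty A with hA | ⟨⟨a⟩⟩
    · exact Or.inl ⟨2, one_lt_two, fun b => isEmptyElim b⟩
    have h' : ∀ b, (fun k => (((wordMap φ)^[k] [b]).length : ℝ)) =Θ[atTop]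
        (fun k => (k : ℝ) ^ e b * β a ^ k) := fun b => hne b a ▸ h b
    by_cases he : ∃ b, 1 ≤ e b
    · exact Or.inr (Or.inl ⟨β a, hβ a, e, h', he⟩)
    · push Not at he
      refine Or.inl ⟨β a, hβ a, fun b => ?_⟩
      simpa [Nat.lt_one_iff.1 (he b)] using h' b
end

section
/- If φ is a growing, quasi-uniform morphism prolongable on a and the pure morphic sequence α = φ^∞(a) is not ultimately periodic, then P_α(n) = Θ(n). -/
open Filter Asymptotics

variable {A : Type*}

lemma length_factorAt (α : ℕ → A) (i n : ℕ) : (factorAt α i n).length = n := by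
  simp [factorAt]

lemma factorAt_succ (α : ℕ → A) (i n : ℕ) :
    factorAt α i (n + 1) = factorAt α i n ++ [α (i + n)] := by
  simp [factorAt, List.range_succ]

lemma factorAt_succ' (α : ℕ → A) (i n : ℕ) :
    factorAt α i (n + 1) = α i :: factorAt α (i + 1) n := by
  simp [factorAt, List.range_succ_eq_map, Function.comp_def, Nat.add_right_comm, ← Nat.add_assoc]

lemma factorAt_add (α : ℕ → A) (i m n : ℕ) :
    factorAt α i (m + n) = factorAt α i m ++ factorAt α (i + m) n := by
  simp [factorAt, List.range_add, Function.comp_def, Nat.add_assoc]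

lemma setOf_isFactor_eq_range (α : ℕ → A) (n : ℕ) :
    {w : List A | w.length = n ∧ IsFactor α w} = Set.range (fun i => factorAt α i n) := by
  ext w
  constructor
  · rintro ⟨rfl, i, hi⟩
    exact ⟨i, hi.symm⟩
  · rintro ⟨i, rfl⟩
    exact ⟨length_factorAt α i n, i, by simp [length_factorAt]⟩

lemma finite_range_factorAt [Finite A] (α : ℕ → A) (n : ℕ) :
    (Set.range (fun i => factorAt α i n)).Finite :=
  (List.finite_length_eq A n).subset (by rintro _ ⟨i, rfl⟩; exact length_factorAt α i n)

/-- If every factor of length `n` has a unique right extension, then `α` is ultimately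
periodic. -/
lemma ultimatelyPeriodic_of_unique_extension [Finite A] (α : ℕ → A) (n : ℕ)
    (h : ∀ i j, factorAt α i n = factorAt α j n → α (i + n) = α (j + n)) :
    UltimatelyPeriodic α := by
  obtain ⟨i, j, hij, he⟩ : ∃ i j, i < j ∧ factorAt α i n = factorAt α j n := by
    have : ¬ Function.Injective (fun i => factorAt α i n) := fun hinj =>
      Set.infinite_range_of_injective hinj (finite_range_factorAt α n)
    simp only [Function.Injective, not_forall] at this
    obtain ⟨i, j, he, hne⟩ := this
    rcases Nat.lt_or_gt_of_ne hne with hlt | hlt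
    · exact ⟨i, j, hlt, he⟩
    · exact ⟨j, i, hlt, he.symm⟩
  have hshift : ∀ t, factorAt α (i + t) n = factorAt α (j + t) n := by
    intro t
    induction t with
    | zero => exact he
    | succ t ih =>
      have h1 : factorAt α (i + t) (n + 1) = factorAt α (j + t) (n + 1) := by
        rw [factorAt_succ, factorAt_succ, ih, h _ _ ih]
      rw [factorAt_succ', factorAt_succ'] at h1
      exact (List.cons.inj h1).2
  refine ⟨i + n, j - i, by omega, fun m hm => ?_⟩
  have := h _ _ (hshift (m - i - n))
  rw [show i + (m - i - n) + n = m by omega,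
    show j + (m - i - n) + n = m + (j - i) by omega] at this
  exact this.symm

lemma complexity_lt_succ [Finite A] (α : ℕ → A) (hnp : ¬ UltimatelyPeriodic α) (n : ℕ) :
    complexity α n < complexity α (n + 1) := by
  by_contra! hle
  apply hnp
  apply ultimatelyPeriodic_of_unique_extension α n
  unfold complexity at hle
  rw [setOf_isFactor_eq_range, setOf_isFactor_eq_range] at hle
  have himg : List.take n '' Set.range (fun i => factorAt α i (n + 1)) =
      Set.range (fun i => factorAt α i n) := by
    rw [← Set.range_comp]
    congr 1
    funext i
    simp [factorAt_succ, List.take_left', length_factorAt]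
  rw [← himg] at hle
  have hinj := Set.injOn_of_ncard_image_eq
    (le_antisymm (Set.ncard_image_le (finite_range_factorAt α (n + 1))) hle)
    (finite_range_factorAt α (n + 1))
  intro i j hij
  have h1 := hinj ⟨i, rfl⟩ ⟨j, rfl⟩
    (by simp [factorAt_succ, List.take_left', length_factorAt, hij])
  simpa [factorAt_succ, hij] using h1

/-- Morse–Hedlund: the complexity of a word that is not ultimately periodic is at least `n`. -/
lemma le_complexity [Finite A] (α : ℕ → A) (hnp : ¬ UltimatelyPeriodic α) (n : ℕ) :
    n ≤ complexity α n := by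
  induction n with
  | zero => exact Nat.zero_le _
  | succ n ih => exact Nat.succ_le_of_lt (ih.trans_lt (complexity_lt_succ α hnp n))

lemma wordMap_iterate_eq_flatMap (φ : A → List A) (k : ℕ) (u : List A) :
    (wordMap φ)^[k] u = u.flatMap (fun b => (wordMap φ)^[k] [b]) := by
  induction k generalizing u with
  | zero => simp
  | succ k ih =>
    rw [Function.iterate_succ_apply, ih]
    simp only [Function.iterate_succ_apply]
    simp only [wordMap, List.flatMap_assoc, List.flatMap_singleton]
    congr 1
    funext b
    exact (ih _).symm

/-- A word no longer than any block of a concatenation meets at most two consecutive blocks. -/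
lemma exists_infix_append_of_infix_flatMap (ψ : A → List A) (a : A) (w u : List A)
    (hlen : ∀ b, w.length ≤ (ψ b).length) (hw : w <:+: u.flatMap ψ) :
    ∃ b c, w <:+: ψ b ++ ψ c := by
  induction u with
  | nil =>
    obtain rfl : w = [] := by simpa using hw
    exact ⟨a, a, List.nil_infix⟩
  | cons b u ih =>
    rw [List.flatMap_cons, List.infix_append_iff] at hw
    rcases hw with hw | hw | ⟨s, t, rfl, hs, ht⟩
    · exact ⟨b, b, hw.trans (List.infix_append' [] _ _)⟩
    · exact ih hw
    · have key : ∃ c, t <+: ψ c := by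
        cases u with
        | nil => exact ⟨a, by simp_all⟩
        | cons c u =>
          refine ⟨c, List.prefix_of_prefix_length_le ht (by simp) ?_⟩
          have := hlen c
          simp at this
          omega
      obtain ⟨c, r, hr⟩ := key
      obtain ⟨l, hl⟩ := hs
      exact ⟨b, c, l, r, by simp [← hl, ← hr]⟩

/-- A factor no longer than any block `φ^k(b)` lies inside two consecutive such blocks. -/
lemma exists_factorAt_infix (φ : A → List A) (a : A) (α : ℕ → A) (hpro : Prolongable φ a)
    (hfix : IsFixedSeq φ a α) (n k : ℕ) (hk : ∀ b, n ≤ ((wordMap φ)^[k] [b]).length) (i : ℕ) :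
    ∃ b c, factorAt α i n <:+: (wordMap φ)^[k] [b] ++ (wordMap φ)^[k] [c] := by
  obtain ⟨m, hm, hkm⟩ :=
    ((hpro.2.eventually_ge_atTop (i + n)).and (eventually_ge_atTop k)).exists
  obtain ⟨l, rfl⟩ := Nat.exists_eq_add_of_le hkm
  apply exists_infix_append_of_infix_flatMap (fun b => (wordMap φ)^[k] [b]) a _
    ((wordMap φ)^[l] [a])
  · simpa [length_factorAt] using hk
  · rw [← wordMap_iterate_eq_flatMap, ← Function.iterate_add_apply, ← hfix (k + l)]
    obtain ⟨r, hr⟩ := Nat.exists_eq_add_of_le hm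
    rw [hr, factorAt_add, factorAt_add, Nat.zero_add]
    exact List.infix_append _ _ _

lemma complexity_le_of_block_length [Fintype A] (φ : A → List A) (a : A) (α : ℕ → A)
    (hpro : Prolongable φ a) (hfix : IsFixedSeq φ a α) (n k M : ℕ)
    (hk : ∀ b, n ≤ ((wordMap φ)^[k] [b]).length)
    (hM : ∀ b, ((wordMap φ)^[k] [b]).length ≤ M) :
    complexity α n ≤ Fintype.card A * Fintype.card A * (2 * M + 1) := by
  classical
  let g : A × A × Fin (2 * M + 1) → List A := fun x =>
    (((wordMap φ)^[k] [x.1] ++ (wordMap φ)^[k] [x.2.1]).drop x.2.2).take n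
  have hsub : Set.range (fun i => factorAt α i n) ⊆ Set.range g := by
    rintro _ ⟨i, rfl⟩
    obtain ⟨b, c, s, t, h⟩ := exists_factorAt_infix φ a α hpro hfix n k hk i
    have hs : s.length < 2 * M + 1 := by
      have h1 := congrArg List.length h
      have hb := hM b
      have hc := hM c
      simp only [List.length_append] at h1
      omega
    refine ⟨(b, c, ⟨s.length, hs⟩), ?_⟩
    simp [g, ← h, List.take_left', length_factorAt]
  unfold complexity
  rw [setOf_isFactor_eq_range]
  calc _ ≤ (Set.range g).ncard := Set.ncard_le_ncard hsub (Set.finite_range g)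
    _ ≤ Nat.card (A × A × Fin (2 * M + 1)) := by
      rw [← Set.image_univ, ← Set.ncard_univ]
      exact Set.ncard_image_le Set.finite_univ
    _ = _ := by simp [mul_assoc]

/-- Uniform two-sided bounds on block lengths for a quasi-uniform morphism. -/
lemma QuasiUniform.exists_bounds [Finite A] {φ : A → List A} (hqu : QuasiUniform φ) :
    ∃ β c C : ℝ, 1 < β ∧ 0 < c ∧ 0 < C ∧ ∀ᶠ k : ℕ in atTop, ∀ b,
      c * β ^ k ≤ ((wordMap φ)^[k] [b]).length ∧ ((wordMap φ)^[k] [b]).length ≤ C * β ^ k := by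
  obtain ⟨β, hβ, h⟩ := hqu
  have hβ0 : 0 < β := by linarith
  choose C hC0 hC using fun b => (h b).1.exists_pos
  choose D hD0 hD using fun b => (h b).2.exists_pos
  obtain ⟨C', hC'⟩ := (Set.finite_range C).bddAbove
  obtain ⟨D', hD'⟩ := (Set.finite_range D).bddAbove
  have hE0 : 0 < max D' 1 := by positivity
  refine ⟨β, (max D' 1)⁻¹, max C' 1, hβ, by positivity, by positivity, ?_⟩
  have hev : ∀ b, ∀ᶠ k : ℕ in atTop, (max D' 1)⁻¹ * β ^ k ≤ ((wordMap φ)^[k] [b]).length ∧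
      ((wordMap φ)^[k] [b]).length ≤ max C' 1 * β ^ k := by
    intro b
    filter_upwards [(hC b).bound, (hD b).bound] with k h1 h2
    have hpow : 0 < β ^ k := pow_pos hβ0 k
    simp only [Real.norm_natCast, Real.norm_of_nonneg hpow.le] at h1 h2
    have hCb : C b ≤ max C' 1 := (hC' ⟨b, rfl⟩).trans (le_max_left _ _)
    have hDb : D b ≤ max D' 1 := (hD' ⟨b, rfl⟩).trans (le_max_left _ _)
    constructor
    · rw [inv_mul_le_iff₀ hE0]
      exact h2.trans (by gcongr)
    · exact h1.trans (by gcongr)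
  exact eventually_all.2 hev

/-- Powers of `β` hit every scale, up to a factor `β` and with arbitrarily large exponent. -/
lemma eventually_exists_pow_between {β c : ℝ} (hβ : 1 < β) (hc : 0 < c) (K : ℕ) :
    ∀ᶠ n : ℕ in atTop, ∃ k, K ≤ k ∧ (n : ℝ) ≤ c * β ^ k ∧ c * β ^ k ≤ β * n := by
  have hβ0 : 0 < β := by linarith
  filter_upwards [tendsto_natCast_atTop_atTop.eventually_gt_atTop (c * β ^ K)] with n hn
  have hex : ∃ k : ℕ, (n : ℝ) ≤ c * β ^ k :=
    (((tendsto_pow_atTop_atTop_of_one_lt hβ).const_mul_atTop hc).eventually_ge_atTop _).exists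
  classical
  have hspec := Nat.find_spec hex
  have hmin : ∀ m < Nat.find hex, c * β ^ m < n := fun m hm => not_le.1 (Nat.find_min hex hm)
  have hlt : K < Nat.find hex := by
    by_contra! hle
    have : c * β ^ Nat.find hex ≤ c * β ^ K := by gcongr; exact hβ.le
    linarith
  obtain ⟨m, hm⟩ := Nat.exists_eq_succ_of_ne_zero (by omega : Nat.find hex ≠ 0)
  refine ⟨Nat.find hex, hlt.le, hspec, ?_⟩
  have := hmin m (by omega)
  rw [hm, Nat.succ_eq_add_one, pow_succ]
  nlinarith

lemma complexity_isBigO [Fintype A] (φ : A → List A) (a : A) (α : ℕ → A)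
    (hqu : QuasiUniform φ) (hpro : Prolongable φ a) (hfix : IsFixedSeq φ a α) :
    (fun n => (complexity α n : ℝ)) =O[atTop] (fun n => (n : ℝ)) := by
  obtain ⟨β, c, C, hβ, hc, hC, hev⟩ := hqu.exists_bounds
  obtain ⟨K, hK⟩ := eventually_atTop.1 hev
  apply IsBigO.of_bound ((Fintype.card A * Fintype.card A : ℝ) * (2 * (C * (β / c)) + 1))
  filter_upwards [eventually_exists_pow_between hβ hc K, eventually_ge_atTop 1] with n hn hn1
  obtain ⟨k, hKk, hnk, hkn⟩ := hn
  have hn1' : (1 : ℝ) ≤ n := by exact_mod_cast hn1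
  have hpow : β ^ k ≤ β / c * n := by
    rw [div_mul_eq_mul_div, le_div_iff₀ hc]
    linarith
  have hfloor : (⌊C * β ^ k⌋₊ : ℝ) ≤ C * (β / c * n) :=
    (Nat.floor_le (by positivity)).trans (by gcongr)
  have hle := complexity_le_of_block_length φ a α hpro hfix n k ⌊C * β ^ k⌋₊
    (fun b => by exact_mod_cast hnk.trans (hK k hKk b).1)
    (fun b => Nat.le_floor (hK k hKk b).2)
  have hle' : (complexity α n : ℝ) ≤
      (Fintype.card A * Fintype.card A : ℝ) * (2 * ⌊C * β ^ k⌋₊ + 1) := by exact_mod_cast hle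
  rw [Real.norm_natCast, Real.norm_natCast, mul_assoc]
  refine hle'.trans ?_
  gcongr
  linarith

/-- A quasi-uniform growing morphism yields a pure morphic sequence of complexity Θ(n)
(when not ultimately periodic). -/
theorem quasiUniform_complexity {A : Type*} [Fintype A] (φ : A → List A) (a : A) (α : ℕ → A)
    (hg : Growing φ) (hqu : QuasiUniform φ) (hpro : Prolongable φ a)
    (hfix : IsFixedSeq φ a α) (hnp : ¬ UltimatelyPeriodic α) :
    (fun n => (complexity α n : ℝ)) =Θ[atTop] (fun n => (n : ℝ)) := by
  refine ⟨complexity_isBigO φ a α hqu hpro hfix, IsBigO.of_bound 1 ?_⟩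
  filter_upwards with n
  rw [Real.norm_natCast, Real.norm_natCast, one_mul]
  exact_mod_cast le_complexity α hnp n
end
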